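/- Let p be a prime and let H be a subgroup of the symmetric group S_n acting primitively on {1, …, n}, with p dividing |H|, with abelian Sylow p-subgroups, and with no proper normal subgroup of index coprime to p (i.e. H = O^{p'}(H)). If every H-orbit on the power set of {1, …, n} has size coprime to p (i.e. H is p-concealed), then H has an irreducible complex character χ whose degree has p-part exactly p, i.e. p divides χ(1) but p^2 does not divide χ(1). -/

import Mathlib

open CategoryTheory MulAction Pointwise

/-- An action of `G` on `X` is primitive if it is transitive and its only blocks are
the trivial ones (the subsingletons and the whole set). -/
def IsPrimitiveAction (G X : Type*) [Group G] [MulAction G X] : Prop :=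
  MulAction.IsPretransitive G X ∧
    ∀ B : Set X, MulAction.IsBlock G B → MulAction.IsTrivialBlock B

section
open Finset
set_option linter.unusedSectionVars false
set_option linter.unusedSimpArgs false
set_option linter.unusedVariables false

theorem repG {G T : Type} [Group G] [Finite G] [Fintype T] [DecidableEq T] [MulAction G T]
    (P : Matrix T T ℂ) (hinv : ∀ (g : G) t t', P (g • t) (g • t') = P t t') (hid : P * P = P)
    (hne : P ≠ 0)
    (hcomm : ∀ M : Matrix T T ℂ, (∀ (g : G) t t', M (g • t) (g • t') = M t t') → P * M * P = M →
      ∃ c : ℂ, M = c • P) :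
    ∃ V : FDRep ℂ G, Simple V ∧ (Module.finrank ℂ V : ℂ) = P.trace := by
  classical
  let ρ0 : Representation ℂ G (T → ℂ) :=
    { toFun := fun g => LinearMap.funLeft ℂ ℂ (fun t => g⁻¹ • t)
      map_one' := by ext; simp
      map_mul' := fun a b => by ext; simp [LinearMap.funLeft_apply, mul_smul] }
  have hρ0 : ∀ g (f : T → ℂ) t, ρ0 g f t = f (g⁻¹ • t) := fun g f t => rfl
  let p : (T → ℂ) →ₗ[ℂ] (T → ℂ) := Matrix.toLin' P
  have hpe : ∀ f t, p f t = ∑ s, P t s * f s := fun f t => by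
    simp [p, Matrix.mulVec, dotProduct]
  have hpp : ∀ f, p (p f) = p f := fun f => by simp [p, hid]
  have hcom : ∀ g f, ρ0 g (p f) = p (ρ0 g f) := by
    intro g f
    ext t
    rw [hρ0, hpe, hpe, ← Equiv.sum_comp (MulAction.toPerm g⁻¹)]
    refine sum_congr rfl fun s _ => ?_
    simp only [MulAction.toPerm_apply, hinv, hρ0]
  let E := LinearMap.range p
  have hE : ∀ f ∈ E, p f = f := by rintro _ ⟨f, rfl⟩; exact hpp f
  have hEg : ∀ g, ∀ f ∈ E, ρ0 g f ∈ E := by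
    rintro g _ ⟨f, rfl⟩; exact ⟨ρ0 g f, (hcom g f).symm⟩
  let ρ : Representation ℂ G E :=
    { toFun := fun g => (ρ0 g).restrict (hEg g)
      map_one' := by ext; simp
      map_mul' := fun a b => by ext; simp }
  have hρ : ∀ g (x : E), ((ρ g x : E) : T → ℂ) = ρ0 g x := fun g x => rfl
  let V : FDRep ℂ G := FDRep.of ρ
  have hfin : (Module.finrank ℂ V : ℂ) = P.trace := by
    have h := LinearMap.IsProj.trace (R := ℂ) (p := E) (f := p)
      ⟨fun x => LinearMap.mem_range_self p x, fun x hx => hE x hx⟩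
    have h2 : Matrix.trace P = LinearMap.trace ℂ (T → ℂ) p := by
      simp [p]
    rw [h2, h]
  refine ⟨V, ?_, hfin⟩
  have : NeZero (Nat.card G : ℂ) := ⟨by exact_mod_cast Nat.card_pos.ne'⟩
  rw [FDRep.simple_iff_end_is_rank_one]
  have hEne : ∃ x : E, x ≠ 0 := by
    by_contra h
    push Not at h
    apply hne
    have : p = 0 := by
      refine LinearMap.ext fun f => ?_
      exact congrArg Subtype.val (h ⟨_, LinearMap.mem_range_self p f⟩)
    simpa [p] using this
  have key : ∀ f : V ⟶ V, ∃ c : ℂ, ∀ x : E, (f.hom.hom.hom : E →ₗ[ℂ] E) x = c • x := by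
    intro f
    set φ : E →ₗ[ℂ] E := f.hom.hom.hom with hφ
    have hcφ : ∀ g x, φ (ρ g x) = ρ g (φ x) := by
      intro g x
      have := f.comm g
      have h2 := congrArg (fun u => (u.hom.hom : E →ₗ[ℂ] E) x) this
      exact h2
    let pr : (T → ℂ) →ₗ[ℂ] E := LinearMap.rangeRestrict p
    let L : (T → ℂ) →ₗ[ℂ] (T → ℂ) := E.subtype ∘ₗ φ ∘ₗ pr
    have hL : ∀ f, L f = (φ (pr f) : T → ℂ) := fun f => rfl
    have hprE : ∀ x : E, pr x = x := fun x => Subtype.ext (hE x x.2)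
    have hprg : ∀ g f, pr (ρ0 g f) = ρ g (pr f) := fun g f => Subtype.ext (hcom g f).symm
    have hLg : ∀ g f, L (ρ0 g f) = ρ0 g (L f) := by
      intro g f; rw [hL, hprg, hcφ, hL, hρ]
    obtain ⟨c, hc⟩ := hcomm (LinearMap.toMatrix' L) (by
        intro g t t'
        have h1 : (Pi.single (g • t') 1 : T → ℂ) = ρ0 g (Pi.single t' 1) := by
          ext s
          rw [hρ0]
          simp only [Pi.single_apply, inv_smul_eq_iff]
        rw [LinearMap.toMatrix'_apply, LinearMap.toMatrix'_apply]
        simp only [h1, hLg, hρ0, inv_smul_smul])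
      (by
        apply (Matrix.toLin' (R := ℂ) (m := T) (n := T)).injective
        rw [Matrix.toLin'_mul, Matrix.toLin'_mul, Matrix.toLin'_toMatrix']
        refine LinearMap.ext fun f => ?_
        change p (L (p f)) = L f
        rw [hL, hL]
        have : pr (p f) = pr f := Subtype.ext (hpp f)
        rw [this]
        exact hE _ (φ (pr f)).2)
    refine ⟨c, fun x => Subtype.ext ?_⟩
    have h3 : L = c • p := by
      have := congrArg Matrix.toLin' hc
      rwa [Matrix.toLin'_toMatrix', map_smul] at this
    have h4 := hL x
    rw [hprE] at h4
    rw [← h4, h3]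
    simp [hE x x.2]
  have hhom : ∀ f f' : V ⟶ V,
      (∀ x : E, (f.hom.hom.hom : E →ₗ[ℂ] E) x = (f'.hom.hom.hom : E →ₗ[ℂ] E) x) → f = f' := by
    intro f f' h
    apply Action.hom_ext
    apply InducedCategory.hom_ext
    apply ModuleCat.hom_ext
    exact LinearMap.ext h
  refine finrank_eq_one (𝟙 V) ?_ ?_
  · intro h
    obtain ⟨x, hx⟩ := hEne
    apply hx
    exact congrArg (fun u : V ⟶ V => (u.hom.hom.hom : E →ₗ[ℂ] E) x) h
  · intro f
    obtain ⟨c, hc⟩ := key f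
    refine ⟨c, hhom _ _ fun x => ?_⟩
    rw [hc x]; rfl

theorem repG2 {G T : Type} [Group G] [Finite G] [Fintype T] [DecidableEq T] [MulAction G T]
    (P S : Matrix T T ℂ) (hP : ∀ (g : G) t t', P (g • t) (g • t') = P t t') (hid : P * P = P)
    (hS : ∀ (g : G) t t', S (g • t) (g • t') = S t t') (hPS : P * S = S) (hSP : S * P = S)
    (c : ℂ) (hc : c ≠ 0) (hSS : S * S = c • P) (htr : S.trace = 0) (htP : P.trace ≠ 0)
    (hcomm : ∀ M : Matrix T T ℂ, (∀ (g : G) t t', M (g • t) (g • t') = M t t') → P * M * P = M →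
      ∃ a b : ℂ, M = a • P + b • S) :
    ∃ V : FDRep ℂ G, Simple V ∧ 2 * (Module.finrank ℂ V : ℂ) = P.trace := by
  obtain ⟨d, hd⟩ : ∃ d : ℂ, d ^ 2 = c := IsAlgClosed.exists_pow_nat_eq c two_pos
  have hd0 : d ≠ 0 := by rintro rfl; simp at hd; exact hc hd.symm
  set E : Matrix T T ℂ := (1 / 2 : ℂ) • (P + d⁻¹ • S) with hE
  have hPE : P * E = E := by simp [hE, mul_add, hid, hPS]
  have hEP : E * P = E := by simp [hE, add_mul, hid, hSP]
  have hES : E * S = d • E := by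
    simp only [hE, Matrix.smul_mul, add_mul, hPS, hSS, ← hd, smul_add, smul_smul]
    rw [add_comm]
    congr 2 <;> field_simp
  have hEE : E * E = E := by
    conv_lhs => rw [hE]
    rw [Matrix.smul_mul, add_mul, hPE, Matrix.smul_mul]
    have hSE : S * E = d • E := by
      simp only [hE, Matrix.mul_smul, mul_add, hSP, hSS, ← hd, smul_add, smul_smul]
      rw [add_comm]
      congr 2 <;> field_simp
    rw [hSE, smul_smul, inv_mul_cancel₀ hd0, one_smul, ← two_smul ℂ, smul_smul]
    norm_num
  have htE : E.trace = P.trace / 2 := by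
    simp [hE, htr]; ring
  obtain ⟨V, hV, hV2⟩ := repG (G := G) E (by intro g t t'; simp [hE, hP, hS]) hEE
    (by rintro h; rw [h] at htE; apply htP; simpa using htE.symm) (by
      intro M hM hEM
      obtain ⟨a, b, hab⟩ := hcomm M hM (by
        rw [← hEM]
        calc P * (E * M * E) * P = (P * E) * M * (E * P) := by simp only [Matrix.mul_assoc]
          _ = _ := by rw [hPE, hEP])
      refine ⟨a + b * d, ?_⟩
      have h1 : E * M = M := by
        rw [← hEM]
        calc E * (E * M * E) = (E * E) * M * E := by simp only [Matrix.mul_assoc]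
          _ = _ := by rw [hEE]
      have h2 : M * E = M := by
        rw [← hEM]
        calc E * M * E * E = E * M * (E * E) := by simp only [Matrix.mul_assoc]
          _ = _ := by rw [hEE]
      rw [← h1, hab, mul_add, Matrix.mul_smul E a P, Matrix.mul_smul E b S, hEP, hES, smul_smul b d E,
        ← add_smul])
  exact ⟨V, hV, by rw [hV2, htE]; ring⟩

def MT (G Ω : Type) [Group G] [MulAction G Ω] (m : ℕ) : Prop :=
  ∀ (s : Finset Ω) (f : Ω → Ω), s.card ≤ m → Set.InjOn f s → ∃ g : G, ∀ x ∈ s, g • x = f x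

section extpow
variable {Ω : Type} [Fintype Ω] [DecidableEq Ω] {k : ℕ}

noncomputable def cpd (k : ℕ) (A : Matrix Ω Ω ℂ) : Matrix (Fin k → Ω) (Fin k → Ω) ℂ :=
  fun t t' => (k.factorial : ℂ)⁻¹ * (A.submatrix t t').det

theorem cpd_mul (A B : Matrix Ω Ω ℂ) : cpd k A * cpd k B = cpd k (A * B) := by
  have h1 : ∀ t t' : Fin k → Ω, ((A * B).submatrix t t').det =
      ∑ s : Fin k → Ω, (∏ i, A (t i) (s i)) * (B.submatrix s t').det := by
    intro t t'
    have h := (Matrix.detRowAlternating (n := Fin k) (R := ℂ)).toMultilinearMap.map_sum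
      (fun (i : Fin k) (x : Ω) => fun j => A (t i) x * B x (t' j))
    have e : ((A * B).submatrix t t') = fun i => ∑ x : Ω, fun j => A (t i) x * B x (t' j) := by
      ext i j; simp [Matrix.mul_apply]
    rw [e]
    refine h.trans (sum_congr rfl fun s _ => ?_)
    have := (Matrix.detRowAlternating (n := Fin k) (R := ℂ)).toMultilinearMap.map_smul_univ
      (fun i => A (t i) (s i)) (fun i j => B (s i) (t' j))
    exact this
  ext t t'
  have h0 : (k.factorial : ℂ) ≠ 0 := by exact_mod_cast k.factorial_ne_zero
  rw [Matrix.mul_apply]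
  simp only [cpd]
  have h2 : ∑ s : Fin k → Ω, (A.submatrix t s).det * (B.submatrix s t').det =
      k.factorial * ((A * B).submatrix t t').det := by
    simp_rw [Matrix.det_apply' (A.submatrix t _), sum_mul]
    rw [sum_comm]
    have : ∀ σ : Equiv.Perm (Fin k), ∑ s : Fin k → Ω,
        (Equiv.Perm.sign σ : ℂ) * (∏ i, (A.submatrix t s) (σ i) i) * (B.submatrix s t').det =
        ((A * B).submatrix t t').det := by
      intro σ
      have := h1 (t ∘ σ) t'
      have h3 : ((A * B).submatrix (t ∘ σ) t').det =
          (Equiv.Perm.sign σ : ℂ) * ((A * B).submatrix t t').det :=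
        Matrix.det_permute σ ((A * B).submatrix t t')
      simp_rw [mul_assoc, ← mul_sum]
      simp only [Matrix.submatrix_apply]
      simp only [Function.comp] at this
      rw [← this]
      rw [h3, ← mul_assoc]
      rcases Int.units_eq_one_or (Equiv.Perm.sign σ) with h | h <;> simp [h]
    rw [sum_congr rfl fun σ _ => this σ]
    simp [Fintype.card_perm]
  calc _ = (k.factorial : ℂ)⁻¹ * (k.factorial : ℂ)⁻¹ *
        ∑ s : Fin k → Ω, (A.submatrix t s).det * (B.submatrix s t').det := by
        rw [mul_sum]; exact sum_congr rfl fun s _ => by ring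
    _ = _ := by rw [h2]; field_simp

noncomputable def sz (Ω : Type) [Fintype Ω] [DecidableEq Ω] : Matrix Ω Ω ℂ :=
  fun x y => (if x = y then 1 else 0) - (Fintype.card Ω : ℂ)⁻¹

theorem sz_col [Nonempty Ω] (y : Ω) : ∑ x, sz Ω x y = 0 := by
  simp [sz, sum_sub_distrib]

theorem sz_row [Nonempty Ω] (y : Ω) : ∑ x, sz Ω y x = 0 := by
  simp [sz, sum_sub_distrib]

theorem sz_mul [Nonempty Ω] : sz Ω * sz Ω = sz Ω := by
  ext x y
  rw [Matrix.mul_apply]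
  conv_lhs => enter [2, z]; rw [sz]
  simp only [sub_mul, sum_sub_distrib, ← mul_sum, sz_col]
  simp

theorem cpd_diag (t : Fin k → Ω) (ht : Function.Injective t) :
    cpd k (sz Ω) t t = (k.factorial : ℂ)⁻¹ * (1 - k * (Fintype.card Ω : ℂ)⁻¹) := by
  rw [cpd]
  congr 1
  have : (sz Ω).submatrix t t = 1 - Matrix.replicateCol Unit (fun _ => (Fintype.card Ω : ℂ)⁻¹) *
      Matrix.replicateRow Unit (fun _ => (1 : ℂ)) := by
    ext i j
    simp [sz, Matrix.mul_apply, Matrix.one_apply, ht.eq_iff]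
  rw [this, Matrix.det_one_sub_mul_comm]
  simp [Matrix.mul_apply]

theorem cpd_trace (hk : k + 1 ≤ Fintype.card Ω) :
    (cpd k (sz Ω)).trace = ((Fintype.card Ω - 1).choose k : ℂ) := by
  classical
  have hn : (Fintype.card Ω : ℂ) ≠ 0 := by
    have : Fintype.card Ω ≠ 0 := by omega
    exact_mod_cast this
  have h1 : ∀ t : Fin k → Ω, cpd k (sz Ω) t t = if Function.Injective t then
      (k.factorial : ℂ)⁻¹ * (1 - k * (Fintype.card Ω : ℂ)⁻¹) else 0 := by
    intro t
    split_ifs with ht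
    · exact cpd_diag t ht
    · rw [Function.Injective] at ht
      push Not at ht
      obtain ⟨i, j, hij, hne⟩ := ht
      rw [cpd, Matrix.det_zero_of_row_eq hne (by ext l; simp [hij]), mul_zero]
  rw [Matrix.trace]
  simp only [Matrix.diag_apply, h1]
  rw [← sum_filter, sum_const, nsmul_eq_mul]
  have h2 : (univ.filter fun t : Fin k → Ω => Function.Injective t).card =
      (Fintype.card Ω).descFactorial k := by
    rw [← Fintype.card_subtype, ← Fintype.card_congr (Equiv.subtypeInjectiveEquivEmbedding _ _).symm,
      Fintype.card_embedding_eq, Fintype.card_fin]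
  rw [h2, Nat.descFactorial_eq_factorial_mul_choose]
  have h3 : Fintype.card Ω * (Fintype.card Ω - 1).choose k =
      (Fintype.card Ω).choose k * (Fintype.card Ω - k) := by
    obtain ⟨m, hm⟩ : ∃ m, Fintype.card Ω = m + 1 := ⟨Fintype.card Ω - 1, by omega⟩
    rw [hm]
    have := Nat.add_one_mul_choose_eq m k
    have h4 := Nat.choose_mul_succ_eq m k
    simp only [Nat.add_sub_cancel] at *
    rw [mul_comm, h4]
  have h5 : (k.factorial : ℂ) ≠ 0 := by exact_mod_cast k.factorial_ne_zero
  have h6 := congrArg (fun x : ℕ => (x : ℂ)) h3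
  push_cast [Nat.cast_sub (show k ≤ Fintype.card Ω by omega)] at h6
  push_cast
  field_simp
  linear_combination -h6

def Good (N : Matrix (Fin k → Ω) (Fin k → Ω) ℂ) : Prop :=
  (∀ (σ : Equiv.Perm (Fin k)) t t', N (t ∘ σ) t' = Equiv.Perm.sign σ * N t t') ∧
  (∀ (σ : Equiv.Perm (Fin k)) t t', N t (t' ∘ σ) = Equiv.Perm.sign σ * N t t') ∧
  (∀ t t', ¬ Function.Injective t → N t t' = 0) ∧
  (∀ t t', ¬ Function.Injective t' → N t t' = 0) ∧
  (∀ t t' j, ∑ x, N (Function.update t j x) t' = 0)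

theorem good_cpd_aux [Nonempty Ω] :
    (∀ (σ : Equiv.Perm (Fin k)) t t', cpd k (sz Ω) (t ∘ σ) t' =
      Equiv.Perm.sign σ * cpd k (sz Ω) t t') ∧
    (∀ t t', ¬ Function.Injective t → cpd k (sz Ω) t t' = 0) ∧
    (∀ t t' j, ∑ x, cpd k (sz Ω) (Function.update t j x) t' = 0) := by
  refine ⟨fun σ t t' => ?_, fun t t' ht => ?_, fun t t' j => ?_⟩
  · have h3 : ((sz Ω).submatrix (t ∘ σ) t').det =
          (Equiv.Perm.sign σ : ℂ) * ((sz Ω).submatrix t t').det :=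
        Matrix.det_permute σ ((sz Ω).submatrix t t')
    rw [cpd, cpd, h3]; ring
  · rw [Function.Injective] at ht
    push Not at ht
    obtain ⟨i, j, hij, hne⟩ := ht
    rw [cpd, Matrix.det_zero_of_row_eq hne (by ext l; simp [hij]), mul_zero]
  · simp only [cpd, ← mul_sum]
    have h : ∀ x, ((sz Ω).submatrix (Function.update t j x) t') =
        Matrix.updateRow ((sz Ω).submatrix t t') j (fun l => sz Ω x (t' l)) := by
      intro x
      ext a b
      rw [Matrix.updateRow_apply]
      by_cases hab : a = j
      · subst hab; simp
      · simp [hab]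
    have h2 := (Matrix.detRowAlternating (n := Fin k) (R := ℂ)).toMultilinearMap.map_update_sum
      (t := univ) (i := j) (g := fun x l => sz Ω x (t' l)) (m := (sz Ω).submatrix t t')
    have h3 : ∑ x, ((sz Ω).submatrix (Function.update t j x) t').det = 0 := by
      rw [sum_congr rfl fun x _ => by rw [h x]]
      refine h2.symm.trans ?_
      refine MultilinearMap.map_coord_zero _ j ?_
      refine (Function.update_self (β := fun _ : Fin k => Fin k → ℂ) _ _ _).trans ?_
      ext l
      simp [sz_col]
    rw [h3, mul_zero]

theorem cpd_symm (t t' : Fin k → Ω) : cpd k (sz Ω) t t' = cpd k (sz Ω) t' t := by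
  rw [cpd, cpd, ← Matrix.det_transpose]
  congr 2
  ext i j
  simp [sz, eq_comm]

theorem good_of_cpd [Nonempty Ω] (M : Matrix (Fin k → Ω) (Fin k → Ω) ℂ)
    (hM : cpd k (sz Ω) * M * cpd k (sz Ω) = M) : Good M := by
  obtain ⟨h1, h2, h3⟩ := good_cpd_aux (Ω := Ω) (k := k)
  have hid : cpd k (sz Ω) * cpd k (sz Ω) = cpd k (sz Ω) := by rw [cpd_mul, sz_mul]
  have hl : cpd k (sz Ω) * M = M := by
    rw [← hM, ← Matrix.mul_assoc, ← Matrix.mul_assoc, hid]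
  have hr : M * cpd k (sz Ω) = M := by
    rw [← hM, Matrix.mul_assoc, hid]
  have el : ∀ t t', M t t' = ∑ s, cpd k (sz Ω) t s * M s t' := fun t t' => by
    conv_lhs => rw [← hl, Matrix.mul_apply]
  have er : ∀ t t', M t t' = ∑ s, M t s * cpd k (sz Ω) t' s := fun t t' => by
    conv_lhs => rw [← hr, Matrix.mul_apply]
    exact sum_congr rfl fun s _ => by rw [cpd_symm]
  refine ⟨fun σ t t' => ?_, fun σ t t' => ?_, fun t t' h => ?_, fun t t' h => ?_, fun t t' j => ?_⟩
  · rw [el, el t, mul_sum]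
    exact sum_congr rfl fun s _ => by rw [h1]; ring
  · rw [er, er t t', mul_sum]
    exact sum_congr rfl fun s _ => by rw [h1]; ring
  · rw [el]; exact sum_eq_zero fun s _ => by rw [h2 _ _ h, zero_mul]
  · rw [er]; exact sum_eq_zero fun s _ => by rw [h2 _ _ h, mul_zero]
  · simp_rw [el (Function.update t j _)]
    rw [sum_comm]
    exact sum_eq_zero fun s _ => by rw [← sum_mul, h3, zero_mul]

end extpow

section coreA
variable {Ω : Type} [Fintype Ω] [DecidableEq Ω] {k : ℕ} {G : Type} [Group G] [MulAction G Ω]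

theorem MT.mono {m m' : ℕ} (h : MT G Ω m) (hm : m' ≤ m) : MT G Ω m' :=
  fun s f hs hf => h s f (hs.trans hm) hf

theorem MT.tuple {m : ℕ} (h : MT G Ω m) {ι : Type} [Fintype ι] (hι : Fintype.card ι ≤ m)
    (t t' : ι → Ω) (ht : Function.Injective t) (ht' : Function.Injective t') :
    ∃ g : G, ∀ i, g • t i = t' i := by
  classical
  obtain ⟨g, hg⟩ := h (univ.image t) (Function.extend t t' id)
    ((card_image_le).trans (by simpa using hι)) (by
      intro x hx y hy hxy
      simp only [coe_image, coe_univ, Set.image_univ, Set.mem_range] at hx hy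
      obtain ⟨i, rfl⟩ := hx
      obtain ⟨j, rfl⟩ := hy
      rw [ht.extend_apply, ht.extend_apply] at hxy
      rw [ht' hxy])
  exact ⟨g, fun i => by rw [hg _ (by simp), ht.extend_apply]⟩

theorem exists_perm_of_range {t t' : Fin k → Ω} (ht' : Function.Injective t')
    (h : ∀ i, ∃ j, t j = t' i) : ∃ σ : Equiv.Perm (Fin k), t' = t ∘ σ := by
  choose f hf using h
  have hfi : Function.Injective f := fun a b hab => ht' (by rw [← hf a, ← hf b, hab])
  exact ⟨Equiv.ofBijective f (Finite.injective_iff_bijective.mp hfi), by ext i; simp [hf]⟩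

theorem coreA (hT : MT G Ω (2 * k)) (hk : k + 1 ≤ Fintype.card Ω)
    (N : Matrix (Fin k → Ω) (Fin k → Ω) ℂ) (hN : Good N)
    (hinv : ∀ (g : G) t t', N (g • t) (g • t') = N t t')
    (hd : ∀ t, Function.Injective t → N t t = 0) : N = 0 := by
  obtain ⟨ha1, ha2, hz1, hz2, hc⟩ := hN
  have hperm : ∀ t (σ : Equiv.Perm (Fin k)), Function.Injective t → N (t ∘ σ) t = 0 := by
    intro t σ ht
    rw [ha1, hd t ht, mul_zero]
  have hupd : ∀ t j x, Function.Injective t → (∀ i, t i ≠ x) → N (Function.update t j x) t = 0 := by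
    intro t j x ht hx
    have h1 := hc t t j
    have h2 : ∀ y, N (Function.update t j y) t =
        if y ∈ univ.image t then 0 else N (Function.update t j x) t := by
      intro y
      split_ifs with hy
      · simp only [mem_image, mem_univ, true_and] at hy
        obtain ⟨i, rfl⟩ := hy
        by_cases hij : i = j
        · subst hij; rw [Function.update_eq_self]; exact hd t ht
        · refine hz1 _ _ fun h => hij (h ?_)
          rw [Function.update_self, Function.update_of_ne hij]
      · simp only [mem_image, mem_univ, true_and, not_exists] at hy
        have h1k : 1 ≤ k := by have := j.pos; omega
        obtain ⟨g, hg⟩ := hT.tuple (ι := Option (Fin k)) (by simp; omega)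
          (fun o => o.elim y t) (fun o => o.elim x t)
          (by rintro (_ | a) (_ | b) hab <;> simp_all [ht.eq_iff])
          (by rintro (_ | a) (_ | b) hab <;> simp_all [ht.eq_iff])
        have e1 : g • t = t := by ext i; exact hg (some i)
        have e2 : g • Function.update t j y = Function.update t j x := by
          ext i
          by_cases hij : i = j
          · subst hij; simpa using hg none
          · have := hg (some i); simpa [hij] using this
        rw [← hinv g, e1, e2]
    rw [sum_congr rfl fun y _ => h2 y] at h1
    rw [sum_ite, sum_const_zero, zero_add, sum_const, nsmul_eq_mul] at h1
    rcases mul_eq_zero.mp h1 with h | h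
    · exfalso
      have h' : (univ.filter fun y => y ∉ univ.image t).card = 0 := by
        exact_mod_cast h
      rw [card_eq_zero] at h'
      have : x ∈ (∅ : Finset Ω) := by
        rw [← h']; simpa using hx
      simp at this
    · exact h
  ext t t'
  simp only [Matrix.zero_apply]
  by_cases hi : Function.Injective t
  swap
  · exact hz1 _ _ hi
  by_cases hi' : Function.Injective t'
  swap
  · exact hz2 _ _ hi'
  by_cases h2 : ∃ i j, i ≠ j ∧ (∀ l, t' l ≠ t i) ∧ ∀ l, t' l ≠ t j
  · obtain ⟨i, j, hij, hi1, hj1⟩ := h2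
    obtain ⟨g, hg⟩ := hT (univ.image t ∪ univ.image t') (Equiv.swap (t i) (t j))
      ((card_union_le _ _).trans (by
        have a1 := card_image_le (s := univ) (f := t)
        have a2 := card_image_le (s := univ) (f := t')
        simp only [card_univ, Fintype.card_fin] at a1 a2
        omega)) (Equiv.swap (t i) (t j)).injective.injOn
    have e1 : g • t = t ∘ Equiv.swap i j := by
      ext l
      rw [Pi.smul_apply, hg _ (by simp), Function.comp, hi.map_swap]
    have e2 : g • t' = t' := by
      ext l
      rw [Pi.smul_apply, hg _ (by simp), Equiv.swap_apply_of_ne_of_ne (hi1 l) (hj1 l)]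
    have := hinv g t t'
    rw [e1, e2, ha1, Equiv.Perm.sign_swap hij] at this
    simp only [Units.val_neg, Units.val_one, Int.cast_neg, Int.cast_one] at this
    linear_combination (-1 / 2 : ℂ) * this
  · push Not at h2
    by_cases h1 : ∃ i, ∀ l, t' l ≠ t i
    · obtain ⟨i, hi1⟩ := h1
      have hoth : ∀ j, j ≠ i → ∃ l, t' l = t j := fun j hj => by
        obtain ⟨l, hl⟩ := h2 i j hj.symm hi1
        exact ⟨l, hl⟩
      obtain ⟨m, hm⟩ : ∃ m, ∀ j, j ≠ i → t j ≠ t' m := by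
        by_contra hcon
        push Not at hcon
        choose f hf1 hf2 using hcon
        have : Function.Injective f := fun a b hab => hi' (by rw [← hf2 a, ← hf2 b, hab])
        obtain ⟨m, hm⟩ := (Finite.injective_iff_surjective.mp this) i
        exact hf1 m hm
      have hi2 : Function.Injective (Function.update t i (t' m)) := by
        intro a b hab
        by_cases ha : a = i <;> by_cases hb : b = i
        · rw [ha, hb]
        · subst ha; simp [hb] at hab; exact (hm b hb hab.symm).elim
        · subst hb; simp [ha] at hab; exact (hm a ha hab).elim
        · simp [ha, hb] at hab; exact hi hab
      obtain ⟨σ, hσ⟩ := exists_perm_of_range (t := t') hi2 (by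
        intro a
        by_cases ha : a = i
        · subst ha; exact ⟨m, by simp⟩
        · obtain ⟨l, hl⟩ := hoth a ha; exact ⟨l, by simp [ha, hl]⟩)
      have e : t = Function.update t' (σ i) (t i) ∘ σ := by
        ext a
        by_cases ha : a = i
        · subst ha; simp
        · have := congrFun hσ a
          simp only [Function.comp, Function.update_of_ne ha] at this
          simp [ha, this]
      rw [e, ha1, hupd _ _ _ hi' hi1, mul_zero]
    · push Not at h1
      obtain ⟨σ, hσ⟩ := exists_perm_of_range hi h1
      rw [hσ]
      exact hperm t' σ hi'

theorem cpd_inv (g : G) (t t' : Fin k → Ω) :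
    cpd k (sz Ω) (g • t) (g • t') = cpd k (sz Ω) t t' := by
  rw [cpd, cpd]
  congr 2
  ext i j
  simp [sz]

theorem coreA' (hT : MT G Ω (2 * k)) (hk : k + 1 ≤ Fintype.card Ω)
    (M : Matrix (Fin k → Ω) (Fin k → Ω) ℂ)
    (hinv : ∀ (g : G) t t', M (g • t) (g • t') = M t t')
    (hM : cpd k (sz Ω) * M * cpd k (sz Ω) = M) : ∃ c : ℂ, M = c • cpd k (sz Ω) := by
  have : Nonempty Ω := Fintype.card_pos_iff.mp (by omega)
  have hid : cpd k (sz Ω) * cpd k (sz Ω) = cpd k (sz Ω) := by rw [cpd_mul, sz_mul]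
  obtain ⟨e⟩ : Nonempty (Fin k ↪ Ω) := by
    rw [Function.Embedding.nonempty_iff_card_le]; simp; omega
  have hnz : cpd k (sz Ω) e e ≠ 0 := by
    rw [cpd_diag _ e.injective]
    have h1 : (Fintype.card Ω : ℂ) ≠ 0 := by
      have : Fintype.card Ω ≠ 0 := by omega
      exact_mod_cast this
    have h2 : (Fintype.card Ω : ℂ) - k ≠ 0 := by
      rw [sub_ne_zero]
      have : Fintype.card Ω ≠ k := by omega
      exact_mod_cast this
    have h5 : (k.factorial : ℂ) ≠ 0 := by exact_mod_cast k.factorial_ne_zero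
    refine mul_ne_zero (inv_ne_zero h5) ?_
    intro h
    apply h2
    field_simp at h
    simpa using h
  refine ⟨M e e / cpd k (sz Ω) e e, ?_⟩
  set c := M e e / cpd k (sz Ω) e e with hc
  rw [← sub_eq_zero]
  refine coreA hT hk _ (good_of_cpd _ ?_) (fun g t t' => ?_) (fun t ht => ?_)
  · simp only [mul_sub, sub_mul, hM, Matrix.mul_smul, Matrix.smul_mul, hid]
  · simp [hinv, cpd_inv]
  · obtain ⟨g, hg⟩ := hT.tuple (ι := Fin k) (by simp; omega) t e ht e.injective
    have hge : g • t = e := by ext i; exact hg i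
    have : (M - c • cpd k (sz Ω)) t t = (M - c • cpd k (sz Ω)) e e := by
      rw [← hge]; simp [hinv, cpd_inv]
    rw [this]
    simp [hc, hnz]

theorem theoremA [Finite G] (hT : MT G Ω (2 * k)) (hk : k + 1 ≤ Fintype.card Ω) :
    ∃ V : FDRep ℂ G, Simple V ∧ Module.finrank ℂ V = (Fintype.card Ω - 1).choose k := by
  have : Nonempty Ω := Fintype.card_pos_iff.mp (by omega)
  have htr := cpd_trace (Ω := Ω) hk
  obtain ⟨V, hV, hV2⟩ := repG (G := G) (cpd k (sz Ω)) cpd_inv (by rw [cpd_mul, sz_mul])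
    (by
      intro h
      rw [h, Matrix.trace_zero] at htr
      have : (Fintype.card Ω - 1).choose k ≠ 0 := (Nat.choose_pos (by omega)).ne'
      exact this (by exact_mod_cast htr.symm))
    (fun M hM hM2 => coreA' hT hk M hM hM2)
  exact ⟨V, hV, by rw [htr] at hV2; exact_mod_cast hV2⟩

end coreA

section alt
variable {Ω : Type} [Fintype Ω] [DecidableEq Ω] {k : ℕ} {G : Type} [Group G] [MulAction G Ω]

theorem MT_perm (m : ℕ) : MT (Equiv.Perm Ω) Ω m := by
  intro s f _ hf
  have hb : Set.BijOn f s (f '' s) := hf.bijOn_image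
  let e : {x // x ∈ s} ≃ {x // x ∈ s.image f} :=
    Equiv.ofBijective (fun x => ⟨f x, mem_image_of_mem f x.2⟩) (by
      constructor
      · intro x y hxy
        exact Subtype.ext (hf x.2 y.2 (congrArg Subtype.val hxy))
      · rintro ⟨y, hy⟩
        obtain ⟨x, hx, rfl⟩ := mem_image.mp hy
        exact ⟨⟨x, hx⟩, rfl⟩)
  refine ⟨e.extendSubtype, fun x hx => ?_⟩
  rw [Equiv.Perm.smul_def, Equiv.extendSubtype_apply_of_mem e x hx]
  rfl

theorem signEq_zero (hn : Fintype.card Ω = 2 * k + 1) (N : Matrix (Fin k → Ω) (Fin k → Ω) ℂ)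
    (hN : Good N) (hs : ∀ (σ : Equiv.Perm Ω) t t', N (σ • t) (σ • t') = Equiv.Perm.sign σ * N t t')
    (t t' : Fin k → Ω) (h : N t t' ≠ 0) : Function.Injective (Sum.elim t t') := by
  obtain ⟨ha1, ha2, hz1, hz2, hc⟩ := hN
  have h1 : Function.Injective t := by by_contra h1; exact h (hz1 _ _ h1)
  have h2 : Function.Injective t' := by by_contra h1; exact h (hz2 _ _ h1)
  refine h1.sumElim h2 fun i j hij => h ?_
  have hcard : (univ.image t ∪ univ.image t').card + 2 ≤ Fintype.card Ω := by
    have a1 := card_image_le (s := univ) (f := t)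
    have a2 := card_image_le (s := univ) (f := t')
    have a3 := card_union_add_card_inter (univ.image t) (univ.image t')
    have a4 : 0 < (univ.image t ∩ univ.image t').card :=
      card_pos.mpr ⟨t i, by simp only [mem_inter, mem_image]; exact
        ⟨⟨i, by simp⟩, ⟨j, by simp [hij]⟩⟩⟩
    simp only [card_univ, Fintype.card_fin] at a1 a2
    omega
  obtain ⟨a, ha, b, hb, hab⟩ : ∃ a ∈ (univ.image t ∪ univ.image t')ᶜ,
      ∃ b ∈ (univ.image t ∪ univ.image t')ᶜ, a ≠ b := by
    apply one_lt_card.mp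
    rw [card_compl]; omega
  simp only [mem_compl, mem_union, mem_image, mem_univ, true_and,
    not_or, not_exists] at ha hb
  have := hs (Equiv.swap a b) t t'
  have e1 : Equiv.swap a b • t = t := by
    ext l; exact Equiv.swap_apply_of_ne_of_ne (ha.1 l) (hb.1 l)
  have e2 : Equiv.swap a b • t' = t' := by
    ext l; exact Equiv.swap_apply_of_ne_of_ne (ha.2 l) (hb.2 l)
  rw [e1, e2, Equiv.Perm.sign_swap hab] at this
  simp only [Units.val_neg, Units.val_one, Int.cast_neg, Int.cast_one] at this
  linear_combination (1 / 2 : ℂ) * this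

theorem signEq_eq (t t' s s' : Fin k → Ω) (h : Function.Injective (Sum.elim t t'))
    (h' : Function.Injective (Sum.elim s s')) :
    ∃ σ : Equiv.Perm Ω, σ • t = s ∧ σ • t' = s' := by
  obtain ⟨σ, hσ⟩ := (MT_perm (Ω := Ω) (2 * k)).tuple (ι := Fin k ⊕ Fin k)
    (by simp; omega) _ _ h h'
  exact ⟨σ, by ext i; exact hσ (.inl i), by ext i; exact hσ (.inr i)⟩

theorem altRep [Finite G] (hk : 1 ≤ k) (hn : Fintype.card Ω = 2 * k + 1)
    (hA : ∀ σ : Equiv.Perm Ω, Equiv.Perm.sign σ = 1 → ∃ g : G, ∀ x, g • x = σ x) :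
    ∃ V : FDRep ℂ G, Simple V ∧ (Module.finrank ℂ V = (2 * k).choose k ∨
      2 * Module.finrank ℂ V = (2 * k).choose k) := by
  have hne : Nonempty Ω := Fintype.card_pos_iff.mp (by omega)
  have hk1 : k + 1 ≤ Fintype.card Ω := by omega
  have htr := cpd_trace (Ω := Ω) hk1
  rw [hn, Nat.add_sub_cancel] at htr
  set P := cpd k (sz Ω) with hP
  have hid : P * P = P := by rw [hP, cpd_mul, sz_mul]
  have htr0 : P.trace ≠ 0 := by
    rw [htr]
    have : (2 * k).choose k ≠ 0 := (Nat.choose_pos (by omega)).ne'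
    exact_mod_cast this
  have hPinv : ∀ (σ : Equiv.Perm Ω) t t', P (σ • t) (σ • t') = P t t' := fun σ t t' => cpd_inv σ t t'
  by_cases hcase : ∀ M : Matrix (Fin k → Ω) (Fin k → Ω) ℂ,
      (∀ (g : G) t t', M (g • t) (g • t') = M t t') → P * M * P = M → ∃ c : ℂ, M = c • P
  · obtain ⟨V, hV, hV2⟩ := repG (G := G) P cpd_inv hid
      (by rintro h; rw [h] at htr0; simp at htr0) hcase
    exact ⟨V, hV, .inl (by rw [htr] at hV2; exact_mod_cast hV2)⟩
  push Not at hcase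
  obtain ⟨a, b, hab⟩ : ∃ a b : Ω, a ≠ b := Fintype.exists_pair_of_one_lt_card (by omega)
  set τ := Equiv.swap a b with hτ
  have hsτ : Equiv.Perm.sign τ = -1 := Equiv.Perm.sign_swap hab
  have hdec : ∀ M : Matrix (Fin k → Ω) (Fin k → Ω) ℂ,
      (∀ (g : G) t t', M (g • t) (g • t') = M t t') → P * M * P = M →
      ∃ (c : ℂ) (S : Matrix (Fin k → Ω) (Fin k → Ω) ℂ), M = c • P + S ∧ P * S * P = S ∧
        ∀ (σ : Equiv.Perm Ω) t t', S (σ • t) (σ • t') = Equiv.Perm.sign σ * S t t' := by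
    intro M hM hPM
    have hMe : ∀ σ : Equiv.Perm Ω, Equiv.Perm.sign σ = 1 → ∀ t t', M (σ • t) (σ • t') = M t t' := by
      intro σ hσ t t'
      obtain ⟨g, hg⟩ := hA σ hσ
      have : ∀ t : Fin k → Ω, σ • t = g • t := fun t => by ext i; simp [hg]
      rw [this, this, hM]
    have hMo : ∀ σ : Equiv.Perm Ω, Equiv.Perm.sign σ = -1 →
        ∀ t t', M (σ • t) (σ • t') = M (τ • t) (τ • t') := by
      intro σ hσ t t'
      have := hMe (σ * τ⁻¹) (by simp [hσ, hsτ]) (τ • t) (τ • t')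
      simpa [smul_smul] using this
    set M' : Matrix (Fin k → Ω) (Fin k → Ω) ℂ := fun t t' => M (τ • t) (τ • t') with hM'
    have hτσ : ∀ σ : Equiv.Perm Ω, ∀ t t', M' (σ • t) (σ • t') = M ((τ * σ) • t) ((τ * σ) • t') :=
      fun σ t t' => by simp [hM', smul_smul]
    have hPM' : P * M' * P = M' := by
      have e1 : M' = M.submatrix (MulAction.toPerm τ) (MulAction.toPerm τ) := rfl
      have e2 : P = P.submatrix (MulAction.toPerm τ) (MulAction.toPerm τ) := by
        ext t t'; exact (hPinv τ t t').symm
      rw [e1, e2, Matrix.submatrix_mul_equiv, Matrix.submatrix_mul_equiv, hPM]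
    obtain ⟨c, hc⟩ := coreA' (G := Equiv.Perm Ω) (MT_perm _) hk1 ((1 / 2 : ℂ) • (M + M')) (by
        intro σ t t'
        rcases Int.units_eq_one_or (Equiv.Perm.sign σ) with h | h
        · simp only [Matrix.smul_apply, Matrix.add_apply, hτσ, hMe σ h]
          rw [hMo (τ * σ) (by simp [h, hsτ])]
        · simp only [Matrix.smul_apply, Matrix.add_apply, hτσ, hMo σ h]
          rw [hMe (τ * σ) (by simp [h, hsτ]), add_comm])
      (by rw [← hP]; simp only [mul_add, add_mul, Matrix.mul_smul, Matrix.smul_mul, hPM, hPM'])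
    refine ⟨c, (1 / 2 : ℂ) • (M - M'), ?_, ?_, ?_⟩
    · rw [hP, ← hc, ← smul_add]
      ext t t'; simp; ring
    · simp only [mul_sub, sub_mul, Matrix.mul_smul, Matrix.smul_mul, hPM, hPM']
    · intro σ t t'
      rcases Int.units_eq_one_or (Equiv.Perm.sign σ) with h | h
      · simp only [Matrix.smul_apply, Matrix.sub_apply, hτσ, hMe σ h, h]
        rw [hMo (τ * σ) (by simp [h, hsτ])]; simp [hM']
      · simp only [Matrix.smul_apply, Matrix.sub_apply, hτσ, hMo σ h, h]
        rw [hMe (τ * σ) (by simp [h, hsτ])]; simp [hM']; ring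
  obtain ⟨M, hM, hPM, hMc⟩ := hcase
  obtain ⟨c, S, hS1, hS2, hS3⟩ := hdec M hM hPM
  have hS0 : S ≠ 0 := by
    rintro rfl; exact hMc c (by rw [hS1, add_zero])
  have hSG := good_of_cpd S hS2
  have hSz := signEq_zero hn S hSG hS3
  obtain ⟨s, s', hss⟩ : ∃ s s', S s s' ≠ 0 := by
    by_contra h; push Not at h; exact hS0 (by ext s s'; exact h s s')
  have hPS : P * S = S := by
    rw [← hS2, ← Matrix.mul_assoc, ← Matrix.mul_assoc, hid]
  have hSP : S * P = S := by
    rw [← hS2, Matrix.mul_assoc, hid]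
  have hSd : ∀ t, S t t = 0 := by
    intro t
    by_contra h
    have h1 := hSz t t h
    have h2 := @h1 (.inl ⟨0, hk⟩) (.inr ⟨0, hk⟩) rfl
    cases h2
  obtain ⟨d, hd⟩ := coreA' (G := Equiv.Perm Ω) (k := k) (MT_perm _) hk1 (S * S) (by
      intro σ t t'
      rw [Matrix.mul_apply, Matrix.mul_apply, ← Equiv.sum_comp (MulAction.toPerm σ)]
      refine sum_congr rfl fun r _ => ?_
      rw [MulAction.toPerm_apply, hS3, hS3]
      rcases Int.units_eq_one_or (Equiv.Perm.sign σ) with h | h <;> simp [h])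
    (by rw [← hP, ← Matrix.mul_assoc, hPS, Matrix.mul_assoc, hSP])
  have hd0 : d ≠ 0 := by
    rintro rfl
    rw [zero_smul] at hd
    have h1 := congrFun (congrFun hd s) s
    rw [Matrix.mul_apply] at h1
    have h2 : ∀ r, S s r * S r s = if S s r ≠ 0 then (-1) ^ k * (S s s') ^ 2 else 0 := by
      intro r
      split_ifs with hr
      · have hi := hSz s r hr
        obtain ⟨σ, h3, h4⟩ := signEq_eq s r s s' hi (hSz _ _ hss)
        have h5 := hS3 σ s r
        rw [h3, h4] at h5
        have h6 : S r s = (-1) ^ k * S s r := by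
          have h7 : ∀ m : ℕ, m ≤ k → ∃ σ : Equiv.Perm Ω, Equiv.Perm.sign σ = (-1) ^ m ∧
              (∀ i : Fin k, (i : ℕ) < m → σ (s i) = r i ∧ σ (r i) = s i) ∧
              (∀ i : Fin k, ¬ (i : ℕ) < m → σ (s i) = s i ∧ σ (r i) = r i) := by
            intro m
            have hsr : ∀ i j, s i ≠ r j := fun i j h => by
              have := @hi (.inl i) (.inr j) h
              cases this
            have hsi : ∀ i j, i ≠ j → s i ≠ s j := fun i j hij h => by
              have := @hi (.inl i) (.inl j) h
              simp_all
            have hri : ∀ i j, i ≠ j → r i ≠ r j := fun i j hij h => by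
              have := @hi (.inr i) (.inr j) h
              simp_all
            induction m with
            | zero => intro _; exact ⟨1, by simp⟩
            | succ m ih =>
              intro hm
              obtain ⟨σ, e1, e2, e3⟩ := ih (by omega)
              let l : Fin k := ⟨m, by omega⟩
              refine ⟨σ * Equiv.swap (s l) (r l), ?_, ?_, ?_⟩
              · rw [Equiv.Perm.sign_mul, Equiv.Perm.sign_swap (hsr l l), e1, pow_succ]
              · intro i him
                by_cases hil : i = l
                · subst hil
                  have := e3 l (by simp [l])
                  simp [this]
                · have him' : (i : ℕ) < m := by
                    have : (i : ℕ) ≠ m := fun h => hil (Fin.ext h)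
                    omega
                  have := e2 i him'
                  rw [Equiv.Perm.mul_apply, Equiv.Perm.mul_apply,
                    Equiv.swap_apply_of_ne_of_ne (hsi i l hil) (hsr i l),
                    Equiv.swap_apply_of_ne_of_ne (hsr l i).symm (hri i l hil)]
                  exact this
              · intro i him
                have hil : i ≠ l := by rintro rfl; simp [l] at him
                have := e3 i (by omega)
                rw [Equiv.Perm.mul_apply, Equiv.Perm.mul_apply,
                    Equiv.swap_apply_of_ne_of_ne (hsi i l hil) (hsr i l),
                    Equiv.swap_apply_of_ne_of_ne (hsr l i).symm (hri i l hil)]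
                exact this
          obtain ⟨ρ, r1, r2, -⟩ := h7 k le_rfl
          have h8 := hS3 ρ s r
          have e1 : ρ • s = r := by ext i; exact (r2 i i.2).1
          have e2 : ρ • r = s := by ext i; exact (r2 i i.2).2
          rw [e1, e2, r1] at h8
          simpa using h8
        rw [h6, h5]
        rcases Int.units_eq_one_or (Equiv.Perm.sign σ) with h | h <;> simp [h] <;> ring
      · push Not at hr
        rw [hr, zero_mul]
    rw [sum_congr rfl fun r _ => h2 r, ← sum_filter, sum_const,
      nsmul_eq_mul] at h1
    simp only [Matrix.zero_apply, mul_eq_zero, pow_eq_zero_iff', neg_eq_zero, one_ne_zero,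
      false_and, hss, false_or, or_false, Nat.cast_eq_zero, card_eq_zero] at h1
    have : s' ∈ (∅ : Finset (Fin k → Ω)) := by rw [← h1]; simp [hss]
    simp at this
  obtain ⟨V, hV, hV2⟩ := repG2 (G := G) P S cpd_inv hid
    (by
      intro g t t'
      have h := hM g t t'
      rw [hS1] at h
      simp only [Matrix.add_apply, Matrix.smul_apply, hP, cpd_inv] at h
      exact add_left_cancel h)
    hPS hSP d hd0 hd (by simp [Matrix.trace, hSd]) htr0 (by
      intro M' hM' hPM'
      obtain ⟨c', S', h1, h2, h3⟩ := hdec M' hM' hPM'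
      refine ⟨c', S' s s' / S s s', ?_⟩
      rw [h1]
      congr 1
      rw [← sub_eq_zero]
      set e := S' s s' / S s s' with he
      have hD3 : ∀ (σ : Equiv.Perm Ω) t t', (S' - e • S) (σ • t) (σ • t') =
          Equiv.Perm.sign σ * (S' - e • S) t t' := by
        intro σ t t'
        simp only [Matrix.sub_apply, Matrix.smul_apply, h3, hS3, smul_eq_mul]; ring
      have hDz := signEq_zero hn (S' - e • S) (good_of_cpd _ (by
        rw [← hP]; simp only [mul_sub, sub_mul, Matrix.mul_smul, Matrix.smul_mul, h2, hS2])) hD3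
      ext t t'
      by_contra hne
      obtain ⟨σ, h5, h6⟩ := signEq_eq t t' s s' (hDz t t' hne) (hSz _ _ hss)
      have h7 := hD3 σ t t'
      rw [h5, h6] at h7
      have h8 : (S' - e • S) s s' = 0 := by simp [he, hss]
      rw [h8] at h7
      apply hne
      exact (mul_eq_zero.mp h7.symm).resolve_left (by simp))
  exact ⟨V, hV, .inr (by rw [htr] at hV2; exact_mod_cast hV2)⟩

end alt

section syl
variable {G Ω : Type} [Group G] [Finite G] [Fintype Ω] [DecidableEq Ω] [MulAction G Ω]
  {p : ℕ} [hp : Fact p.Prime]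

def Stb (Q : Sylow p G) (s : Finset Ω) : Prop := ∀ g ∈ Q, g • s = s
def Pw (Q : Sylow p G) (s : Finset Ω) : Prop := ∀ g ∈ Q, ∀ x ∈ s, g • x = x
def Fx (p : ℕ) (G : Type) {Ω : Type} [Group G] [MulAction G Ω] (s : Finset Ω) : Prop :=
  ∃ Q : Sylow p G, ∀ g ∈ Q, ∀ x ∈ s, g • x = x

theorem Fx.mono {s t : Finset Ω} (h : Fx p G t) (hs : s ⊆ t) : Fx p G s := by
  obtain ⟨Q, hQ⟩ := h
  exact ⟨Q, fun g hg x hx => hQ g hg x (hs hx)⟩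

theorem conj_syl (Q : Sylow p G) (k : G) : ∃ Q' : Sylow p G, ∀ x, x ∈ Q ↔ k * x * k⁻¹ ∈ Q' := by
  refine ⟨k • Q, fun x => ?_⟩
  rw [← SetLike.mem_coe, ← SetLike.mem_coe, Sylow.coe_smul, Set.mem_smul_set_iff_inv_smul_mem]
  simp [MulAut.smul_def, mul_assoc]

theorem syl_conj (K : Subgroup G) (Q Q' : Sylow p G) (hQ : ∀ x ∈ Q, x ∈ K) (hQ' : ∀ x ∈ Q', x ∈ K) :
    ∃ k ∈ K, ∀ x, x ∈ Q ↔ k * x * k⁻¹ ∈ Q' := by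
  obtain ⟨k, hk⟩ := MulAction.exists_smul_eq K (Q.subtype (N := K) hQ) (Q'.subtype (N := K) hQ')
  rw [Sylow.smul_subtype] at hk
  have hk2 := Sylow.subtype_injective hk
  refine ⟨k, k.2, fun x => ?_⟩
  rw [← hk2]
  rw [← SetLike.mem_coe, ← SetLike.mem_coe]
  change _ ↔ _ ∈ (((k : G) • Q : Sylow p G) : Set G)
  rw [Sylow.coe_smul, Set.mem_smul_set_iff_inv_smul_mem]
  simp [MulAut.smul_def, mul_assoc]

theorem syl_pow (Q : Sylow p G) {g : G} (hg : g ∈ Q) : ∃ j, g ^ p ^ j = 1 := by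
  obtain ⟨j, hj⟩ := Q.isPGroup' ⟨g, hg⟩
  exact ⟨j, by simpa using congrArg Subtype.val hj⟩

def pstab (G : Type) {Ω : Type} [Group G] [MulAction G Ω] (s : Finset Ω) : Subgroup G where
  carrier := {g | ∀ x ∈ s, g • x = x}
  one_mem' := by simp
  mul_mem' := fun {a b} ha hb x hx => by rw [mul_smul, hb x hx, ha x hx]
  inv_mem' := fun {a} ha x hx => by rw [inv_smul_eq_iff, ha x hx]

theorem mem_smulF {g : G} {s : Finset Ω} {x : Ω} : x ∈ g • s ↔ g⁻¹ • x ∈ s :=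
  inv_smul_mem_iff.symm

theorem fix_of_Fx {D : Finset Ω} (hD : Fx p G D) {z : G} (hz : z • D = D) (j : ℕ)
    (hj : z ^ p ^ j = 1) : ∀ x ∈ D, z • x = x := by
  obtain ⟨Q, hQ⟩ := hD
  set K := MulAction.stabilizer G D with hK
  have hle : pstab G D ≤ K := by
    intro g hg
    rw [hK, MulAction.mem_stabilizer_iff]
    ext x
    rw [mem_smulF]
    constructor
    · intro h; have := hg _ h; rw [smul_inv_smul] at this; rwa [this]
    · intro h; have := hg _ h; rw [← this, inv_smul_smul]; exact h
  have hn : ((pstab G D).subgroupOf K).Normal := by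
    constructor
    rintro ⟨n, hn⟩ h1 ⟨k, hk⟩
    rw [Subgroup.mem_subgroupOf] at *
    intro x hx
    simp only [Subgroup.coe_mul, InvMemClass.coe_inv, mul_smul]
    have h2 : k⁻¹ • x ∈ D := by
      rw [← mem_smulF, MulAction.mem_stabilizer_iff.mp hk]; exact hx
    rw [show n • k⁻¹ • x = k⁻¹ • x from h1 _ h2, smul_inv_smul]
  have hidx : ¬ p ∣ ((pstab G D).subgroupOf K).index := by
    intro h
    have h1 : ((pstab G D).subgroupOf K).index ∣ (pstab G D).index :=
      Subgroup.relIndex_dvd_index_of_le hle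
    have h2 : (pstab G D).index ∣ Q.index := Subgroup.index_dvd_of_le (fun g hg => hQ g hg)
    exact Q.not_dvd_index' (Subgroup.FiniteIndex.index_ne_zero) (h.trans (h1.trans h2))
  have hz1 : (⟨z, MulAction.mem_stabilizer_iff.mpr hz⟩ : K) ^ ((pstab G D).subgroupOf K).index ∈
      (pstab G D).subgroupOf K := Subgroup.pow_index_mem _ _
  set m := ((pstab G D).subgroupOf K).index
  have hz2 : z ^ m ∈ pstab G D := by simpa [Subgroup.mem_subgroupOf] using hz1
  have hcop : Nat.Coprime m (p ^ j) :=
    Nat.Coprime.pow_right _ ((Nat.Prime.coprime_iff_not_dvd hp.out).mpr hidx).symm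
  have hz3 : z ∈ pstab G D := by
    have hb := Int.gcd_eq_gcd_ab m (p ^ j : ℕ)
    rw [Int.gcd_natCast_natCast, hcop.gcd_eq_one] at hb
    have : z = (z ^ m) ^ (Int.gcdA m (p ^ j : ℕ)) * (z ^ (p ^ j)) ^ (Int.gcdB m (p ^ j : ℕ)) := by
      rw [← zpow_natCast, ← zpow_natCast, ← zpow_mul, ← zpow_mul, ← zpow_add, ← hb]; simp
    rw [this, hj, one_zpow, mul_one]
    exact Subgroup.zpow_mem _ hz2 _
  exact hz3

theorem pw_of_Fx {D : Finset Ω} (hD : Fx p G D) {Q : Sylow p G} (hQ : Stb Q D) : Pw Q D :=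
  fun g hg => by
    obtain ⟨j, hj⟩ := syl_pow Q hg
    exact fix_of_Fx hD (hQ g hg) j hj

theorem Stb.smul_mem {Q : Sylow p G} {s : Finset Ω} (h : Stb Q s) {g : G} (hg : g ∈ Q) {x : Ω}
    (hx : x ∈ s) : g • x ∈ s := by
  rw [← h g hg]; exact smul_mem_smul_finset hx

theorem stb_of {Q : Sylow p G} {s : Finset Ω} (h : ∀ g ∈ Q, ∀ x ∈ s, g • x ∈ s) : Stb Q s := by
  intro g hg
  refine eq_of_subset_of_card_le ?_ (by simp)
  intro x hx
  rw [mem_smulF] at hx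
  have := h g hg _ hx
  rwa [smul_inv_smul] at this

theorem Pw.stb {Q : Sylow p G} {s : Finset Ω} (h : Pw Q s) : Stb Q s :=
  stb_of fun g hg x hx => by rw [h g hg x hx]; exact hx

open Classical in
noncomputable def Qorb (Q : Sylow p G) (x : Ω) : Finset Ω :=
  univ.filter fun y => ∃ g ∈ Q, g • x = y

theorem mem_Qorb {Q : Sylow p G} {x y : Ω} : y ∈ Qorb Q x ↔ ∃ g ∈ Q, g • x = y := by
  simp [Qorb]

theorem self_mem_Qorb (Q : Sylow p G) (x : Ω) : x ∈ Qorb Q x := mem_Qorb.mpr ⟨1, one_mem _, by simp⟩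

theorem stb_Qorb (Q : Sylow p G) (x : Ω) : Stb Q (Qorb Q x) := by
  refine stb_of fun g hg y hy => ?_
  obtain ⟨h, hh, rfl⟩ := mem_Qorb.mp hy
  exact mem_Qorb.mpr ⟨g * h, mul_mem hg hh, mul_smul _ _ _⟩

theorem Qorb_subset {Q : Sylow p G} {s : Finset Ω} (h : Stb Q s) {x : Ω} (hx : x ∈ s) :
    Qorb Q x ⊆ s := by
  intro y hy
  obtain ⟨g, hg, rfl⟩ := mem_Qorb.mp hy
  exact h.smul_mem hg hx

theorem Qorb_card_pow (Q : Sylow p G) (x : Ω) : ∃ j, (Qorb Q x).card = p ^ j := by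
  have h1 := Q.isPGroup'.card_orbit x
  obtain ⟨j, hj⟩ := h1
  refine ⟨j, ?_⟩
  rw [← hj, ← Fintype.card_coe, ← Nat.card_eq_fintype_card]
  refine Nat.card_congr (Equiv.subtypeEquivRight fun y => ?_)
  rw [mem_Qorb, MulAction.mem_orbit_iff]
  constructor
  · rintro ⟨g, hg, h⟩; exact ⟨⟨g, hg⟩, h⟩
  · rintro ⟨⟨g, hg⟩, h⟩; exact ⟨g, hg, h⟩

theorem Qorb_card_dvd {Q : Sylow p G} {x : Ω} {g : G} (hg : g ∈ Q) (hx : g • x ≠ x) :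
    p ∣ (Qorb Q x).card := by
  obtain ⟨j, hj⟩ := Qorb_card_pow Q x
  rw [hj]
  refine dvd_pow_self p ?_
  rintro rfl
  rw [pow_zero, card_eq_one] at hj
  obtain ⟨a, ha⟩ := hj
  have h1 := self_mem_Qorb Q x
  have h2 : g • x ∈ Qorb Q x := mem_Qorb.mpr ⟨g, hg, rfl⟩
  rw [ha, mem_singleton] at h1 h2
  exact hx (h2.trans h1.symm)

theorem Qorb_card_ge {Q : Sylow p G} {x : Ω} {g : G} (hg : g ∈ Q) (hx : g • x ≠ x) :
    p ≤ (Qorb Q x).card :=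
  Nat.le_of_dvd (card_pos.mpr ⟨x, self_mem_Qorb Q x⟩) (Qorb_card_dvd hg hx)

theorem Fx_of_lt (hc : ∀ s : Finset Ω, ∃ Q : Sylow p G, Stb Q s) {s : Finset Ω} (hs : s.card < p) :
    Fx p G s := by
  obtain ⟨Q, hQ⟩ := hc s
  refine ⟨Q, fun g hg x hx => ?_⟩
  by_contra h
  have := card_le_card (Qorb_subset hQ hx)
  have := Qorb_card_ge hg h
  omega

theorem exists_Z (hc : ∀ s : Finset Ω, ∃ Q : Sylow p G, Stb Q s)
    (hF : ¬ Fx p G (univ : Finset Ω)) : ∃ C : Finset Ω, C.card = p ∧ ¬ Fx p G C := by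
  obtain ⟨Q, -⟩ := hc ∅
  have : ∃ g ∈ Q, ∃ x : Ω, g • x ≠ x := by
    by_contra h
    push Not at h
    exact hF ⟨Q, fun g hg x _ => h g hg x⟩
  obtain ⟨g, hg, x, hx⟩ := this
  obtain ⟨j, hj⟩ := syl_pow Q hg
  have hex : ∃ j, g ^ p ^ j • x = x := ⟨j, by rw [hj, one_smul]⟩
  classical
  have h0 : Nat.find hex ≠ 0 := by
    intro h
    have := Nat.find_spec hex
    rw [h] at this
    exact hx (by simpa using this)
  obtain ⟨i, hi⟩ := Nat.exists_eq_succ_of_ne_zero h0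
  set z := g ^ p ^ i with hz
  have hzx : z • x ≠ x := fun h => by
    have := Nat.find_min' hex h
    omega
  have hzp : z ^ p • x = x := by
    have := Nat.find_spec hex
    rw [hi, Nat.succ_eq_add_one, pow_succ, pow_mul] at this
    exact this
  set D := (range p).image fun l => z ^ l • x with hD
  have hzD : z • D = D := by
    refine eq_of_subset_of_card_le ?_ (by simp)
    intro y hy
    rw [mem_smul_finset] at hy
    obtain ⟨w, hw, rfl⟩ := hy
    rw [hD, mem_image] at hw
    obtain ⟨l, hl, rfl⟩ := hw
    rw [mem_range] at hl
    rw [hD, mem_image, smul_smul, ← pow_succ']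
    rcases Nat.lt_or_ge (l + 1) p with h | h
    · exact ⟨l + 1, mem_range.mpr h, rfl⟩
    · have : l + 1 = p := by omega
      rw [this, hzp]
      exact ⟨0, mem_range.mpr hp.out.pos, by simp⟩
  have hDF : ¬ Fx p G D := by
    intro h
    obtain ⟨j', hj'⟩ := syl_pow Q (pow_mem hg (p ^ i))
    refine hzx (fix_of_Fx h hzD j' hj' x ?_)
    rw [hD, mem_image]
    exact ⟨0, mem_range.mpr hp.out.pos, by simp⟩
  refine ⟨D, le_antisymm (card_image_le.trans (by simp)) ?_, hDF⟩
  by_contra h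
  exact hDF (Fx_of_lt hc (not_le.mp h))

theorem smul_pw {Q Q' : Sylow p G} {k : G} (h : ∀ x, x ∈ Q ↔ k * x * k⁻¹ ∈ Q') {x : Ω} :
    (∀ g ∈ Q, g • x = x) ↔ ∀ g ∈ Q', g • k • x = k • x := by
  constructor
  · intro hx g hg
    have h1 : k⁻¹ * g * k ∈ Q := by rw [h]; simpa [mul_assoc] using hg
    have h2 := hx _ h1
    rw [mul_smul, mul_smul, inv_smul_eq_iff] at h2
    exact h2
  · intro hx g hg
    have h2 := hx _ ((h g).mp hg)
    rw [mul_smul, inv_smul_smul, mul_smul] at h2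
    exact smul_left_cancel _ h2

theorem smul_stb {Q Q' : Sylow p G} {k : G} (h : ∀ x, x ∈ Q ↔ k * x * k⁻¹ ∈ Q') {s : Finset Ω}
    (hs : Stb Q s) : Stb Q' (k • s) := by
  intro g hg
  have h1 : k⁻¹ * g * k ∈ Q := by rw [h]; simpa [mul_assoc] using hg
  have h2 := hs _ h1
  rw [mul_smul, mul_smul, inv_smul_eq_iff] at h2
  exact h2

theorem Fx_smul (k : G) {s : Finset Ω} : Fx p G (k • s) ↔ Fx p G s := by
  have : ∀ (k : G) (s : Finset Ω), Fx p G s → Fx p G (k • s) := by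
    rintro k s ⟨Q, hQ⟩
    obtain ⟨Q', hQ'⟩ := conj_syl Q k
    refine ⟨Q', fun g hg x hx => ?_⟩
    rw [mem_smulF] at hx
    have := (smul_pw hQ').mp (fun g hg => hQ g hg _ hx) g hg
    rwa [smul_inv_smul] at this
  refine ⟨fun h => ?_, this k s⟩
  have h2 := this k⁻¹ _ h
  rwa [inv_smul_smul] at h2

end syl

section syl5
variable {G Ω : Type} [Group G] [Finite G] [Fintype Ω] [DecidableEq Ω] [MulAction G Ω]
  {p : ℕ} [hp : Fact p.Prime]

theorem Qorb_eq {Q : Sylow p G} {x y : Ω} (h : y ∈ Qorb Q x) : Qorb Q y = Qorb Q x := by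
  obtain ⟨g, hg, rfl⟩ := mem_Qorb.mp h
  ext z
  rw [mem_Qorb, mem_Qorb]
  constructor
  · rintro ⟨k, hk, rfl⟩; exact ⟨k * g, mul_mem hk hg, mul_smul _ _ _⟩
  · rintro ⟨k, hk, rfl⟩; exact ⟨k * g⁻¹, mul_mem hk (inv_mem hg), by rw [mul_smul, inv_smul_smul]⟩

theorem Stb.sdiff {Q : Sylow p G} {s t : Finset Ω} (hs : Stb Q s) (ht : Stb Q t) :
    Stb Q (s \ t) := by
  refine stb_of fun g hg x hx => ?_
  rw [mem_sdiff] at *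
  refine ⟨hs.smul_mem hg hx.1, fun h => hx.2 ?_⟩
  have := ht.smul_mem (inv_mem hg) h
  rwa [inv_smul_smul] at this

theorem decomp {Q : Sylow p G} {s : Finset Ω} (hs : s.card < 2 * p) (hF : ¬ Fx p G s)
    (hQ : Stb Q s) : ∃ C ⊆ s, C.card = p ∧ ¬ Fx p G C ∧ Stb Q C ∧ (∀ x ∈ C, Qorb Q x = C) ∧
      Pw Q (s \ C) := by
  have : ∃ x ∈ s, ∃ g ∈ Q, g • x ≠ x := by
    by_contra h
    push Not at h
    exact hF ⟨Q, fun g hg x hx => h x hx g hg⟩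
  obtain ⟨x, hx, g, hg, hgx⟩ := this
  have hsub := Qorb_subset hQ hx
  have h2 := card_le_card hsub
  have h3 := Qorb_card_ge hg hgx
  have h4 : (Qorb Q x).card = p := by
    obtain ⟨c, hc⟩ := Qorb_card_dvd hg hgx
    have hp0 := hp.out.pos
    have : c < 2 := by
      by_contra h
      have : p * 2 ≤ p * c := Nat.mul_le_mul_left _ (by omega)
      omega
    interval_cases c <;> omega
  refine ⟨Qorb Q x, hsub, h4, fun h => ?_, stb_Qorb Q x, fun y hy => Qorb_eq hy, ?_⟩
  · exact hgx (pw_of_Fx h (stb_Qorb Q x) g hg x (self_mem_Qorb Q x))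
  · intro k hk y hy
    by_contra h
    have h5 := card_le_card (Qorb_subset (hQ.sdiff (stb_Qorb Q x)) hy)
    rw [card_sdiff_of_subset hsub] at h5
    have := Qorb_card_ge hk h
    omega

theorem exists_singleton {s C : Finset Ω} (h : C ⊆ s) (hc : s.card = C.card + 1) :
    ∃ a ∈ s, C = s.erase a := by
  have h1 : (s \ C).card = 1 := by rw [card_sdiff_of_subset h]; omega
  obtain ⟨a, ha⟩ := card_eq_one.mp h1
  have ha' : a ∈ s \ C := by rw [ha]; simp
  rw [mem_sdiff] at ha'
  refine ⟨a, ha'.1, eq_of_subset_of_card_le ?_ ?_⟩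
  · intro y hy
    exact mem_erase.mpr ⟨fun h => ha'.2 (h ▸ hy), h hy⟩
  · rw [card_erase_of_mem ha'.1]; omega

theorem smul_erase' (g : G) (s : Finset Ω) (a : Ω) : g • s.erase a = (g • s).erase (g • a) := by
  ext x
  simp only [mem_smulF, mem_erase, ne_eq, inv_smul_eq_iff]

theorem lemP (hc : ∀ s : Finset Ω, ∃ Q : Sylow p G, Stb Q s) {W : Finset Ω} (hW : W.card = p + 1)
    {a b : Ω} (hab : a ≠ b) (ha : a ∈ W) (hb : b ∈ W) (hFa : ¬ Fx p G (W.erase a))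
    (hFb : ¬ Fx p G (W.erase b)) {c : Ω} (hcW : c ∈ W) : ¬ Fx p G (W.erase c) := by
  obtain ⟨Q, hQ⟩ := hc W
  have hp2 := hp.out.two_le
  obtain ⟨C, hCW, hCp, hCF, hCQ, hCt, -⟩ := decomp (by omega) (fun h => hFa (h.mono (erase_subset _ _))) hQ
  obtain ⟨s, hs, rfl⟩ := exists_singleton hCW (by omega)
  by_cases hcs : c = s
  · rwa [hcs]
  have key : ∀ a ∈ W, a ≠ s → ¬ Fx p G (W.erase a) → ¬ Fx p G (W.erase c) := by
    intro a ha has hFa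
    have h1 : c ∈ Qorb Q a := by
      rw [hCt a (mem_erase.mpr ⟨has, ha⟩)]; exact mem_erase.mpr ⟨hcs, hcW⟩
    obtain ⟨g, hg, rfl⟩ := mem_Qorb.mp h1
    rwa [← hQ g hg, ← smul_erase', Fx_smul]
  by_cases has : a = s
  · exact key b hb (fun h => hab (has.trans h.symm)) hFb
  · exact key a ha has hFa

def Clq (p : ℕ) (G : Type) {Ω : Type} [Group G] [MulAction G Ω] (B : Finset Ω) : Prop :=
  p ≤ B.card ∧ ∀ C ⊆ B, C.card = p → ¬ Fx p G C

theorem Clq.smul {B : Finset Ω} (h : Clq p G B) (g : G) : Clq p G (g • B) := by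
  refine ⟨by simpa using h.1, fun C hC hCp hF => ?_⟩
  refine h.2 (g⁻¹ • C) ?_ (by simpa using hCp) ((Fx_smul _).mpr hF)
  rwa [← subset_smul_finset_iff] 

theorem Clq.extend (hc : ∀ s : Finset Ω, ∃ Q : Sylow p G, Stb Q s) {B : Finset Ω}
    (h : Clq p G B) {A : Finset Ω} (hA : A ⊆ B) (hAp : A.card + 1 = p) {x : Ω} (hx : x ∉ B)
    (hF : ¬ Fx p G (insert x A)) : Clq p G (insert x B) := by
  have key : ∀ (k : ℕ) (A A' : Finset Ω), (A' \ A).card = k → A ⊆ B → A.card + 1 = p → A' ⊆ B →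
      A'.card + 1 = p → ¬ Fx p G (insert x A) → ¬ Fx p G (insert x A') := by
    intro k
    induction k with
    | zero =>
      intro A A' h0 hA hAp hA' hAp' hF
      rw [card_eq_zero, sdiff_eq_empty_iff_subset] at h0
      rwa [eq_of_subset_of_card_le h0 (by omega)]
    | succ k ih =>
      intro A A' h0 hA hAp hA' hAp' hF
      have h1 : (A' \ A).Nonempty := card_pos.mp (by omega)
      have h2 : (A \ A').Nonempty := card_pos.mp (by
        have := card_sdiff_add_card_inter A A'
        have := card_sdiff_add_card_inter A' A
        rw [inter_comm] at this
        omega)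
      obtain ⟨b, hb⟩ := h1
      obtain ⟨a, ha⟩ := h2
      rw [mem_sdiff] at hb ha
      have hxA : x ∉ A := fun h => hx (hA h)
      have hxb : x ≠ b := fun h => hx (h ▸ hA' hb.1)
      have hxa : x ≠ a := fun h => hx (h ▸ hA ha.1)
      have hba : b ≠ a := fun h => hb.2 (h ▸ ha.1)
      set W := insert x (insert b A) with hW
      have hWc : W.card = p + 1 := by
        rw [hW, card_insert_of_notMem (by simp [hxb, hxA]), card_insert_of_notMem hb.2]
        omega
      have e1 : W.erase b = insert x A := by
        rw [hW]; ext y; simp only [mem_erase, mem_insert]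
        grind
      have e2 : W.erase x = insert b A := by
        rw [hW]; ext y; simp only [mem_erase, mem_insert]
        grind
      have e3 : W.erase a = insert x (insert b (A.erase a)) := by
        rw [hW]; ext y; simp only [mem_erase, mem_insert]
        grind
      have h3 : ¬ Fx p G (W.erase a) := by
        refine lemP hc hWc hxb (by simp [hW]) (by simp [hW]) ?_ ?_ (by simp [hW, ha.1])
        · rw [e2]
          refine h.2 _ ?_ ?_
          · rw [insert_subset_iff]; exact ⟨hA' hb.1, hA⟩
          · rw [card_insert_of_notMem hb.2]; exact hAp
        · rw [e1]; exact hF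
      rw [e3] at h3
      refine ih (insert b (A.erase a)) A' ?_ ?_ ?_ hA' hAp' h3
      · have : A' \ insert b (A.erase a) = (A' \ A).erase b := by
          ext y; simp only [mem_erase, mem_insert, mem_sdiff]
          grind
        rw [this, card_erase_of_mem (mem_sdiff.mpr hb)]; omega
      · rw [insert_subset_iff]
        exact ⟨hA' hb.1, (erase_subset _ _).trans hA⟩
      · rw [card_insert_of_notMem (by simp [hb.2]), card_erase_of_mem ha.1]
        have : 0 < A.card := card_pos.mpr ⟨a, ha.1⟩
        omega
  refine ⟨h.1.trans (card_le_card (subset_insert _ _)), fun C hC hCp => ?_⟩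
  by_cases hxC : x ∈ C
  · rw [← insert_erase hxC]
    refine key _ A (C.erase x) rfl hA hAp ?_ ?_ hF
    · intro y hy
      rw [mem_erase] at hy
      have := hC hy.2
      rw [mem_insert] at this
      exact this.resolve_left hy.1
    · rw [card_erase_of_mem hxC]; have := hp.out.pos; omega
  · refine h.2 C ?_ hCp
    intro y hy
    have := hC hy
    rw [mem_insert] at this
    exact this.resolve_left (fun h => hxC (h ▸ hy))

theorem Clq.merge (hc : ∀ s : Finset Ω, ∃ Q : Sylow p G, Stb Q s) {B1 B2 : Finset Ω}
    (h1 : Clq p G B1) (h2 : Clq p G B2) (h : p ≤ (B1 ∩ B2).card + 1) : Clq p G (B1 ∪ B2) := by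
  have hp0 := hp.out.pos
  obtain ⟨A, hA, hAp⟩ := exists_subset_card_eq (show p - 1 ≤ (B1 ∩ B2).card by omega)
  have : ∀ T : Finset Ω, T ⊆ B2 → Clq p G (B1 ∪ T) := by
    intro T
    induction T using Finset.induction_on with
    | empty => intro _; simpa using h1
    | insert x T hx ih =>
      intro hT
      rw [insert_subset_iff] at hT
      have h3 := ih hT.2
      by_cases hxB : x ∈ B1 ∪ T
      · rwa [union_insert, insert_eq_of_mem hxB]
      rw [union_insert]
      have hxA : x ∉ A := fun h => hxB (mem_union_left _ (mem_inter.mp (hA h)).1)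
      refine h3.extend hc (A := A) ?_ (by omega) hxB ?_
      · exact fun y hy => mem_union_left _ (mem_inter.mp (hA hy)).1
      · refine h2.2 _ ?_ ?_
        · rw [insert_subset_iff]
          exact ⟨hT.1, fun y hy => (mem_inter.mp (hA hy)).2⟩
        · rw [card_insert_of_notMem hxA]; omega
  exact this B2 subset_rfl

theorem Clq.of_card {C : Finset Ω} (h : C.card = p) (hF : ¬ Fx p G C) : Clq p G C :=
  ⟨h.ge, fun D hD hDp => by rwa [eq_of_subset_of_card_le hD (by omega)]⟩

theorem Clq.exists_max {C : Finset Ω} (h : Clq p G C) : ∃ B, C ⊆ B ∧ Maximal (Clq p G) B :=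
  (Set.toFinite {B : Finset Ω | Clq p G B}).exists_le_maximal h

theorem Maximal.smulC {B : Finset Ω} (h : Maximal (Clq p G) B) (g : G) :
    Maximal (Clq p G) (g • B) := by
  refine ⟨h.1.smul g, fun B' hB' hle => ?_⟩
  have h2 : B ⊆ g⁻¹ • B' := by
    intro x hx
    rw [mem_smulF, inv_inv]
    exact hle (smul_mem_smul_finset hx)
  have h3 := h.2 (hB'.smul g⁻¹) h2
  intro x hx
  rw [mem_smulF]
  exact h3 (smul_mem_smul_finset hx)

theorem Maximal.eqC (hc : ∀ s : Finset Ω, ∃ Q : Sylow p G, Stb Q s) {B B' : Finset Ω}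
    (h : Maximal (Clq p G) B) (h' : Maximal (Clq p G) B') (hi : p ≤ (B ∩ B').card + 1) : B = B' := by
  have h3 := Clq.merge hc h.1 h'.1 hi
  have e1 := h.eq_of_le h3 subset_union_left
  have e2 := h'.eq_of_le h3 subset_union_right
  exact e1.trans e2.symm

theorem maxC_stb (hc : ∀ s : Finset Ω, ∃ Q : Sylow p G, Stb Q s) {B A : Finset Ω}
    (h : Maximal (Clq p G) B) (hA : A ⊆ B) (hAp : p ≤ A.card + 1) {Q : Sylow p G} (hQ : Pw Q A) :
    Stb Q B := by
  intro g hg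
  refine Maximal.eqC hc (h.smulC g) h (hAp.trans ?_)
  refine Nat.add_le_add_right (card_le_card ?_) 1
  intro x hx
  refine mem_inter.mpr ⟨?_, hA hx⟩
  rw [← hQ g hg x hx]
  exact smul_mem_smul_finset (hA hx)

theorem maxC_card (hc : ∀ s : Finset Ω, ∃ Q : Sylow p G, Stb Q s) {B : Finset Ω}
    (h : Maximal (Clq p G) B) : 2 * p - 1 ≤ B.card := by
  have hp0 := hp.out.pos
  have hB := h.1.1
  obtain ⟨A, hA, hAp⟩ := exists_subset_card_eq (show p - 1 ≤ B.card by omega)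
  obtain ⟨Q, hQ⟩ := Fx_of_lt hc (show A.card < p by omega)
  have hs := maxC_stb hc h hA (by omega) hQ
  by_contra hlt
  have hBF : ¬ Fx p G B := fun hF => by
    obtain ⟨C, hC, hCp⟩ := exists_subset_card_eq hB
    exact h.1.2 C hC hCp (hF.mono hC)
  obtain ⟨C, hCB, hCp, hCF, hCQ, hCt, hPw⟩ := decomp (by omega) hBF hs
  have h1 : (A ∩ C).Nonempty := by
    rw [nonempty_iff_ne_empty]
    intro h0
    have := card_union_add_card_inter A C
    rw [h0, card_empty] at this
    have := card_le_card (union_subset hA hCB)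
    omega
  obtain ⟨x, hx⟩ := h1
  rw [mem_inter] at hx
  have h2 := hCt x hx.2
  have h3 : Qorb Q x ⊆ {x} := by
    intro y hy
    obtain ⟨g, hg, rfl⟩ := mem_Qorb.mp hy
    rw [hQ g hg x hx.1]; simp
  have := card_le_card h3
  rw [h2, hCp, card_singleton] at this
  have := hp.out.two_le
  omega

end syl5

section syl6
variable {G Ω : Type} [Group G] [Finite G] [Fintype Ω] [DecidableEq Ω] [MulAction G Ω]
  {p : ℕ} [hp : Fact p.Prime]

theorem exists_meet [IsPreprimitive G Ω] {B : Finset Ω} (h2 : 2 ≤ B.card) (hne : B ≠ univ) :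
    ∃ g : G, g • B ≠ B ∧ (g • B ∩ B).Nonempty := by
  by_contra h
  push Not at h
  have hb : IsBlock G (B : Set Ω) := by
    rw [isBlock_iff_smul_eq_or_disjoint]
    intro g
    by_cases hg : g • B = B
    · left; rw [← coe_smul_finset, hg]
    · right
      rw [← coe_smul_finset, disjoint_coe, disjoint_iff_inter_eq_empty]
      exact h g hg
  rcases IsPreprimitive.isTrivialBlock_of_isBlock hb with h1 | h1
  · have : B.card ≤ 1 := card_le_one.mpr fun a ha b hb => h1 ha hb
    omega
  · exact hne (by exact_mod_cast h1)

theorem maxC_univ [IsPreprimitive G Ω] (hc : ∀ s : Finset Ω, ∃ Q : Sylow p G, Stb Q s)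
    {B : Finset Ω} (hB : Maximal (Clq p G) B) : B = univ := by
  classical
  by_contra hne
  have hp2 := hp.out.two_le
  obtain ⟨g0, hg0, hm0⟩ := exists_meet (G := G) (hp2.trans hB.1.1) hne
  set S : Finset (Finset Ω × Finset Ω) := univ.filter fun P =>
    Maximal (Clq p G) P.1 ∧ Maximal (Clq p G) P.2 ∧ P.1 ≠ P.2 with hS
  have hS0 : (g0 • B, B) ∈ S := by
    rw [hS, mem_filter]; exact ⟨mem_univ _, hB.smulC g0, hB, hg0⟩
  obtain ⟨⟨B1, B2⟩, hP, hmax⟩ := S.exists_max_image (fun P => (P.1 ∩ P.2).card) ⟨_, hS0⟩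
  have ht1 : 1 ≤ (B1 ∩ B2).card := (card_pos.mpr hm0).trans_le (hmax _ hS0)
  rw [hS, mem_filter] at hP
  obtain ⟨-, hB1, hB2, hne12⟩ := hP
  simp only at hB1 hB2 hne12
  have hmx : ∀ B B' : Finset Ω, Maximal (Clq p G) B → Maximal (Clq p G) B' →
      (B1 ∩ B2).card < (B ∩ B').card → B = B' := by
    intro B B' h h' hlt
    by_contra hne
    have := hmax (B, B') (by rw [hS, mem_filter]; exact ⟨mem_univ _, h, h', hne⟩)
    simp only at this
    omega
  clear hmax hS0 hm0 hg0
  set E := B1 ∩ B2 with hE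
  set t := E.card with ht
  have htp : t + 2 ≤ p := by
    by_contra h
    exact hne12 (Maximal.eqC hc hB1 hB2 (by rw [← hE]; omega))
  have hc1 := maxC_card hc hB1
  have hc2 := maxC_card hc hB2
  have hE1 : E ⊆ B1 := inter_subset_left
  have hE2 : E ⊆ B2 := inter_subset_right
  have hd1 : (B1 \ E).card = B1.card - t := card_sdiff_of_subset hE1
  have hd2 : (B2 \ E).card = B2.card - t := card_sdiff_of_subset hE2
  obtain ⟨e, he⟩ := card_pos.mp (show 0 < E.card by omega)
  set A0 := E.erase e with hA0
  have hA0c : A0.card = t - 1 := card_erase_of_mem he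
  obtain ⟨A1, hA1, hA1c⟩ := exists_subset_card_eq (show p - t ≤ (B1 \ E).card by omega)
  have hdis : Disjoint A0 A1 := by
    rw [disjoint_left]
    intro x h1 h2
    exact (mem_sdiff.mp (hA1 h2)).2 (mem_of_mem_erase h1)
  set A := A0 ∪ A1 with hA
  have hAc : A.card = p - 1 := by rw [hA, card_union_of_disjoint hdis]; omega
  have hAB : A ⊆ B1 := union_subset ((erase_subset _ _).trans hE1)
    (hA1.trans sdiff_subset)
  have hA0B2 : A0 ⊆ B2 := (erase_subset _ _).trans hE2
  have hA1n : ∀ a ∈ A1, a ∉ B2 := by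
    intro a ha h
    have := mem_sdiff.mp (hA1 ha)
    exact this.2 (mem_inter.mpr ⟨this.1, h⟩)
  have hA1ne : A1.Nonempty := card_pos.mp (by omega)
  obtain ⟨b, hb⟩ := card_pos.mp (show 0 < (B2 \ E).card by omega)
  have hnB1 : ∀ b ∈ B2 \ E, b ∉ B1 := fun b hb h =>
    (mem_sdiff.mp hb).2 (mem_inter.mpr ⟨h, (mem_sdiff.mp hb).1⟩)
  have hbA : b ∉ A := fun h => hnB1 b hb (hAB h)
  have hchoice : ∃ b' ∈ (B2 \ E).erase b, ∀ s ∈ A0, Fx p G ((insert b (insert b' A)).erase s) := by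
    by_contra hcon
    push Not at hcon
    choose! f hf1 hf2 using hcon
    have hcard : A0.card < ((B2 \ E).erase b).card := by
      rw [card_erase_of_mem hb]; omega
    obtain ⟨x, hx, y, hy, hxy, hfxy⟩ := exists_ne_map_eq_of_card_lt_of_maps_to hcard
      (fun x hx => hf1 x hx)
    set s := f x with hs
    have hsA0 : s ∈ A0 := hf1 x hx
    have hsA : s ∈ A := mem_union_left _ hsA0
    have hsB1 := hAB hsA
    have hx' := mem_erase.mp hx
    have hy' := mem_erase.mp hy
    have hxn := hnB1 x hx'.2
    have hyn := hnB1 y hy'.2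
    have hbn := hnB1 b hb
    have hxA : x ∉ A := fun h => hxn (hAB h)
    have hyA : y ∉ A := fun h => hyn (hAB h)
    have hXc : ∀ z, z ∉ B1 → z ≠ b → ((insert b (insert z A)).erase s).card = p := by
      intro z hz hzb
      have hzA : z ∉ A := fun h => hz (hAB h)
      rw [card_erase_of_mem (by simp [hsA]), card_insert_of_notMem,
        card_insert_of_notMem hzA]
      · omega
      · simp [hbA, hzb.symm]
    have q1 := Clq.of_card (hXc x hxn hx'.1) (hf2 x hx)
    have q2 := Clq.of_card (hXc y hyn hy'.1) (by have := hf2 y hy; rwa [← hfxy] at this)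
    have hsb : s ≠ b := fun h => hbn (h ▸ hsB1)
    have q3 := Clq.merge hc q1 q2 (by
      have : insert b (A.erase s) ⊆ (insert b (insert x A)).erase s ∩ (insert b (insert y A)).erase s := by
        intro z hz
        simp only [mem_insert, mem_erase, mem_inter] at *
        grind
      have := card_le_card this
      rw [card_insert_of_notMem (by simp [hbA]), card_erase_of_mem hsA] at this
      omega)
    obtain ⟨B3, hsub, hB3⟩ := q3.exists_max
    have h32 : B3 = B2 := by
      refine hmx _ _ hB3 hB2 ?_
      have : insert b (insert x (insert y (A0.erase s))) ⊆ B3 ∩ B2 := by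
        intro z hz
        simp only [mem_insert, mem_erase] at hz
        rw [mem_inter]
        have hsx : s ≠ x := fun h => hxn (h ▸ hsB1)
        have hsy : s ≠ y := fun h => hyn (h ▸ hsB1)
        constructor
        · apply hsub
          simp only [mem_insert, mem_erase, mem_union, hA]
          grind
        · rcases hz with rfl | rfl | rfl | hz
          · exact (mem_sdiff.mp hb).1
          · exact (mem_sdiff.mp hx'.2).1
          · exact (mem_sdiff.mp hy'.2).1
          · exact hA0B2 hz.2
      have h5 := card_le_card this
      have n0 : ∀ z, z ∉ B1 → z ∉ A0.erase s := fun z hz h =>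
        hz (hAB (mem_union_left _ (mem_of_mem_erase h)))
      rw [card_insert_of_notMem, card_insert_of_notMem, card_insert_of_notMem,
        card_erase_of_mem hsA0] at h5
      · have : 0 < A0.card := card_pos.mpr ⟨s, hsA0⟩
        omega
      · exact n0 y hyn
      · rw [mem_insert, not_or]; exact ⟨hxy, n0 x hxn⟩
      · rw [mem_insert, mem_insert, not_or, not_or]
        exact ⟨hx'.1.symm, hy'.1.symm, n0 b hbn⟩
    obtain ⟨a, ha⟩ := hA1ne
    refine hA1n a ha ?_
    rw [← h32]
    apply hsub
    have : a ≠ s := fun h => by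
      rw [h] at ha
      exact hA1n s ha (hA0B2 hsA0)
    simp [hA, ha, this]
  obtain ⟨b', hb', hgood⟩ := hchoice
  rw [mem_erase] at hb'
  have hbn := hnB1 b hb
  have hbn' := hnB1 b' hb'.2
  have hbA' : b' ∉ A := fun h => hbn' (hAB h)
  set X := insert b (insert b' A) with hX
  have hXc : X.card = p + 1 := by
    rw [hX, card_insert_of_notMem, card_insert_of_notMem hbA']
    · omega
    · simp [hbA, hb'.1.symm]
  have hAX : A ⊆ X := fun x hx => by simp [hX, hx]
  set Y := insert b (insert b' A0) with hY
  have hYc : Y.card = t + 1 := by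
    have n1 : b' ∉ A0 := fun h => hbA' (mem_union_left _ h)
    have n2 : b ∉ A0 := fun h => hbA (mem_union_left _ h)
    rw [hY, card_insert_of_notMem, card_insert_of_notMem n1]
    · omega
    · simp [n2, hb'.1.symm]
  have hYX : Y ⊆ X := by
    intro z hz
    simp only [hY, hX, hA, mem_insert, mem_union] at *
    grind
  have hYB2 : Y ⊆ B2 := by
    intro z hz
    simp only [hY, mem_insert] at hz
    rcases hz with rfl | rfl | hz
    · exact (mem_sdiff.mp hb).1
    · exact (mem_sdiff.mp hb'.2).1
    · exact hA0B2 hz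
  by_cases hXF : Fx p G X
  · obtain ⟨Q, hQ⟩ := hXF
    have s1 : Stb Q B1 := maxC_stb hc hB1 hAB (by omega) (fun g hg x hx => hQ g hg x (hAX hx))
    have s2 : Stb Q B2 := by
      intro g hg
      refine hmx _ _ (hB2.smulC g) hB2 ?_
      have : Y ⊆ g • B2 ∩ B2 := by
        intro z hz
        refine mem_inter.mpr ⟨?_, hYB2 hz⟩
        rw [← hQ g hg z (hYX hz)]
        exact smul_mem_smul_finset (hYB2 hz)
      have := card_le_card this
      omega
    have hfix : ∀ g ∈ Q, g • e = e := by
      intro g hg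
      have hgE : g • e ∈ E := mem_inter.mpr
        ⟨s1.smul_mem hg (hE1 he), s2.smul_mem hg (hE2 he)⟩
      by_contra hge
      have h1 : g • e ∈ A0 := mem_erase.mpr ⟨hge, hgE⟩
      have h2 := hQ g hg _ (hAX (mem_union_left _ h1))
      exact hge (smul_left_cancel _ h2)
    have heA : e ∉ A := by
      rw [hA, mem_union, not_or]
      exact ⟨by simp [hA0], fun h => (mem_sdiff.mp (hA1 h)).2 he⟩
    refine hB1.1.2 (insert e A) ?_ ?_ ⟨Q, ?_⟩
    · rw [insert_subset_iff]; exact ⟨hE1 he, hAB⟩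
    · rw [card_insert_of_notMem heA]; omega
    · intro g hg x hx
      rw [mem_insert] at hx
      rcases hx with rfl | hx
      · exact hfix g hg
      · exact hQ g hg x (hAX hx)
  · obtain ⟨Q, hQ⟩ := hc X
    obtain ⟨C, hCX, hCp, hCF, -, -, -⟩ := decomp (by omega) hXF hQ
    obtain ⟨s, hs, rfl⟩ := exists_singleton hCX (by omega)
    obtain ⟨B3, hsub, hB3⟩ := (Clq.of_card hCp hCF).exists_max
    have hs' := hs
    rw [hX, mem_insert, mem_insert, hA, mem_union] at hs'
    have caseB : ∀ z ∈ X, z ∉ A → z ≠ s → z ∉ B1 → s ∉ A → False := by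
      intro z hzX hzA hzs hzB hsA
      have : B3 = B1 := by
        refine hmx _ _ hB3 hB1 ?_
        have : A ⊆ B3 ∩ B1 := by
          intro y hy
          refine mem_inter.mpr ⟨hsub (mem_erase.mpr ⟨?_, hAX hy⟩), hAB hy⟩
          exact fun h => hsA (h ▸ hy)
        have := card_le_card this
        omega
      exact hzB (this ▸ hsub (mem_erase.mpr ⟨hzs, hzX⟩))
    rcases hs' with rfl | rfl | hs' | hs'
    · exact caseB b' (by simp [hX]) hbA' hb'.1 hbn' hbA
    · exact caseB b (by simp [hX]) hbA hb'.1.symm hbn hbA'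
    · exact hCF (hgood s hs')
    · have h32 : B3 = B2 := by
        refine hmx _ _ hB3 hB2 ?_
        have : Y ⊆ B3 ∩ B2 := by
          intro y hy
          refine mem_inter.mpr ⟨hsub (mem_erase.mpr ⟨?_, hYX hy⟩), hYB2 hy⟩
          rintro rfl
          exact hA1n _ hs' (hYB2 hy)
        have := card_le_card this
        omega
      obtain ⟨a, ha, has⟩ := exists_mem_ne (show 1 < A1.card by omega) s
      refine hA1n a ha (h32 ▸ hsub (mem_erase.mpr ⟨has, hAX (mem_union_right _ ha)⟩))

theorem allZ [IsPreprimitive G Ω] (hc : ∀ s : Finset Ω, ∃ Q : Sylow p G, Stb Q s)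
    (hF : ¬ Fx p G (univ : Finset Ω)) : ∀ C : Finset Ω, p ≤ C.card → ¬ Fx p G C := by
  obtain ⟨C, h1, h2⟩ := exists_Z hc hF
  obtain ⟨B, hsub, hB⟩ := (Clq.of_card h1 h2).exists_max
  have := maxC_univ hc hB
  subst this
  intro C hC hF
  obtain ⟨D, hD, hDp⟩ := exists_subset_card_eq hC
  exact hB.1.2 D (subset_univ _) hDp (hF.mono hD)

end syl6

section syl7
variable {G Ω : Type} [Group G] [Finite G] [Fintype Ω] [DecidableEq Ω] [MulAction G Ω]
  {p : ℕ} [hp : Fact p.Prime]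

structure Ctx (p : ℕ) (G Ω : Type) [Group G] [Fintype Ω] [DecidableEq Ω] [MulAction G Ω] : Prop where
  hc : ∀ s : Finset Ω, ∃ Q : Sylow p G, Stb Q s
  hZ : ∀ C : Finset Ω, p ≤ C.card → ¬ Fx p G C
  hn : p ≤ Fintype.card Ω

open Classical in
noncomputable def FixS (Ω : Type) [Fintype Ω] [MulAction G Ω] (Q : Sylow p G) : Finset Ω :=
  univ.filter fun x => ∀ g ∈ Q, g • x = x

theorem mem_FixS {Q : Sylow p G} {x : Ω} : x ∈ FixS Ω Q ↔ ∀ g ∈ Q, g • x = x := by simp [FixS]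

theorem pw_iff {Q : Sylow p G} {s : Finset Ω} : Pw Q s ↔ s ⊆ FixS Ω Q :=
  ⟨fun h x hx => mem_FixS.mpr fun g hg => h g hg x hx, fun h g hg x hx => mem_FixS.mp (h hx) g hg⟩

theorem FixS_smul {Q Q' : Sylow p G} {k : G} (h : ∀ x, x ∈ Q ↔ k * x * k⁻¹ ∈ Q') :
    FixS Ω Q' = k • FixS Ω Q := by
  ext x
  rw [mem_smulF, mem_FixS, mem_FixS, smul_pw h, smul_inv_smul]

theorem Ctx.card_fix (c : Ctx p G Ω) (Q : Sylow p G) : (FixS Ω Q).card = p - 1 := by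
  have hp0 := hp.out.pos
  refine le_antisymm ?_ ?_
  · by_contra h
    exact c.hZ (FixS Ω Q) (by omega) ⟨Q, pw_iff.mpr subset_rfl⟩
  · have := c.hn
    obtain ⟨A, -, hA⟩ := exists_subset_card_eq
      (show p - 1 ≤ (univ : Finset Ω).card by rw [card_univ]; omega)
    obtain ⟨Q', hQ'⟩ := Fx_of_lt c.hc (show A.card < p by omega)
    obtain ⟨k, -, hk⟩ := syl_conj ⊤ Q' Q (fun _ _ => trivial) (fun _ _ => trivial)
    rw [FixS_smul hk, card_smul_finset, ← hA]
    exact card_le_card (pw_iff.mp hQ')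

theorem Ctx.fix_eq (c : Ctx p G Ω) {Q : Sylow p G} {A : Finset Ω} (h : Pw Q A)
    (hA : p - 1 ≤ A.card) : FixS Ω Q = A :=
  (eq_of_subset_of_card_le (pw_iff.mp h) (by rw [c.card_fix]; exact hA)).symm

theorem Ctx.mod (c : Ctx p G Ω) : ∃ a, 2 ≤ a ∧ Fintype.card Ω + 1 = a * p := by
  obtain ⟨Q, -⟩ := c.hc ∅
  have h1 := Q.isPGroup'.card_modEq_card_fixedPoints Ω
  have h2 : Nat.card (fixedPoints Q Ω) = p - 1 := by
    rw [← c.card_fix Q, ← Fintype.card_coe, ← Nat.card_eq_fintype_card]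
    refine Nat.card_congr (Equiv.subtypeEquivRight fun y => ?_)
    rw [mem_FixS, mem_fixedPoints]
    constructor
    · intro h g hg; exact h ⟨g, hg⟩
    · rintro h ⟨g, hg⟩; exact h g hg
  rw [h2, Nat.card_eq_fintype_card] at h1
  have hp0 := hp.out.two_le
  have h3 : Fintype.card Ω + 1 ≡ 0 [MOD p] := by
    have := h1.add_right 1
    rw [show p - 1 + 1 = p by omega] at this
    exact this.trans (by simp [Nat.ModEq])
  obtain ⟨a, ha⟩ := (Nat.modEq_zero_iff_dvd.mp h3)
  refine ⟨a, ?_, by rw [ha, mul_comm]⟩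
  by_contra h
  have hn := c.hn
  have : a < 2 := by omega
  interval_cases a <;> omega

theorem MT_of_St {m : ℕ} (hm : m + 1 ≤ Fintype.card Ω)
    (h : ∀ (D : Finset Ω) (x y : Ω), D.card + 1 = m → x ∉ D → y ∉ D →
      ∃ g : G, (∀ z ∈ D, g • z = z) ∧ g • x = y) : MT G Ω m := by
  intro s
  induction s using Finset.induction_on with
  | empty => intro f _ _; exact ⟨1, by simp⟩
  | insert x t hx ih =>
    intro f hcard hf
    rw [card_insert_of_notMem hx] at hcard
    obtain ⟨g, hg⟩ := ih f (by omega) (hf.mono (by simp))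
    have hi : (t.image f).card = t.card := card_image_of_injOn (hf.mono (by simp))
    have n1 : f x ∉ t.image f := by
      rw [mem_image]
      rintro ⟨y, hy, hxy⟩
      have := hf (by simp [hy]) (by simp) hxy
      exact hx (this ▸ hy)
    have n2 : g • x ∉ t.image f := by
      rw [mem_image]
      rintro ⟨y, hy, hxy⟩
      rw [← hg y hy] at hxy
      exact hx (smul_left_cancel _ hxy ▸ hy)
    obtain ⟨D, hD1, hD2, hD3⟩ := exists_subsuperset_card_eq (n := m - 1)
      (show t.image f ⊆ (univ.erase (f x)).erase (g • x) from fun y hy => by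
        simp only [mem_erase, mem_univ, and_true]
        exact ⟨fun h => n2 (h ▸ hy), fun h => n1 (h ▸ hy)⟩) (by omega) (by
        have h1 := pred_card_le_card_erase (s := univ.erase (f x)) (a := g • x)
        have h2 := pred_card_le_card_erase (s := univ) (a := f x)
        rw [card_univ] at h2
        omega)
    obtain ⟨k, hk1, hk2⟩ := h D (g • x) (f x) (by omega) (fun h => by simpa using hD2 h)
      (fun h => by simpa using hD2 h)
    refine ⟨k * g, fun z hz => ?_⟩
    rw [mul_smul]
    rw [mem_insert] at hz
    rcases hz with rfl | hz
    · exact hk2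
    · rw [hg z hz]
      exact hk1 _ (hD1 (mem_image_of_mem f hz))

theorem Ctx.MT_pred (c : Ctx p G Ω) : MT G Ω (p - 1) := by
  obtain ⟨a, ha, han⟩ := c.mod
  have hp0 := hp.out.two_le
  have hn := c.hn
  refine MT_of_St (by omega) ?_
  intro D x y hD hx hy
  obtain ⟨Q, hQ⟩ := Fx_of_lt c.hc (show (insert x D).card < p by
    rw [card_insert_of_notMem hx]; omega)
  obtain ⟨Q', hQ'⟩ := Fx_of_lt c.hc (show (insert y D).card < p by
    rw [card_insert_of_notMem hy]; omega)
  obtain ⟨k, hkD, hk⟩ := syl_conj (pstab G D) Q Q' (fun g hg z hz => hQ g hg z (by simp [hz]))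
    (fun g hg z hz => hQ' g hg z (by simp [hz]))
  refine ⟨k, hkD, ?_⟩
  have e1 := c.fix_eq hQ (by rw [card_insert_of_notMem hx]; omega)
  have e2 := c.fix_eq hQ' (by rw [card_insert_of_notMem hy]; omega)
  have e3 := FixS_smul (Ω := Ω) hk
  rw [e1, e2] at e3
  have h1 : k • x ∈ insert y D := by rw [e3]; exact smul_mem_smul_finset (by simp)
  rw [mem_insert] at h1
  refine h1.resolve_right fun h2 => hx ?_
  have := (pstab G D).inv_mem hkD _ h2
  rw [inv_smul_smul] at this
  rwa [this]

theorem Ctx.decomp (c : Ctx p G Ω) {Q : Sylow p G} {s : Finset Ω} (hs : s.card < 2 * p)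
    (hs' : p ≤ s.card) (hQ : Stb Q s) :
    ∃ C ⊆ s, C.card = p ∧ Stb Q C ∧ (∀ x ∈ C, Qorb Q x = C) ∧ s \ C ⊆ FixS Ω Q := by
  obtain ⟨C, h1, h2, h3, h4, h5, h6⟩ := _root_.decomp hs (c.hZ s hs') hQ
  exact ⟨C, h1, h2, h4, h5, pw_iff.mp h6⟩

theorem Ctx.ppart (c : Ctx p G Ω) (hT : MT G Ω p) :
    p ∣ Fintype.card Ω - p + 1 ∧ ¬ p ^ 2 ∣ Fintype.card Ω - p + 1 := by
  have hp0 := hp.out.two_le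
  have hn := c.hn
  constructor
  · obtain ⟨a, ha, han⟩ := c.mod
    refine ⟨a - 1, ?_⟩
    rw [Nat.mul_sub, mul_comm p a, ← han]; omega
  · intro hdvd
    obtain ⟨C, -, hC⟩ := exists_subset_card_eq
      (show p ≤ (univ : Finset Ω).card by rw [card_univ]; exact hn)
    obtain ⟨Q, hQ⟩ := c.hc C
    obtain ⟨C', hC', hC'p, -, horb, -⟩ := c.decomp (by omega) hC.ge hQ
    obtain rfl := eq_of_subset_of_card_le hC' (by omega)
    obtain ⟨x, hx⟩ := card_pos.mp (show 0 < C'.card by omega)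
    set A := FixS Ω Q with hA
    have hAc : A.card = p - 1 := c.card_fix Q
    have hxA : x ∉ A := by
      intro h
      have h3 : Qorb Q x ⊆ {x} := by
        intro y hy
        obtain ⟨g, hg, rfl⟩ := mem_Qorb.mp hy
        rw [mem_FixS.mp h g hg]; simp
      have := card_le_card h3
      rw [horb x hx, hC, card_singleton] at this
      omega
    have hQK : (Q : Subgroup G) ≤ pstab G A := fun g hg z hz => mem_FixS.mp hz g hg
    have hN : (stabilizer G x).relIndex (pstab G A) = Fintype.card Ω - p + 1 := by
      change (stabilizer (pstab G A) x).index = _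
      rw [index_stabilizer]
      have : orbit (pstab G A) x = ((univ \ A : Finset Ω) : Set Ω) := by
        ext y
        simp only [coe_sdiff, coe_univ, Set.mem_sdiff, Set.mem_univ, true_and,
          mem_coe, mem_orbit_iff]
        constructor
        · rintro ⟨⟨k, hk⟩, rfl⟩ h
          have h' : k • x ∈ A := h
          have := (pstab G A).inv_mem hk _ h'
          rw [inv_smul_smul] at this
          exact hxA (this ▸ h')
        · intro hy
          obtain ⟨g, hg⟩ := hT (insert x A) (fun z => if z = x then y else z)
            (by rw [card_insert_of_notMem hxA]; omega) (by
              intro u hu v hv huv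
              simp only [coe_insert, Set.mem_insert_iff, mem_coe] at hu hv
              simp only at huv
              split_ifs at huv with h1 h2 h2
              · rw [h1, h2]
              · exact absurd (huv ▸ hv.resolve_left h2) hy
              · exact absurd (huv ▸ hu.resolve_left h1) hy
              · exact huv)
          refine ⟨⟨g, fun z hz => ?_⟩, ?_⟩
          · have := hg z (by simp [hz])
            rwa [if_neg (fun h : z = x => hxA (h ▸ hz))] at this
          · have := hg x (by simp)
            rwa [if_pos rfl] at this
      rw [this, Set.ncard_coe_finset, card_sdiff_of_subset (subset_univ _), hAc,
        card_univ]
      omega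
    have hM : (stabilizer G x).relIndex (Q : Subgroup G) = p := by
      change (stabilizer (Q : Subgroup G) x).index = _
      rw [index_stabilizer]
      have : orbit (Q : Subgroup G) x = ((Qorb Q x : Finset Ω) : Set Ω) := by
        ext y
        rw [mem_coe, mem_Qorb, mem_orbit_iff]
        constructor
        · rintro ⟨⟨g, hg⟩, h⟩; exact ⟨g, hg, h⟩
        · rintro ⟨g, hg, h⟩; exact ⟨⟨g, hg⟩, h⟩
      rw [this, Set.ncard_coe_finset, horb x hx, hC]
    have e1 : (stabilizer G x ⊓ pstab G A).index =
        (Fintype.card Ω - p + 1) * (pstab G A).index := by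
      rw [← Subgroup.relIndex_mul_index (inf_le_right : stabilizer G x ⊓ pstab G A ≤ pstab G A),
        Subgroup.inf_relIndex_right, hN]
    have e2 : (stabilizer G x ⊓ (Q : Subgroup G)).index = p * (Q : Subgroup G).index := by
      rw [← Subgroup.relIndex_mul_index (inf_le_right : stabilizer G x ⊓ (Q : Subgroup G) ≤ Q),
        Subgroup.inf_relIndex_right, hM]
    have e3 : (stabilizer G x ⊓ pstab G A).index ∣ (stabilizer G x ⊓ (Q : Subgroup G)).index :=
      Subgroup.index_dvd_of_le (inf_le_inf_left _ hQK)
    rw [e1, e2] at e3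
    have e4 : p ^ 2 ∣ p * (Q : Subgroup G).index := (hdvd.mul_right _).trans e3
    rw [pow_two] at e4
    have e5 := Nat.dvd_of_mul_dvd_mul_left hp.out.pos e4
    exact Q.not_dvd_index' (Subgroup.FiniteIndex.index_ne_zero) e5

theorem choose_part {n : ℕ} (hn : p ≤ n) (h0 : p ∣ n + 1) (h1 : p ∣ n - p + 1)
    (h2 : ¬ p ^ 2 ∣ n - p + 1) : p ∣ (n - 1).choose (p - 1) ∧ ¬ p ^ 2 ∣ (n - 1).choose (p - 1) := by
  have hp2 := hp.out.two_le
  have e := Nat.choose_succ_right_eq (n - 1) (p - 2)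
  rw [show p - 2 + 1 = p - 1 by omega, show n - 1 - (p - 2) = n - p + 1 by omega] at e
  have hL := Choose.choose_modEq_choose_mod_mul_choose_div_nat (n := n - 1) (k := p - 2) (p := p)
  obtain ⟨a, ha⟩ := h0
  have ha1 : 1 ≤ a := by
    by_contra h
    have : a = 0 := by omega
    subst this; omega
  obtain ⟨b, rfl⟩ := Nat.exists_eq_add_of_le ha1
  have hn1 : n - 1 = (p - 2) + p * b := by
    rw [mul_add] at ha; omega
  have hmod : (n - 1) % p = p - 2 := by
    rw [hn1, Nat.add_mul_mod_self_left, Nat.mod_eq_of_lt (by omega)]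
  rw [hmod, Nat.mod_eq_of_lt (by omega : p - 2 < p), Nat.choose_self,
    Nat.div_eq_of_lt (by omega : p - 2 < p), Nat.choose_zero_right, mul_one] at hL
  have hcop : ¬ p ∣ (n - 1).choose (p - 2) := by
    intro h
    have := (Nat.modEq_zero_iff_dvd.mpr h).symm.trans hL
    rw [Nat.ModEq, Nat.zero_mod, Nat.mod_eq_of_lt (by omega)] at this
    omega
  have hcp : Nat.Coprime p (p - 1) := by
    rw [Nat.Prime.coprime_iff_not_dvd hp.out]
    intro h
    have := Nat.le_of_dvd (by omega) h
    omega
  constructor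
  · refine hcp.dvd_of_dvd_mul_right (n := p - 1) ?_
    rw [e]; exact h1.mul_left _
  · intro h
    apply h2
    have h3 : p ^ 2 ∣ (n - 1).choose (p - 2) * (n - p + 1) := by rw [← e]; exact h.mul_right _
    exact (Nat.Coprime.pow_left 2 ((Nat.Prime.coprime_iff_not_dvd hp.out).mpr hcop)).dvd_of_dvd_mul_left h3

end syl7

section dc
variable {Ω : Type} [Fintype Ω] [DecidableEq Ω]

theorem dc1 (F : Finset Ω → Ω → ℝ) :
    ∑ Y : Finset Ω, ∑ x ∈ Y, F (Y.erase x) x = ∑ Z : Finset Ω, ∑ x ∈ Zᶜ, F Z x := by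
  rw [sum_sigma', sum_sigma']
  refine sum_bij' (fun P _ => ⟨P.1.erase P.2, P.2⟩) (fun P _ => ⟨insert P.2 P.1, P.2⟩)
    ?_ ?_ ?_ ?_ ?_
  · rintro ⟨Y, x⟩ h; simp
  · rintro ⟨Y, x⟩ h; simp
  · rintro ⟨Y, x⟩ h
    simp only [mem_sigma, mem_univ, true_and] at h
    simp [insert_erase h]
  · rintro ⟨Y, x⟩ h
    simp only [mem_sigma, mem_univ, true_and, mem_compl] at h
    simp [erase_insert h]
  · rintro ⟨Y, x⟩ h; rfl

theorem dc2 (F : Finset Ω → Ω → Ω → ℝ) :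
    ∑ Y : Finset Ω, ∑ x ∈ Y, ∑ y ∈ Y.erase x, F ((Y.erase x).erase y) x y =
      ∑ Z : Finset Ω, ∑ y ∈ Zᶜ, ∑ x ∈ (insert y Z)ᶜ, F Z x y := by
  rw [dc1 (fun Y x => ∑ y ∈ Y, F (Y.erase y) x y)]
  have : ∀ Y : Finset Ω, ∑ x ∈ Yᶜ, ∑ y ∈ Y, F (Y.erase y) x y =
      ∑ y ∈ Y, ∑ x ∈ (insert y (Y.erase y))ᶜ, F (Y.erase y) x y := by
    intro Y
    rw [sum_comm]
    refine sum_congr rfl fun y hy => ?_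
    rw [insert_erase hy]
  simp_rw [this]
  exact dc1 (fun Z y => ∑ x ∈ (insert y Z)ᶜ, F Z x y)

theorem up_ident (k : ℕ) (f : Finset Ω → ℝ) (hf : ∀ s, s.card ≠ k → f s = 0) :
    ∑ Y : Finset Ω, (∑ x ∈ Y, f (Y.erase x)) ^ 2 = ∑ Z : Finset Ω, (∑ x ∈ Zᶜ, f (insert x Z)) ^ 2 +
      ((Fintype.card Ω : ℝ) - 2 * k) * ∑ X : Finset Ω, f X ^ 2 := by
  have h1 : ∀ Y : Finset Ω, (∑ x ∈ Y, f (Y.erase x)) ^ 2 = ∑ x ∈ Y, f (Y.erase x) ^ 2 +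
      ∑ x ∈ Y, ∑ y ∈ Y.erase x, f (insert y ((Y.erase x).erase y)) * f (insert x ((Y.erase x).erase y)) := by
    intro Y
    rw [pow_two, sum_mul_sum, ← sum_add_distrib]
    refine sum_congr rfl fun x hx => ?_
    rw [← add_sum_erase _ _ hx, pow_two]
    congr 1
    refine sum_congr rfl fun y hy => ?_
    rw [insert_erase hy, erase_right_comm, insert_erase]
    rw [mem_erase] at *
    exact ⟨hy.1.symm, hx⟩
  have h2 : ∀ Z : Finset Ω, (∑ x ∈ Zᶜ, f (insert x Z)) ^ 2 = ∑ x ∈ Zᶜ, f (insert x Z) ^ 2 +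
      ∑ y ∈ Zᶜ, ∑ x ∈ (insert y Z)ᶜ, f (insert y Z) * f (insert x Z) := by
    intro Z
    rw [pow_two, sum_mul_sum, ← sum_add_distrib]
    refine sum_congr rfl fun x hx => ?_
    rw [← add_sum_erase _ _ hx, pow_two, compl_insert]
  simp_rw [h1, h2, sum_add_distrib]
  rw [dc2 (fun Z x y => f (insert y Z) * f (insert x Z)), dc1 (fun Y x => f Y ^ 2)]
  have h3 : ∑ Z : Finset Ω, ∑ x ∈ Zᶜ, f (insert x Z) ^ 2 = k * ∑ X : Finset Ω, f X ^ 2 := by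
    rw [← dc1 (fun Z x => f (insert x Z) ^ 2), mul_sum]
    refine sum_congr rfl fun Y _ => ?_
    rw [sum_congr rfl (fun x hx => by rw [insert_erase hx]), sum_const,
      nsmul_eq_mul]
    by_cases h : Y.card = k
    · rw [h]
    · rw [hf Y h]; simp
  have h4 : ∑ Z : Finset Ω, ∑ x ∈ Zᶜ, f Z ^ 2 = ((Fintype.card Ω : ℝ) - k) * ∑ X : Finset Ω, f X ^ 2 := by
    rw [mul_sum]
    refine sum_congr rfl fun Y _ => ?_
    rw [sum_const, nsmul_eq_mul]
    by_cases h : Y.card = k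
    · have := card_add_card_compl Y
      rw [← this, h]; push_cast; ring
    · rw [hf Y h]; simp
  rw [h3, h4]; ring

variable (G : Type) [Group G] [MulAction G Ω]
def VV (Ω : Type) [Fintype Ω] [DecidableEq Ω] [MulAction G Ω] (k : ℕ) : Submodule ℝ (Finset Ω → ℝ) where
  carrier := {f | (∀ (g : G) s, f (g • s) = f s) ∧ ∀ s, s.card ≠ k → f s = 0}
  add_mem' := fun {a b} ha hb => ⟨fun g s => by simp [ha.1, hb.1], fun s hs => by simp [ha.2 s hs, hb.2 s hs]⟩
  zero_mem' := by simp
  smul_mem' := fun c f h => ⟨fun g s => by simp [h.1], fun s hs => by simp [h.2 s hs]⟩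

theorem LW [Finite G] {k : ℕ} (hk : 2 * k < Fintype.card Ω) :
    Module.finrank ℝ (VV G Ω k) ≤ Module.finrank ℝ (VV G Ω (k + 1)) := by
  let φ : VV G Ω k →ₗ[ℝ] VV G Ω (k + 1) :=
    { toFun := fun f => ⟨fun Y => ∑ x ∈ Y, f.1 (Y.erase x), by
        constructor
        · intro g s
          have hinj : Function.Injective (fun x : Ω => g • x) := MulAction.injective g
          have e : g • s = s.image (fun x => g • x) := rfl
          beta_reduce
          rw [e, sum_image (fun a _ b _ h => hinj h)]
          refine sum_congr rfl fun x _ => ?_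
          rw [← e, ← smul_erase', f.2.1]
        · intro s hs
          refine sum_eq_zero fun x hx => f.2.2 _ ?_
          rw [card_erase_of_mem hx]
          have : 0 < s.card := card_pos.mpr ⟨x, hx⟩
          omega⟩
      map_add' := fun f g => by
        ext Y; simp [sum_add_distrib]
      map_smul' := fun c f => by
        ext Y; simp [mul_sum] }
  refine LinearMap.finrank_le_finrank_of_injective (f := φ) ?_
  rw [injective_iff_map_eq_zero]
  intro f hf
  have h0 : ∀ Y : Finset Ω, ∑ x ∈ Y, f.1 (Y.erase x) = 0 := fun Y => congrFun (congrArg Subtype.val hf) Y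
  have h1 := up_ident k f.1 f.2.2
  simp only [h0] at h1
  have h2 : 0 ≤ ∑ Z : Finset Ω, (∑ x ∈ Zᶜ, f.1 (insert x Z)) ^ 2 :=
    sum_nonneg fun _ _ => sq_nonneg _
  have h3 : 0 ≤ ∑ X : Finset Ω, f.1 X ^ 2 := sum_nonneg fun _ _ => sq_nonneg _
  have h4 : (0 : ℝ) < (Fintype.card Ω : ℝ) - 2 * k := by
    have : (2 * k : ℝ) < Fintype.card Ω := by exact_mod_cast hk
    linarith
  have h5 : ∑ X : Finset Ω, f.1 X ^ 2 = 0 := by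
    simp at h1
    nlinarith
  rw [sum_eq_zero_iff_of_nonneg (fun _ _ => sq_nonneg _)] at h5
  ext X
  simpa using h5 X (mem_univ _)

theorem LW' [Finite G] {k l : ℕ} (hkl : k ≤ l) (hl : 2 * l < Fintype.card Ω + 2) :
    Module.finrank ℝ (VV G Ω k) ≤ Module.finrank ℝ (VV G Ω l) := by
  induction l, hkl using Nat.le_induction with
  | base => exact le_rfl
  | succ l h ih => exact (ih (by omega)).trans (LW G (by omega))

end dc

section syl9
variable {G Ω : Type} [Group G] [Finite G] [Fintype Ω] [DecidableEq Ω] [MulAction G Ω]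
  {p : ℕ} [hp : Fact p.Prime]

def IsC (Q : Sylow p G) (C : Finset Ω) : Prop := C.card = p ∧ ∀ x ∈ C, Qorb Q x = C

theorem IsC.ne {Q : Sylow p G} {C : Finset Ω} (h : IsC Q C) : ∃ x, x ∈ C :=
  card_pos.mp (by rw [h.1]; exact hp.out.pos)

theorem IsC.stb {Q : Sylow p G} {C : Finset Ω} (h : IsC Q C) : Stb Q C := by
  obtain ⟨x, hx⟩ := h.ne
  rw [← h.2 x hx]; exact stb_Qorb Q x

theorem IsC.notMem {Q : Sylow p G} {C : Finset Ω} (h : IsC Q C) {x : Ω} (hx : x ∈ C) :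
    x ∉ FixS Ω Q := by
  intro h'
  have h3 : Qorb Q x ⊆ {x} := by
    intro y hy
    obtain ⟨g, hg, rfl⟩ := mem_Qorb.mp hy
    rw [mem_FixS.mp h' g hg]; simp
  have := card_le_card h3
  rw [h.2 x hx, h.1, card_singleton] at this
  have := hp.out.two_le
  omega

theorem IsC.disj {Q : Sylow p G} {C S : Finset Ω} (h : IsC Q C) (hS : S ⊆ FixS Ω Q) :
    Disjoint C S := by
  rw [disjoint_left]
  exact fun x hx h' => h.notMem hx (hS h')

theorem IsC.uniq {Q : Sylow p G} {C C' S : Finset Ω} (h : IsC Q C) (h' : IsC Q C')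
    (hS : S ⊆ FixS Ω Q) (hsub : C' ⊆ C ∪ S) : C' = C := by
  obtain ⟨x, hx⟩ := h'.ne
  rcases mem_union.mp (hsub hx) with h1 | h1
  · rw [← h'.2 x hx, h.2 x h1]
  · exact absurd (hS h1) (h'.notMem hx)

theorem IsC.smul {Q Q' : Sylow p G} {k : G} (hk : ∀ x, x ∈ Q ↔ k * x * k⁻¹ ∈ Q') {C : Finset Ω}
    (h : IsC Q C) : IsC Q' (k • C) := by
  refine ⟨by simpa using h.1, fun x hx => ?_⟩
  rw [mem_smulF] at hx
  ext y
  rw [mem_smulF, ← h.2 _ hx, mem_Qorb, mem_Qorb]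
  constructor
  · rintro ⟨g, hg, rfl⟩
    refine ⟨k⁻¹ * g * k, ?_, ?_⟩
    · rw [hk]; simpa [mul_assoc] using hg
    · rw [mul_smul, mul_smul, smul_inv_smul]
  · rintro ⟨g, hg, h2⟩
    refine ⟨k * g * k⁻¹, (hk g).mp hg, ?_⟩
    rw [mul_smul, mul_smul, h2, smul_inv_smul]

theorem conjS {Q Q' : Sylow p G} {s : Finset Ω} (h : Stb Q s) (h' : Stb Q' s) :
    ∃ k : G, k • s = s ∧ ∀ x, x ∈ Q ↔ k * x * k⁻¹ ∈ Q' := by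
  obtain ⟨k, hk, hk'⟩ := syl_conj (stabilizer G s) Q Q' (fun x hx => mem_stabilizer_iff.mpr (h x hx))
    (fun x hx => mem_stabilizer_iff.mpr (h' x hx))
  exact ⟨k, mem_stabilizer_iff.mp hk, hk'⟩

theorem conj_trans {Q Q' Q'' : Sylow p G} {k l : G} (h : ∀ x, x ∈ Q ↔ k * x * k⁻¹ ∈ Q')
    (h' : ∀ x, x ∈ Q' ↔ l * x * l⁻¹ ∈ Q'') : ∀ x, x ∈ Q ↔ (l * k) * x * (l * k)⁻¹ ∈ Q'' := by
  intro x; rw [h, h']; simp [mul_assoc]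

theorem conjT {Q Q' : Sylow p G} {s t : Finset Ω} {g : G} (hg : g • s = t) (h : Stb Q s) (h' : Stb Q' t) :
    ∃ k : G, k • s = t ∧ ∀ x, x ∈ Q ↔ k * x * k⁻¹ ∈ Q' := by
  obtain ⟨Q1, hQ1⟩ := conj_syl Q g
  have h1 := smul_stb hQ1 h
  rw [hg] at h1
  obtain ⟨k, hk, hk'⟩ := conjS h1 h'
  exact ⟨k * g, by rw [mul_smul, hg, hk], conj_trans hQ1 hk'⟩

theorem stb_union {Q : Sylow p G} {C S : Finset Ω} (h : IsC Q C) (hS : S ⊆ FixS Ω Q) :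
    Stb Q (C ∪ S) := by
  refine stb_of fun g hg x hx => ?_
  rw [mem_union] at *
  rcases hx with hx | hx
  · exact Or.inl (h.stb.smul_mem hg hx)
  · rw [mem_FixS.mp (hS hx) g hg]; exact Or.inr hx

def Cen (p : ℕ) (G : Type) {Ω : Type} [Group G] [Fintype Ω] [DecidableEq Ω] [MulAction G Ω]
    (X C : Finset Ω) : Prop :=
  ∃ (Q : Sylow p G) (S : Finset Ω), IsC Q C ∧ S ⊆ FixS Ω Q ∧ X = C ∪ S

theorem Ctx.cen_exists (c : Ctx p G Ω) {X : Finset Ω} (h1 : p ≤ X.card) (h2 : X.card < 2 * p) :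
    ∃ C, Cen p G X C := by
  obtain ⟨Q, hQ⟩ := c.hc X
  obtain ⟨C, hC, hCp, -, h3, h4⟩ := c.decomp h2 h1 hQ
  exact ⟨C, Q, X \ C, ⟨hCp, h3⟩, h4, by rw [union_sdiff_of_subset hC]⟩

theorem Cen.eqv {X X' C C' : Finset Ω} {g : G} (h : Cen p G X C) (h' : Cen p G X' C')
    (hg : g • X = X') : ∃ k : G, k • X = X' ∧ k • C = C' := by
  obtain ⟨Q, S, hC, hS, rfl⟩ := h
  obtain ⟨Q', S', hC', hS', rfl⟩ := h'
  obtain ⟨k, hk, hk'⟩ := conjT hg (stb_union hC hS) (stb_union hC' hS')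
  refine ⟨k, hk, hC'.uniq (hC.smul hk') hS' ?_⟩
  rw [← hk]
  exact smul_finset_subset_smul_finset subset_union_left

theorem Ctx.cen_up (c : Ctx p G Ω) {C : Finset Ω} (hC : C.card = p) {i : ℕ} (hi : i < p) :
    ∃ X, X.card = p + i ∧ Cen p G X C := by
  obtain ⟨Q, hQ⟩ := c.hc C
  obtain ⟨C', h1, h2, -, h3, -⟩ := c.decomp (by have := hp.out.pos; omega) hC.ge hQ
  obtain rfl := eq_of_subset_of_card_le h1 (by omega)
  have hfix := c.card_fix Q
  obtain ⟨S, hS, hSi⟩ := exists_subset_card_eq (show i ≤ (FixS Ω Q).card by omega)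
  have hI : IsC Q C' := ⟨h2, h3⟩
  exact ⟨C' ∪ S, by rw [card_union_of_disjoint (hI.disj hS)]; omega, Q, S, hI, hS, rfl⟩

theorem Ctx.wide (c : Ctx p G Ω) {W W' C C' : Finset Ω} (h : Cen p G W C) (h' : Cen p G W' C')
    (hW : W.card = 2 * p - 1) (hW' : W'.card = 2 * p - 1) {g : G} (hg : g • C = C') :
    ∃ k : G, k • W = W' := by
  obtain ⟨Q, S, hC, hS, rfl⟩ := h
  obtain ⟨Q', S', hC', hS', rfl⟩ := h'
  obtain ⟨k, hk, hk'⟩ := conjT hg hC.stb hC'.stb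
  have e1 := c.card_fix Q
  have e2 := c.card_fix Q'
  have hp0 := hp.out.pos
  rw [card_union_of_disjoint (hC.disj hS), hC.1] at hW
  rw [card_union_of_disjoint (hC'.disj hS'), hC'.1] at hW'
  have f1 := eq_of_subset_of_card_le hS (by omega)
  have f2 := eq_of_subset_of_card_le hS' (by omega)
  refine ⟨k, ?_⟩
  rw [smul_finset_union, hk, f1, f2, FixS_smul hk']

def HH (p : ℕ) (G Ω : Type) [Group G] [Fintype Ω] [DecidableEq Ω] [MulAction G Ω] (i : ℕ) : Prop :=
  ∀ (Q : Sylow p G) (C S S' : Finset Ω), IsC Q C → S ⊆ FixS Ω Q → S' ⊆ FixS Ω Q → S.card = i →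
    S'.card = i → ∃ g : G, g • (C ∪ S) = C ∪ S'

theorem HH.strong {i : ℕ} (h : HH p G Ω i) {Q : Sylow p G} {C S S' : Finset Ω} (hC : IsC Q C)
    (hS : S ⊆ FixS Ω Q) (hS' : S' ⊆ FixS Ω Q) (hi : S.card = i) (hi' : S'.card = i) :
    ∃ g : G, (∀ x, x ∈ Q ↔ g * x * g⁻¹ ∈ Q) ∧ g • C = C ∧ g • S = S' := by
  obtain ⟨g, hg⟩ := h Q C S S' hC hS hS' hi hi'
  obtain ⟨k, hk, hk'⟩ := conjT hg (stb_union hC hS) (stb_union hC hS')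
  have e1 : k • C = C := by
    refine hC.uniq (hC.smul hk') hS' ?_
    rw [← hk]
    exact smul_finset_subset_smul_finset subset_union_left
  refine ⟨k, hk', e1, ?_⟩
  have h2 : k • S ⊆ FixS Ω Q := by
    rw [FixS_smul hk']; exact smul_finset_subset_smul_finset hS
  rw [smul_finset_union, e1] at hk
  have h3 := congrArg (· \ C) hk
  simp only [union_sdiff_left] at h3
  rwa [sdiff_eq_self_of_disjoint (hC.disj h2).symm,
    sdiff_eq_self_of_disjoint (hC.disj hS').symm] at h3

theorem Ctx.HH_of_big (c : Ctx p G Ω) (h4 : 4 * p - 1 ≤ Fintype.card Ω) {i : ℕ} (hi : i < p) :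
    HH p G Ω i := by
  classical
  have hp0 := hp.out.pos
  choose! cen hcen using fun (X : Finset Ω) (h : p ≤ X.card ∧ X.card < 2 * p) => c.cen_exists h.1 h.2
  choose! wid hwid hwid' using fun (C : Finset Ω) (h : C.card = p) => c.cen_up h (show p - 1 < p by omega)
  have hceninv : ∀ (g : G) (X : Finset Ω), X.card = p + i → ∃ k : G, k • cen X = cen (g • X) := by
    intro g X hX
    obtain ⟨k, -, hk⟩ := Cen.eqv (hcen X ⟨by omega, by omega⟩) (hcen (g • X) ⟨by simp; omega, by simp; omega⟩) rfl
    exact ⟨k, hk⟩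
  let φ : VV G Ω p →ₗ[ℝ] VV G Ω (p + i) :=
    { toFun := fun f => ⟨fun X => if X.card = p + i then f.1 (cen X) else 0, by
        constructor
        · intro g s
          beta_reduce
          rw [card_smul_finset]
          split_ifs with h
          · obtain ⟨k, hk⟩ := hceninv g s h
            rw [← hk, f.2.1]
          · rfl
        · intro s hs
          beta_reduce
          rw [if_neg hs]⟩
      map_add' := fun f g => by
        ext Y; simp only [Submodule.coe_add, Pi.add_apply]; split_ifs <;> simp
      map_smul' := fun r f => by
        ext Y; simp only [Submodule.coe_smul, Pi.smul_apply, RingHom.id_apply]; split_ifs <;> simp }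
  have hφ : Function.Injective φ := by
    rw [injective_iff_map_eq_zero]
    intro f hf
    ext C
    by_cases hC : C.card = p
    · obtain ⟨X, hX, hXC⟩ := c.cen_up hC hi
      have h1 : (if X.card = p + i then f.1 (cen X) else 0) = 0 :=
        congrFun (congrArg Subtype.val hf) X
      rw [if_pos hX] at h1
      obtain ⟨k, -, hk⟩ := Cen.eqv (g := (1 : G)) hXC (hcen X ⟨by omega, by omega⟩) (one_smul _ _)
      rw [← hk, f.2.1] at h1
      simpa using h1
    · simpa using f.2.2 C hC
  let ψ : VV G Ω (2 * p - 1) →ₗ[ℝ] VV G Ω p :=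
    { toFun := fun f => ⟨fun C => if C.card = p then f.1 (wid C) else 0, by
        constructor
        · intro g s
          beta_reduce
          rw [card_smul_finset]
          split_ifs with h
          · have h' : (g • s).card = p := by simpa using h
            obtain ⟨k, hk⟩ := c.wide (hwid' s h) (hwid' (g • s) h')
              (by rw [hwid s h]; omega) (by rw [hwid (g • s) h']; omega) rfl
            rw [← hk, f.2.1]
          · rfl
        · intro s hs
          beta_reduce
          rw [if_neg hs]⟩
      map_add' := fun f g => by
        ext Y; simp only [Submodule.coe_add, Pi.add_apply]; split_ifs <;> simp
      map_smul' := fun r f => by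
        ext Y; simp only [Submodule.coe_smul, Pi.smul_apply, RingHom.id_apply]; split_ifs <;> simp }
  have hψ : Function.Injective ψ := by
    rw [injective_iff_map_eq_zero]
    intro f hf
    ext W
    by_cases hW : W.card = 2 * p - 1
    · obtain ⟨C, hC⟩ := c.cen_exists (X := W) (by omega) (by omega)
      have hCp : C.card = p := by obtain ⟨Q, S, h, -⟩ := hC; exact h.1
      have h1 : (if C.card = p then f.1 (wid C) else 0) = 0 :=
        congrFun (congrArg Subtype.val hf) C
      rw [if_pos hCp] at h1
      obtain ⟨k, hk⟩ := c.wide hC (hwid' C hCp) hW (by rw [hwid C hCp]; omega) (g := (1 : G)) (one_smul _ _)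
      rw [← hk, f.2.1] at h1
      simpa using h1
    · simpa using f.2.2 W hW
  have e1 := LinearMap.finrank_le_finrank_of_injective hφ
  have e2 := LinearMap.finrank_le_finrank_of_injective hψ
  have e3 := LW' (Ω := Ω) G (show p + i ≤ 2 * p - 1 by omega) (by omega)
  have hsurj : Function.Surjective φ :=
    (LinearMap.injective_iff_surjective_of_finrank_eq_finrank (by omega)).mp hφ
  intro Q C S S' hC hS hS' hSi hSi'
  have hX : (C ∪ S).card = p + i := by rw [card_union_of_disjoint (hC.disj hS), hC.1, hSi]
  have hX' : (C ∪ S').card = p + i := by rw [card_union_of_disjoint (hC.disj hS'), hC.1, hSi']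
  let F : VV G Ω (p + i) := ⟨fun X => if ∃ g : G, g • (C ∪ S) = X then 1 else 0, by
    constructor
    · intro g s
      beta_reduce
      congr 1
      refine propext ⟨?_, ?_⟩
      · rintro ⟨k, hk⟩; exact ⟨g⁻¹ * k, by rw [mul_smul, hk, inv_smul_smul]⟩
      · rintro ⟨k, hk⟩; exact ⟨g * k, by rw [mul_smul, hk]⟩
    · intro s hs
      beta_reduce
      rw [if_neg]
      rintro ⟨k, rfl⟩
      rw [card_smul_finset] at hs
      exact hs hX⟩
  obtain ⟨f, hf⟩ := hsurj F
  have key : ∀ T, T ⊆ FixS Ω Q → (C ∪ T).card = p + i → F.1 (C ∪ T) = f.1 C := by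
    intro T hT hTc
    rw [← hf]
    change (if (C ∪ T).card = p + i then f.1 (cen (C ∪ T)) else 0) = _
    rw [if_pos hTc]
    obtain ⟨k, -, hk⟩ := Cen.eqv (g := (1 : G)) (⟨Q, T, hC, hT, rfl⟩ : Cen p G (C ∪ T) C)
      (hcen (C ∪ T) ⟨by omega, by omega⟩) (one_smul _ _)
    rw [← hk, f.2.1]
  have h1 : F.1 (C ∪ S') = F.1 (C ∪ S) := (key S' hS' hX').trans (key S hS hX).symm
  have h2 : F.1 (C ∪ S) = 1 := if_pos ⟨1, one_smul _ _⟩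
  rw [h2] at h1
  by_contra hcon
  have h3 : F.1 (C ∪ S') = 0 := if_neg hcon
  rw [h3] at h1
  norm_num at h1

end syl9

section syl10
variable {G Ω : Type} [Group G] [Finite G] [Fintype Ω] [DecidableEq Ω] [MulAction G Ω]
  {p : ℕ} [hp : Fact p.Prime]

theorem set_conn (R : Finset Ω → Finset Ω → Prop) (hr : ∀ s, R s s)
    (ht : ∀ s t u, R s t → R t u → R s u) (Γ : Finset Ω)
    (hs : ∀ S ⊆ Γ, ∀ s ∈ S, ∀ s' ∈ Γ, s' ∉ S → R S (insert s' (S.erase s))) :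
    ∀ S S', S ⊆ Γ → S' ⊆ Γ → S.card = S'.card → R S S' := by
  have key : ∀ (k : ℕ) (S S' : Finset Ω), (S' \ S).card = k → S ⊆ Γ → S' ⊆ Γ → S.card = S'.card →
      R S S' := by
    intro k
    induction k with
    | zero =>
      intro S S' h0 _ _ hc
      rw [card_eq_zero, sdiff_eq_empty_iff_subset] at h0
      rw [eq_of_subset_of_card_le h0 (by omega)]
      exact hr _
    | succ k ih =>
      intro A A' h0 hA hA' hAp
      have h1 : (A' \ A).Nonempty := card_pos.mp (by omega)
      have h2 : (A \ A').Nonempty := card_pos.mp (by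
        have := card_sdiff_add_card_inter A A'
        have := card_sdiff_add_card_inter A' A
        rw [inter_comm] at this
        omega)
      obtain ⟨b, hb⟩ := h1
      obtain ⟨a, ha⟩ := h2
      rw [mem_sdiff] at hb ha
      have hba : b ≠ a := fun h => hb.2 (h ▸ ha.1)
      refine ht _ _ _ (hs A hA a ha.1 b (hA' hb.1) hb.2) (ih (insert b (A.erase a)) A' ?_ ?_ hA' ?_)
      · have : A' \ insert b (A.erase a) = (A' \ A).erase b := by
          ext y; simp only [mem_erase, mem_insert, mem_sdiff]
          grind
        rw [this, card_erase_of_mem (mem_sdiff.mpr hb)]; omega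
      · rw [insert_subset_iff]
        exact ⟨hA' hb.1, (erase_subset _ _).trans hA⟩
      · rw [card_insert_of_notMem (by simp [hb.2]), card_erase_of_mem ha.1]
        have : 0 < A.card := card_pos.mpr ⟨a, ha.1⟩
        omega
  exact fun S S' h1 h2 h3 => key _ S S' rfl h1 h2 h3

theorem Ctx.lift (c : Ctx p G Ω) (Q : Sylow p G) (f : Equiv.Perm Ω)
    (hf : ∀ x ∈ FixS Ω Q, f x ∈ FixS Ω Q) :
    ∃ g : G, (∀ x, x ∈ Q ↔ g * x * g⁻¹ ∈ Q) ∧ ∀ x ∈ FixS Ω Q, g • x = f x := by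
  obtain ⟨g, hg⟩ := c.MT_pred (FixS Ω Q) f (by rw [c.card_fix]) f.injective.injOn
  obtain ⟨Q', hQ'⟩ := conj_syl Q g
  have h1 : g • FixS Ω Q = FixS Ω Q := by
    refine eq_of_subset_of_card_le ?_ (by simp)
    intro y hy
    obtain ⟨x, hx, rfl⟩ := mem_smul_finset.mp hy
    rw [hg x hx]; exact hf x hx
  have h2 := FixS_smul (Ω := Ω) hQ'
  rw [h1] at h2
  obtain ⟨k, hk, hk'⟩ := syl_conj (pstab G (FixS Ω Q)) Q' Q
    (fun x hx => pw_iff.mpr h2.symm.subset x hx) (fun x hx => pw_iff.mpr subset_rfl x hx)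
  refine ⟨k * g, conj_trans hQ' hk', fun x hx => ?_⟩
  rw [mul_smul, hg x hx]
  exact hk _ (hf x hx)

theorem IsC.eq_or_disj {Q : Sylow p G} {C C' : Finset Ω} (h : IsC Q C) (h' : IsC Q C') :
    C' = C ∨ Disjoint C' C := by
  by_cases hd : Disjoint C' C
  · exact Or.inr hd
  · left
    rw [not_disjoint_iff] at hd
    obtain ⟨x, hx, hx'⟩ := hd
    rw [← h'.2 x hx, h.2 x hx']

theorem Ctx.sq_C (c : Ctx p G Ω) (h3 : Fintype.card Ω + 1 = 3 * p) {Q : Sylow p G} {C : Finset Ω}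
    (hC : IsC Q C) {g : G} (hg : ∀ x, x ∈ Q ↔ g * x * g⁻¹ ∈ Q) :
    (g • C = C ∨ g • C = (C ∪ FixS Ω Q)ᶜ) ∧ (g * g) • C = C := by
  have hfix := c.card_fix Q
  have hp0 := hp.out.pos
  have hΓ := FixS_smul (Ω := Ω) hg
  have h1 := hC.smul hg
  have hcu : (C ∪ FixS Ω Q).card = 2 * p - 1 := by
    rw [card_union_of_disjoint (hC.disj subset_rfl), hC.1, hfix]; omega
  have hcc : ∀ s : Finset Ω, g • sᶜ = (g • s)ᶜ := by
    intro s; ext x; simp [mem_smulF]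
  rcases hC.eq_or_disj h1 with h | h
  · exact ⟨Or.inl h, by rw [mul_smul, h, h]⟩
  · have h2 : g • C = (C ∪ FixS Ω Q)ᶜ := by
      refine eq_of_subset_of_card_le ?_ ?_
      · intro x hx
        rw [mem_compl, mem_union, not_or]
        exact ⟨fun h' => disjoint_left.mp h hx h', h1.notMem hx⟩
      · rw [card_compl, hcu, card_smul_finset, hC.1]; omega
    refine ⟨Or.inr h2, ?_⟩
    rw [mul_smul, h2, hcc, smul_finset_union, h2, ← hΓ]
    ext x
    have := @IsC.notMem _ _ _ _ _ _ _ _ _ _ _ hC x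
    simp only [mem_compl, mem_union]
    tauto

theorem Ctx.HH_three (c : Ctx p G Ω) (h3 : Fintype.card Ω + 1 = 3 * p) (h5 : 5 ≤ p) (i : ℕ) :
    HH p G Ω i := by
  intro Q C S S' hC hS hS' hi hi'
  have hfix := c.card_fix Q
  have := set_conn (fun S S' => ∃ g : G, g • C = C ∧ g • S = S') (fun s => ⟨1, by simp, by simp⟩)
    (by
      rintro s t u ⟨g, hg, hg'⟩ ⟨k, hk, hk'⟩
      exact ⟨k * g, by rw [mul_smul, hg, hk], by rw [mul_smul, hg', hk']⟩) (FixS Ω Q) (by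
      intro S hS s hs s' hs' hsS
      have hss' : s ≠ s' := fun h => hsS (h ▸ hs)
      have hsΓ := hS hs
      obtain ⟨r, hr, hrn⟩ : ∃ r ∈ FixS Ω Q, r ∉ ({s, s'} : Finset Ω) :=
        exists_mem_notMem_of_card_lt_card (by
          have := card_le_two (a := s) (b := s'); omega)
      simp only [mem_insert, mem_singleton, not_or] at hrn
      have main : ∀ τ : Equiv.Perm Ω, (∀ x ∈ FixS Ω Q, τ x ∈ FixS Ω Q) →
          (∀ x ∈ S, τ (τ x) ∈ insert s' (S.erase s)) →
          ∃ g : G, g • C = C ∧ g • S = insert s' (S.erase s) := by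
        intro τ h1 h2
        obtain ⟨g, hg, hgx⟩ := c.lift Q τ h1
        refine ⟨g * g, (c.sq_C h3 hC hg).2, eq_of_subset_of_card_le ?_ ?_⟩
        · intro y hy
          obtain ⟨x, hx, rfl⟩ := mem_smul_finset.mp hy
          rw [mul_smul, hgx x (hS hx), hgx _ (h1 x (hS hx))]
          exact h2 x hx
        · rw [card_smul_finset, card_insert_of_notMem (by simp [hsS]),
            card_erase_of_mem hs]
          have : 0 < S.card := card_pos.mpr ⟨s, hs⟩
          omega
      by_cases hrS : r ∈ S
      · refine main (Equiv.swap s s' * Equiv.swap s' r) ?_ ?_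
        · intro x hx
          simp only [Equiv.Perm.mul_apply, Equiv.swap_apply_def]
          grind
        · intro x hx
          simp only [Equiv.Perm.mul_apply, Equiv.swap_apply_def, mem_insert, mem_erase]
          grind
      · refine main (Equiv.swap s r * Equiv.swap r s') ?_ ?_
        · intro x hx
          simp only [Equiv.Perm.mul_apply, Equiv.swap_apply_def]
          grind
        · intro x hx
          simp only [Equiv.Perm.mul_apply, Equiv.swap_apply_def, mem_insert, mem_erase]
          grind)
  obtain ⟨g, hg, hg'⟩ := this S S' hS hS' (by omega)
  exact ⟨g, by rw [smul_finset_union, hg, hg']⟩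

def Eq' (G : Type) {Ω : Type} [Group G] [DecidableEq Ω] [MulAction G Ω] (s t : Finset Ω) : Prop :=
  ∃ g : G, g • s = t

theorem Eq'.refl (s : Finset Ω) : Eq' G s s := ⟨1, one_smul _ _⟩
theorem Eq'.symm {s t : Finset Ω} (h : Eq' G s t) : Eq' G t s := by
  obtain ⟨g, rfl⟩ := h; exact ⟨g⁻¹, inv_smul_smul _ _⟩
theorem Eq'.trans {s t u : Finset Ω} (h : Eq' G s t) (h' : Eq' G t u) : Eq' G s u := by
  obtain ⟨g, rfl⟩ := h; obtain ⟨k, rfl⟩ := h'; exact ⟨k * g, mul_smul _ _ _⟩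

theorem Ctx.L1 (c : Ctx p G Ω) {Y : Finset Ω} (hY : Y.card = p + 1) :
    ∃ y0 ∈ Y, ∀ y ∈ Y, ∀ y' ∈ Y, y ≠ y0 → y' ≠ y0 → Eq' G (Y.erase y) (Y.erase y') := by
  have hp2 := hp.out.two_le
  obtain ⟨Q, hQ⟩ := c.hc Y
  obtain ⟨C, hCW, hCp, hCQ, hCt, -⟩ := c.decomp (by omega) (by omega) hQ
  obtain ⟨s, hs, rfl⟩ := exists_singleton hCW (by omega)
  refine ⟨s, hs, fun y hy y' hy' hn hn' => ?_⟩
  have h1 : y' ∈ Qorb Q y := by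
    rw [hCt y (mem_erase.mpr ⟨hn, hy⟩)]; exact mem_erase.mpr ⟨hn', hy'⟩
  obtain ⟨g, hg, rfl⟩ := mem_Qorb.mp h1
  exact ⟨g, by rw [smul_erase', hQ g hg]⟩

theorem Ctx.S2a (c : Ctx p G Ω) (h3 : 3 ≤ p) (hH : HH p G Ω 1) {V : Finset Ω}
    (hV : V.card = p + 2) : ∃ C ⊆ V, C.card = p ∧
      ∃ β, ∀ X ⊆ V, X.card = p → X ≠ C → Eq' G X β := by
  obtain ⟨Q, hQ⟩ := c.hc V
  obtain ⟨C, hCV, hCp, hCQ, hCt, hfix⟩ := c.decomp (by omega) (by omega) hQ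
  have hC : IsC Q C := ⟨hCp, hCt⟩
  obtain ⟨s, s', hss, hS⟩ := card_eq_two.mp (show (V \ C).card = 2 by
    rw [card_sdiff_of_subset hCV]; omega)
  have hsV : s ∈ V \ C := by rw [hS]; simp
  have hsV' : s' ∈ V \ C := by rw [hS]; simp
  have hsf := hfix hsV
  have hsf' := hfix hsV'
  rw [mem_sdiff] at hsV hsV'
  have hVe : ∀ x ∈ V, x ∈ C ∨ x = s ∨ x = s' := by
    intro x hx
    by_cases h : x ∈ C
    · exact Or.inl h
    · right
      have : x ∈ V \ C := mem_sdiff.mpr ⟨hx, h⟩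
      rw [hS] at this
      simpa using this
  obtain ⟨g, hgN, hgC, hgs⟩ := hH.strong hC (S := {s}) (S' := {s'}) (by simpa using hsf)
    (by simpa using hsf') (by simp) (by simp)
  have hgs' : g • s = s' := by
    have : g • s ∈ g • ({s} : Finset Ω) := smul_mem_smul_finset (by simp)
    rw [hgs] at this
    simpa using this
  obtain ⟨c0, hc0⟩ := hC.ne
  set β := (V.erase c0).erase s' with hβ
  have ee : ∀ x, (V.erase x).erase s' = insert s (C.erase x) ∨ x ∉ C := by
    intro x
    by_cases hx : x ∈ C
    · left
      ext y
      simp only [mem_erase, mem_insert]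
      have := hVe y
      have := @hCV y
      grind
    · exact Or.inr hx
  have ee' : ∀ x, (V.erase x).erase s = insert s' (C.erase x) ∨ x ∉ C := by
    intro x
    by_cases hx : x ∈ C
    · left
      ext y
      simp only [mem_erase, mem_insert]
      have := hVe y
      have := @hCV y
      grind
    · exact Or.inr hx
  have b1 : ∀ x ∈ C, Eq' G ((V.erase x).erase s') β := by
    intro x hx
    have : c0 ∈ Qorb Q x := by rw [hCt x hx]; exact hc0
    obtain ⟨q, hq, rfl⟩ := mem_Qorb.mp this
    exact ⟨q, by rw [smul_erase', smul_erase', hQ q hq, mem_FixS.mp hsf' q hq]⟩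
  have b2 : ∀ x ∈ C, Eq' G ((V.erase x).erase s) β := by
    intro x hx
    have hx' : g⁻¹ • x ∈ C := by rw [← mem_smulF, hgC]; exact hx
    refine Eq'.trans ?_ (b1 _ hx')
    refine ⟨g⁻¹, ?_⟩
    rw [inv_smul_eq_iff, (ee _).resolve_right (not_not.mpr hx'),
      (ee' _).resolve_right (not_not.mpr hx), smul_finset_insert, hgs', smul_erase', hgC,
      smul_inv_smul]
  have b3 : ∀ x ∈ C, ∃ y0, ∀ y ∈ C, y ≠ x → y ≠ y0 → Eq' G ((V.erase x).erase y) β := by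
    intro x hx
    have hxs : x ≠ s := fun h => hsV.2 (h ▸ hx)
    have hxs' : x ≠ s' := fun h => hsV'.2 (h ▸ hx)
    obtain ⟨y0, hy0, h⟩ := c.L1 (Y := V.erase x) (by rw [card_erase_of_mem (hCV hx)]; omega)
    refine ⟨y0, fun y hy hyx hyy0 => ?_⟩
    by_cases hy0s : y0 = s
    · refine (h y (by simp [hyx, hCV hy]) s' (by simp [hxs'.symm, hsV'.1]) hyy0 ?_).trans (b1 x hx)
      rw [hy0s]; exact hss.symm
    · exact (h y (by simp [hyx, hCV hy]) s (by simp [hxs.symm, hsV.1]) hyy0 (Ne.symm hy0s)).trans (b2 x hx)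
  have b4 : ∀ x ∈ C, ∀ y ∈ C, x ≠ y → Eq' G ((V.erase x).erase y) β := by
    intro x hx y hy hxy
    by_contra hcon
    have : y ∈ Qorb Q x := by rw [hCt x hx]; exact hy
    obtain ⟨q, hq, rfl⟩ := mem_Qorb.mp this
    obtain ⟨y0, hy0⟩ := b3 (q • x) hy
    have e1 : x = y0 := by
      by_contra h
      exact hcon (by rw [erase_right_comm]; exact hy0 x hx hxy h)
    have e2 : q • q • x = y0 := by
      by_contra h
      have h1 := hy0 (q • q • x) (hCQ.smul_mem hq hy) (fun h => hxy (smul_left_cancel _ h).symm) h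
      refine hcon (Eq'.trans ⟨q, ?_⟩ h1)
      rw [smul_erase', smul_erase', hQ q hq]
    rw [← e1] at e2
    obtain ⟨j, hj⟩ := syl_pow Q hq
    have hodd : Odd (p ^ j) := (hp.out.odd_of_ne_two (by omega)).pow
    obtain ⟨m, hm⟩ := hodd
    have h2 : ∀ m : ℕ, q ^ (2 * m) • x = x := by
      intro m
      induction m with
      | zero => simp
      | succ m ih => rw [show 2 * (m + 1) = 2 * m + 2 by ring, pow_add, mul_smul, pow_two, mul_smul, e2, ih]
    have h4 : q ^ (2 * m + 1) • x = q • x := by rw [pow_succ', mul_smul, h2]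
    rw [← hm, hj, one_smul] at h4
    exact hxy h4
  refine ⟨C, hCV, hCp, β, fun X hX hXp hXC => ?_⟩
  obtain ⟨u, v, huv, hD⟩ := card_eq_two.mp (show (V \ X).card = 2 by
    rw [card_sdiff_of_subset hX]; omega)
  have huV : u ∈ V \ X := by rw [hD]; simp
  have hvV : v ∈ V \ X := by rw [hD]; simp
  rw [mem_sdiff] at huV hvV
  have hXe : X = (V.erase u).erase v := by
    rw [← Finset.sdiff_sdiff_eq_self hX, hD]
    ext y
    simp only [mem_sdiff, mem_insert, mem_singleton, mem_erase]
    tauto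
  rw [hXe]
  rcases hVe u huV.1 with hu | hu | hu <;> rcases hVe v hvV.1 with hv | hv | hv
  · exact b4 u hu v hv huv
  · rw [hv]; exact b2 u hu
  · rw [hv]; exact b1 u hu
  · rw [hu, erase_right_comm]; exact b2 v hv
  · exact absurd (hu.trans hv.symm) huv
  · exfalso
    apply hXC
    rw [hXe, hu, hv]
    ext y
    simp only [mem_erase]
    have := hVe y
    have := @hCV y
    grind
  · rw [hu, erase_right_comm]; exact b1 v hv
  · exfalso
    apply hXC
    rw [hXe, hu, hv]
    ext y
    simp only [mem_erase]
    have := hVe y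
    have := @hCV y
    grind
  · exact absurd (hu.trans hv.symm) huv

end syl10

section syl11
variable {G Ω : Type} [Group G] [Finite G] [Fintype Ω] [DecidableEq Ω] [MulAction G Ω]
  {p : ℕ} [hp : Fact p.Prime]

theorem Ctx.S2b (c : Ctx p G Ω) (h3 : 3 ≤ p) (hH : HH p G Ω 1) {X β : Finset Ω} (hX : X.card = p)
    (hβ : ¬ Eq' G X β) {v w u : Ω} (hv : v ∉ X) (hw : w ∉ X) (hvw : v ≠ w) (hu : u ∉ X) (huv : v ≠ u)
    (h : ∀ T ⊆ insert v (insert w X), T.card = p → T ≠ X → Eq' G T β) :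
    ∀ T ⊆ insert v (insert u X), T.card = p → T ≠ X → Eq' G T β := by
  have hV : (insert v (insert u X)).card = p + 2 := by
    rw [card_insert_of_notMem (by simp [huv, hv]), card_insert_of_notMem hu, hX]
  obtain ⟨C, hCV, hCp, β', hβ'⟩ := c.S2a h3 hH hV
  obtain ⟨y, hy, hyC⟩ : ∃ y ∈ X, (insert v X).erase y ≠ C := by
    obtain ⟨a, ha, b, hb, hab⟩ := one_lt_card.mp (show 1 < X.card by omega)
    by_cases h1 : (insert v X).erase a = C
    · refine ⟨b, hb, fun h2 => ?_⟩
      have : b ∈ (insert v X).erase a := by simp [hb, hab.symm]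
      rw [h1, ← h2] at this
      simp at this
    · exact ⟨a, ha, h1⟩
  have hc1 : ((insert v X).erase y).card = p := by
    rw [card_erase_of_mem (by simp [hy]), card_insert_of_notMem hv]; omega
  have hne : (insert v X).erase y ≠ X := fun h => by
    rw [← h] at hy; simp at hy
  have e1 : Eq' G ((insert v X).erase y) β := h _ (by
    intro z; simp only [mem_erase, mem_insert]; tauto) hc1 hne
  have e2 : Eq' G ((insert v X).erase y) β' := hβ' _ (by
    intro z; simp only [mem_erase, mem_insert]; tauto) hc1 hyC
  have hCX : C = X := by
    by_contra hne'
    have e3 := hβ' X (by intro z; simp only [mem_insert]; tauto) hX (Ne.symm hne')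
    exact hβ ((e3.trans e2.symm).trans e1)
  intro T hT hTp hTX
  exact ((hβ' T hT hTp (hCX ▸ hTX)).trans e2.symm).trans e1

theorem Ctx.homog_p (c : Ctx p G Ω) (h3 : 3 ≤ p) (hn : p + 2 ≤ Fintype.card Ω) (hH : HH p G Ω 1)
    (X X' : Finset Ω) (hX : X.card = p) (hX' : X'.card = p) : Eq' G X X' := by
  by_contra hcon
  have hbad : ∃ X0 : Finset Ω, X0.card = p ∧ ∃ v w β, v ∉ X0 ∧ w ∉ X0 ∧ v ≠ w ∧ ¬ Eq' G X0 β ∧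
      ∀ T ⊆ insert v (insert w X0), T.card = p → T ≠ X0 → Eq' G T β := by
    by_contra hno
    apply hcon
    refine set_conn (fun S T => S.card = p → Eq' G S T) (fun s _ => Eq'.refl s) ?_ univ ?_ X X' 
      (subset_univ _) (subset_univ _) (by omega) hX
    · intro s t u h1 h2 hs
      refine (h1 hs).trans (h2 ?_)
      obtain ⟨g, hg⟩ := h1 hs
      rw [← hg, card_smul_finset, hs]
    · intro S _ s hs s' _ hs' hSp
      by_contra hne
      obtain ⟨w, hw⟩ : ∃ w, w ∉ insert s' S := by
        by_contra! hall
        have : (insert s' S).card = Fintype.card Ω := by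
          rw [eq_univ_of_forall hall, card_univ]
        rw [card_insert_of_notMem hs'] at this
        omega
      have hV : (insert w (insert s' S)).card = p + 2 := by
        rw [card_insert_of_notMem hw, card_insert_of_notMem hs', hSp]
      have hS'p : (insert s' (S.erase s)).card = p := by
        rw [card_insert_of_notMem (by simp [hs']), card_erase_of_mem hs]
        omega
      obtain ⟨C, hCV, hCp, β, hβ⟩ := c.S2a h3 hH hV
      have sub1 : S ⊆ insert w (insert s' S) := by
        intro z; simp only [mem_insert]; tauto
      have sub2 : insert s' (S.erase s) ⊆ insert w (insert s' S) := by
        intro z; simp only [mem_insert, mem_erase]; tauto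
      have hCβ : ¬ Eq' G C β := by
        intro hC
        have hall : ∀ T ⊆ insert w (insert s' S), T.card = p → Eq' G T β := by
          intro T hT hTp
          by_cases h : T = C
          · rw [h]; exact hC
          · exact hβ T hT hTp h
        exact hne ((hall _ sub1 hSp).trans (hall _ sub2 hS'p).symm)
      obtain ⟨v, w', hvw', hd⟩ := card_eq_two.mp (show ((insert w (insert s' S)) \ C).card = 2 by
        rw [card_sdiff_of_subset hCV, hV, hCp]; omega)
      have hv : v ∈ (insert w (insert s' S)) \ C := by rw [hd]; simp
      have hw' : w' ∈ (insert w (insert s' S)) \ C := by rw [hd]; simp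
      rw [mem_sdiff] at hv hw'
      refine hno ⟨C, hCp, v, w', β, hv.2, hw'.2, hvw', hCβ, ?_⟩
      intro T hT
      refine hβ T (hT.trans ?_)
      rw [insert_subset_iff, insert_subset_iff]
      exact ⟨hv.1, hw'.1, hCV⟩
  obtain ⟨X, hX, v, w, β, hv, hw, hvw, hβ, h⟩ := hbad
  obtain ⟨A, hAX, hA⟩ := exists_subset_card_eq (s := X) (n := p - 2) (by omega)
  obtain ⟨x, x', hxx', hd⟩ := card_eq_two.mp (show (X \ A).card = 2 by
        rw [card_sdiff_of_subset hAX, hA, hX]; omega)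
  have hx : x ∈ X \ A := by rw [hd]; simp
  have hx' : x' ∈ X \ A := by rw [hd]; simp
  rw [mem_sdiff] at hx hx'
  obtain ⟨g, hg⟩ := c.MT_pred (insert x A) (fun y => if y = x then v else y) (by
      rw [card_insert_of_notMem hx.2]; omega) (by
      intro a ha b hb hab
      simp only [coe_insert, Set.mem_insert_iff, mem_coe] at ha hb
      have := fun h => hv (hAX h)
      dsimp only at hab
      grind)
  have hgx : g • x = v := by
    have := hg x (by simp)
    simpa using this
  have hgA : ∀ a ∈ A, g • a = a := by
    intro a ha
    have := hg a (by simp [ha])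
    rwa [if_neg (by rintro rfl; exact hx.2 ha)] at this
  have hgX : g • X = insert v (insert (g • x') A) := by
    have : X = insert x (insert x' A) := by
      rw [← sdiff_union_of_subset hAX, hd]; ext; simp
    rw [this, smul_finset_insert, smul_finset_insert, hgx]
    congr 2
    ext z
    rw [mem_smul_finset]
    constructor
    · rintro ⟨y, hy, rfl⟩; rwa [hgA y hy]
    · intro hz; exact ⟨z, hz, hgA z hz⟩
  have hgXX : g • X ≠ X := fun e => hv (by rw [← e, hgX]; simp)
  apply hβ
  refine Eq'.trans ⟨g, rfl⟩ ?_
  have hgp : (g • X).card = p := by rw [card_smul_finset, hX]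
  by_cases hu : g • x' ∈ X
  · refine h _ ?_ hgp hgXX
    rw [hgX]
    intro z; simp only [mem_insert]
    rintro (rfl | rfl | h)
    · simp
    · simp [hu]
    · simp [hAX h]
  · have huv : v ≠ g • x' := by
      intro h
      rw [← hgx] at h
      exact hxx' (MulAction.injective g h)
    refine c.S2b h3 hH hX hβ hv hw hvw hu huv h _ ?_ hgp hgXX
    rw [hgX]
    intro z; simp only [mem_insert]
    rintro (rfl | rfl | h)
    · simp
    · simp
    · simp [hAX h]

theorem Ctx.homog (c : Ctx p G Ω) (hom : ∀ X X' : Finset Ω, X.card = p → X'.card = p → Eq' G X X')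
    {i : ℕ} (hi : i < p) (hH : HH p G Ω i) (S S' : Finset Ω) (hS : S.card = p + i)
    (hS' : S'.card = p + i) : Eq' G S S' := by
  obtain ⟨Q, hQ⟩ := c.hc S
  obtain ⟨Q', hQ'⟩ := c.hc S'
  obtain ⟨C, hC, hCp, hCs, hCo, hCF⟩ := c.decomp (by omega) (by omega) hQ
  obtain ⟨C', hC', hCp', hCs', hCo', hCF'⟩ := c.decomp (by omega) (by omega) hQ'
  obtain ⟨g, hg⟩ := hom C C' hCp hCp'
  obtain ⟨k, hk, hk'⟩ := conjT hg hCs hCs'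
  have h1 := FixS_smul (Ω := Ω) hk'
  have h2 : k • (S \ C) ⊆ FixS Ω Q' := by
    rw [h1]; exact smul_finset_subset_smul_finset hCF
  obtain ⟨l, hl⟩ := hH Q' C' (k • (S \ C)) (S' \ C') ⟨hCp', hCo'⟩ h2 hCF' (by
    rw [card_smul_finset, card_sdiff_of_subset hC]; omega) (by
    rw [card_sdiff_of_subset hC']; omega)
  refine ⟨l * k, ?_⟩
  rw [mul_smul]
  have : S = C ∪ (S \ C) := by rw [union_sdiff_of_subset hC]
  rw [this, smul_finset_union, hk, hl, union_sdiff_of_subset hC']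

end syl11

section jordan
variable {α : Type} [Fintype α] [DecidableEq α] {p : ℕ} [hp : Fact p.Prime]

def fixer (M : Subgroup (Equiv.Perm α)) (C : Finset α) : Subgroup (Equiv.Perm α) where
  carrier := {g | g ∈ M ∧ ∀ x ∉ C, g x = x}
  one_mem' := ⟨M.one_mem, by simp⟩
  mul_mem' := fun {a b} ha hb => ⟨M.mul_mem ha.1 hb.1, fun x hx => by
    rw [Equiv.Perm.mul_apply, hb.2 x hx, ha.2 x hx]⟩
  inv_mem' := fun {a} ha => ⟨M.inv_mem ha.1, fun x hx => by
    rw [Equiv.Perm.inv_eq_iff_eq, ha.2 x hx]⟩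

theorem fixer_card (M : Subgroup (Equiv.Perm α)) (C : Finset α) :
    Nat.card (fixer M C) ∣ C.card.factorial := by
  have h1 : fixer M C ≤ (Equiv.Perm.ofSubtype (p := (· ∈ C))).range := by
    intro g hg
    have hh : ∀ x, g x ∈ C ↔ x ∈ C := ?_
    · refine ⟨Equiv.Perm.subtypePerm g hh, Equiv.Perm.ofSubtype_subtypePerm (p := (· ∈ C)) hh ?_⟩
      intro x hx; by_contra h; exact hx (hg.2 x h)
    · intro x
      constructor
      · intro h; by_contra hx
        have := hg.2 _ hx
        exact hx (this ▸ h)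
      · intro hx; by_contra h
        have := hg.2 _ h
        rw [g.injective this] at h
        exact h hx
  have h2 := Subgroup.card_dvd_of_le h1
  rw [Nat.card_congr (MonoidHom.ofInjective (f := Equiv.Perm.ofSubtype (p := (· ∈ C)))
    Equiv.Perm.ofSubtype_injective).toEquiv.symm] at h2
  rwa [Nat.card_eq_fintype_card (α := Equiv.Perm _), Fintype.card_perm, Fintype.card_coe] at h2

theorem jordan_conj (M : Subgroup (Equiv.Perm α)) {z z' : Equiv.Perm α} (hz : z ∈ M) (hz' : z' ∈ M)
    (ho : orderOf z = p) (ho' : orderOf z' = p) (C : Finset α) (hC : C.card = p)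
    (hs : ∀ x ∉ C, z x = x) (hs' : ∀ x ∉ C, z' x = x) :
    ∃ k ∈ fixer M C, k * z' * k⁻¹ ∈ Subgroup.zpowers z := by
  have key : ∀ w : fixer M C, orderOf w = p → ∃ P : Sylow p (fixer M C), (P : Subgroup (fixer M C)) = Subgroup.zpowers w := by
    intro w hw
    have hpg : IsPGroup p (Subgroup.zpowers w) := IsPGroup.of_card (n := 1) (by
      rw [Nat.card_zpowers, hw, pow_one])
    obtain ⟨P, hP⟩ := hpg.exists_le_sylow
    refine ⟨P, (Subgroup.eq_of_le_of_card_ge hP ?_).symm⟩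
    obtain ⟨k, hk⟩ := P.isPGroup'.exists_card_eq
    rw [Nat.card_zpowers, hw]
    have h1 : p ^ k ∣ p.factorial := by
      rw [← hk]
      refine (Subgroup.card_subgroup_dvd_card _).trans ?_
      have := fixer_card M C
      rwa [hC] at this
    have hk1 : k ≤ 1 := by
      rw [hp.out.pow_dvd_factorial_iff (b := 2)] at h1
      · simpa [Nat.div_self hp.out.pos] using h1
      · rw [Nat.log_lt_iff_lt_pow hp.out.one_lt hp.out.pos.ne']
        nlinarith [hp.out.two_le]
    change Nat.card P ≤ p
    rw [hk]
    calc p ^ k ≤ p ^ 1 := Nat.pow_le_pow_right hp.out.pos hk1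
      _ = p := pow_one p
  have hzf : z ∈ fixer M C := ⟨hz, hs⟩
  have hzf' : z' ∈ fixer M C := ⟨hz', hs'⟩
  obtain ⟨P, hP⟩ := key ⟨z, hzf⟩ (by rw [Subgroup.orderOf_mk, ho])
  obtain ⟨P', hP'⟩ := key ⟨z', hzf'⟩ (by rw [Subgroup.orderOf_mk, ho'])
  obtain ⟨k, -, hk⟩ := syl_conj ⊤ P' P (fun _ _ => trivial) (fun _ _ => trivial)
  refine ⟨k, k.2, ?_⟩
  have h1 : (⟨z', hzf'⟩ : fixer M C) ∈ (P' : Subgroup (fixer M C)) := by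
    rw [hP']; exact Subgroup.mem_zpowers _
  have h2 : _ ∈ (P : Subgroup (fixer M C)) := (hk _).mp h1
  rw [hP] at h2
  obtain ⟨j, hj⟩ := h2
  refine ⟨j, ?_⟩
  have := congrArg Subtype.val hj
  simpa using this

theorem jordan_lift (M : Subgroup (Equiv.Perm α)) (hM : IsPreprimitive M α) {z : Equiv.Perm α} (hz : z ∈ M)
    (hc : z.IsCycle) (hcp : z.support.card = p) (h3 : p + 1 ≤ Fintype.card α) (f : Equiv.Perm α)
    (hf : ∀ x ∈ z.support, f x = x) :
    ∃ m ∈ M, (∀ x ∉ z.support, m x = f x) ∧ m * z * m⁻¹ ∈ Subgroup.zpowers z := by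
  have hsn : ((z.support : Set α)ᶜ).ncard = (Fintype.card α - p - 1) + 1 := by
    rw [← coe_compl, Set.ncard_coe_finset, card_compl, hcp]; omega
  have hp2 := hp.out.two_le
  have hcard : Nat.card (SubMulAction.ofFixingSubgroup M ((z.support : Set α)ᶜ)) = p := by
    have : Nat.card (SubMulAction.ofFixingSubgroup M ((z.support : Set α)ᶜ)) = Nat.card (z.support : Set α) := by
      refine Nat.card_congr (Equiv.subtypeEquivRight ?_)
      intro x
      rw [SubMulAction.mem_ofFixingSubgroup_iff]; simp
    rw [this, Nat.card_eq_card_toFinset]; simp [hcp]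
  have hmp : IsMultiplyPreprimitive M α (Fintype.card α - p - 1 + 2) := by
    refine hM.isMultiplyPreprimitive hsn (by rw [Nat.card_eq_fintype_card]; omega) ?_
    have := Equiv.Perm.isPretransitive_of_isCycle_mem hc hz
    exact IsPreprimitive.of_prime_card (by rw [hcard]; exact hp.out)
  have hmt : IsMultiplyPretransitive M α (Fintype.card α - p) := by
    have := IsMultiplyPreprimitive.isMultiplyPretransitive M α (Fintype.card α - p - 1 + 2)
    exact isMultiplyPretransitive_of_le (n := Fintype.card α - p - 1 + 2) (by omega) (by
      rw [Nat.card_eq_fintype_card]; omega)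
  let e : Fin (Fintype.card α - p) ≃ (z.supportᶜ : Finset α) :=
    (equivFinOfCardEq (by rw [card_compl, hcp])).symm
  obtain ⟨m0, hm0⟩ := hmt.exists_smul_eq (e.toEmbedding.trans (Function.Embedding.subtype _))
    ((e.toEmbedding.trans (Function.Embedding.subtype _)).trans f.toEmbedding)
  have hm0' : ∀ x ∉ z.support, (m0 : Equiv.Perm α) x = f x := by
    intro x hx
    have := DFunLike.congr_fun hm0 (e.symm ⟨x, by simpa using hx⟩)
    simp at this
    exact this
  have hfs : ∀ x ∉ z.support, f x ∉ z.support := by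
    intro x hx h
    have := hf _ h
    rw [f.injective this] at h
    exact hx h
  obtain ⟨k, hk, hk'⟩ := jordan_conj (p := p) M hz (z' := m0 * z * (m0 : Equiv.Perm α)⁻¹)
    (M.mul_mem (M.mul_mem m0.2 hz) (M.inv_mem m0.2)) (by rw [hc.orderOf, hcp]) (by
      rw [← hcp, ← hc.orderOf]
      exact orderOf_injective (MulAut.conj (m0 : Equiv.Perm α)).toMonoidHom (MulEquiv.injective _) z)
    z.support hcp (by simp) (by
      have himg : image (m0 : Equiv.Perm α) (z.supportᶜ) = z.supportᶜ := by
        refine eq_of_subset_of_card_le ?_ (by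
          rw [card_image_of_injective _ (m0 : Equiv.Perm α).injective])
        intro y hy
        obtain ⟨x, hx, rfl⟩ := mem_image.mp hy
        rw [mem_compl] at hx ⊢
        rw [hm0' x hx]; exact hfs x hx
      intro x hx
      have : x ∈ image (m0 : Equiv.Perm α) (z.supportᶜ) := by rw [himg]; simpa using hx
      obtain ⟨y, hy, rfl⟩ := mem_image.mp this
      rw [mem_compl, Equiv.Perm.notMem_support] at hy
      simp [hy])
  refine ⟨k * m0, M.mul_mem hk.1 m0.2, ?_, ?_⟩
  · intro x hx
    rw [Equiv.Perm.mul_apply, hm0' x hx, hk.2 _ (hfs x hx)]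
  · convert hk' using 1
    group

theorem jordan_prime (M : Subgroup (Equiv.Perm α)) (hM : IsPreprimitive M α) {z : Equiv.Perm α} (hz : z ∈ M)
    (hc : z.IsCycle) (hcp : z.support.card = p) (h3 : p = 3 ∨ p + 3 ≤ Fintype.card α) :
    alternatingGroup α ≤ M := by
  rcases h3 with rfl | h3
  · exact Equiv.Perm.alternatingGroup_le_of_isPreprimitive_of_isThreeCycle_mem hM
      (card_support_eq_three_iff.mp hcp) hz
  obtain ⟨a, b, c, hab, hac, hbc, ha, hb, hcc⟩ : ∃ a b c, a ≠ b ∧ a ≠ c ∧ b ≠ c ∧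
      a ∉ z.support ∧ b ∉ z.support ∧ c ∉ z.support := by
    obtain ⟨a, ha, b, hb, c, hc, h⟩ := two_lt_card.mp (show 2 < (z.supportᶜ).card by
      rw [card_compl, hcp]; omega)
    rw [mem_compl] at ha hb hc
    exact ⟨a, b, c, h.1, h.2.1, h.2.2, ha, hb, hc⟩
  have sw : ∀ u v, u ∉ z.support → v ∉ z.support → ∀ x ∈ z.support, Equiv.swap u v x = x := by
    intro u v hu hv x hx
    exact Equiv.swap_apply_of_ne_of_ne (fun h => hu (h ▸ hx)) (fun h => hv (h ▸ hx))
  have sw' : ∀ u v, u ∉ z.support → v ∉ z.support → ∀ x ∉ z.support, Equiv.swap u v x ∉ z.support := by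
    intro u v hu hv x hx h
    have := sw u v hu hv _ h
    rw [(Equiv.swap u v).injective this] at h
    exact hx h
  obtain ⟨m1, hm1, h1, e1⟩ := jordan_lift (p := p) M hM hz hc hcp (by omega) (Equiv.swap a b) (sw a b ha hb)
  obtain ⟨m2, hm2, h2, e2⟩ := jordan_lift (p := p) M hM hz hc hcp (by omega) (Equiv.swap a c) (sw a c ha hcc)
  have hmm1 : ∀ x ∉ z.support, m1⁻¹ x = Equiv.swap a b x := by
    intro x hx
    rw [Equiv.Perm.inv_eq_iff_eq, h1 _ (sw' a b ha hb x hx), Equiv.swap_apply_self]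
  have hmm2 : ∀ x ∉ z.support, m2⁻¹ x = Equiv.swap a c x := by
    intro x hx
    rw [Equiv.Perm.inv_eq_iff_eq, h2 _ (sw' a c ha hcc x hx), Equiv.swap_apply_self]
  obtain ⟨i1, e1⟩ := e1
  obtain ⟨i2, e2⟩ := e2
  dsimp only at e1 e2
  have c1 : m1 * m2 * z * (m1 * m2)⁻¹ = z ^ (i1 * i2) := by
    have : m1 * m2 * z * (m1 * m2)⁻¹ = m1 * (m2 * z * m2⁻¹) * m1⁻¹ := by group
    rw [this, ← e2, ← conj_zpow, ← e1, zpow_mul]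
  have c2 : m2 * m1 * z * (m2 * m1)⁻¹ = z ^ (i1 * i2) := by
    have : m2 * m1 * z * (m2 * m1)⁻¹ = m2 * (m1 * z * m1⁻¹) * m2⁻¹ := by group
    rw [this, ← e1, ← conj_zpow, ← e2, ← zpow_mul, mul_comm]
  set w := m1 * m2 * m1⁻¹ * m2⁻¹ with hw
  have hwM : w ∈ M := M.mul_mem (M.mul_mem (M.mul_mem hm1 hm2) (M.inv_mem hm1)) (M.inv_mem hm2)
  set y := m2 * m1 * z * (m2 * m1)⁻¹ with hy
  have hyM : y ∈ M := by rw [c2]; exact M.zpow_mem hz _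
  have hwy : w * y = y * w := by
    have : w * y * w⁻¹ = m1 * m2 * z * (m1 * m2)⁻¹ := by rw [hw, hy]; group
    rw [c1, ← c2] at this
    exact mul_inv_eq_iff_eq_mul.mp this
  have hyc : y.IsCycle := hc.conj
  have hys : y.support = z.support := by
    refine eq_of_subset_of_card_le ?_ ?_
    · rw [c2]; exact Equiv.Perm.support_zpow_le _ _
    · rw [hy, Equiv.Perm.card_support_conj]
  have hw1 : ∀ x ∉ z.support, w x = (Equiv.swap a b * Equiv.swap a c) ((Equiv.swap a b * Equiv.swap a c) x) := by
    intro x hx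
    simp only [hw, Equiv.Perm.mul_apply]
    have k1 := sw' a c ha hcc x hx
    have k2 := sw' a b ha hb _ k1
    have k3 := sw' a c ha hcc _ k2
    rw [hmm2 x hx, hmm1 _ k1, h2 _ k2, h1 _ k3]
  have hwC : ∀ x ∈ z.support, w x ∈ z.support := by
    intro x hx
    rw [← hys, Equiv.Perm.mem_support] at hx ⊢
    intro h
    apply hx
    apply w.injective
    rw [← Equiv.Perm.mul_apply, hwy, Equiv.Perm.mul_apply, h]
  obtain ⟨x0, hx0⟩ := hc.nonempty_support
  obtain ⟨j, hj⟩ := hyc.exists_zpow_eq (x := x0) (y := w x0)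
    (by rw [← Equiv.Perm.mem_support, hys]; exact hx0)
    (by rw [← Equiv.Perm.mem_support, hys]; exact hwC _ hx0)
  have hcom : ∀ i : ℤ, w * y ^ i = y ^ i * w := fun i => (Commute.zpow_right (show Commute w y from hwy) i)
  have hwyj : ∀ x ∈ z.support, w x = (y ^ j) x := by
    intro x hx
    obtain ⟨i, rfl⟩ := hyc.exists_zpow_eq (x := x0) (y := x)
      (by rw [← Equiv.Perm.mem_support, hys]; exact hx0)
      (by rw [← Equiv.Perm.mem_support, hys]; exact hx)
    rw [← Equiv.Perm.mul_apply, hcom, Equiv.Perm.mul_apply, ← hj, ← Equiv.Perm.mul_apply,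
      ← Equiv.Perm.mul_apply, zpow_mul_comm]
  have hu : (y ^ j)⁻¹ * w = (Equiv.swap a b * Equiv.swap a c) * (Equiv.swap a b * Equiv.swap a c) := by
    ext x
    by_cases hx : x ∈ z.support
    · rw [Equiv.Perm.mul_apply, hwyj x hx, ← Equiv.Perm.mul_apply, inv_mul_cancel]
      simp only [Equiv.Perm.one_apply, Equiv.Perm.mul_apply, sw a c ha hcc x hx, sw a b ha hb x hx]
    · have hwx : w x ∉ z.support := by
        rw [hw1 x hx]
        simp only [Equiv.Perm.mul_apply]
        exact sw' a b ha hb _ (sw' a c ha hcc _ (sw' a b ha hb _ (sw' a c ha hcc _ hx)))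
      rw [Equiv.Perm.mul_apply]
      have : (y ^ j) (w x) = w x := by
        by_contra h
        have h2 := Equiv.Perm.support_zpow_le y j (Equiv.Perm.mem_support.mpr h)
        rw [hys] at h2
        exact hwx h2
      rw [Equiv.Perm.inv_eq_iff_eq.mpr this.symm, hw1 x hx, Equiv.Perm.mul_apply (Equiv.swap a b * Equiv.swap a c)]
  have h3c := (Equiv.Perm.isThreeCycle_swap_mul_swap_same hab hac hbc).isThreeCycle_sq
  rw [← hu] at h3c
  exact Equiv.Perm.alternatingGroup_le_of_isPreprimitive_of_isThreeCycle_mem hM h3c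
    (M.mul_mem (M.inv_mem (M.zpow_mem hyM _)) hwM)

end jordan

section jordan2
variable {α : Type} [Fintype α] [DecidableEq α] {p : ℕ} [hp : Fact p.Prime]

theorem jordan_trans (M : Subgroup (Equiv.Perm α)) [IsPretransitive M α] {z : Equiv.Perm α} (hz : z ∈ M)
    (hc : z.IsCycle) (hcp : z.support.card = p) (h2 : Fintype.card α < 2 * p)
    (h3 : p = 3 ∨ p + 3 ≤ Fintype.card α) :
    alternatingGroup α ≤ M := by
  refine jordan_prime M ?_ hz hc hcp h3
  have hmem : ∀ x, x ∈ SubMulAction.ofFixingSubgroup M ((z.support : Set α)ᶜ) ↔ x ∈ (z.support : Set α) := by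
    intro x
    rw [SubMulAction.mem_ofFixingSubgroup_iff]; simp
  have hcard : Nat.card (SubMulAction.ofFixingSubgroup M ((z.support : Set α)ᶜ)) = p := by
    have : Nat.card (SubMulAction.ofFixingSubgroup M ((z.support : Set α)ᶜ)) = Nat.card (z.support : Set α) :=
      Nat.card_congr (Equiv.subtypeEquivRight hmem)
    rw [this, Nat.card_eq_card_toFinset]; simp [hcp]
  have := Equiv.Perm.isPretransitive_of_isCycle_mem hc hz
  have hpp : IsPreprimitive (fixingSubgroup M ((z.support : Set α)ᶜ))
      (SubMulAction.ofFixingSubgroup M ((z.support : Set α)ᶜ)) :=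
    IsPreprimitive.of_prime_card (by rw [hcard]; exact hp.out)
  let f : (SubMulAction.ofFixingSubgroup M ((z.support : Set α)ᶜ)) →ₑ[
      (fixingSubgroup M ((z.support : Set α)ᶜ)).subtype] α :=
    { toFun := Subtype.val, map_smul' := fun m x => rfl }
  refine IsPreprimitive.of_card_lt (f := f) ?_
  have hr : Set.range f = (z.support : Set α) := by
    ext x
    rw [← hmem]
    constructor
    · rintro ⟨y, rfl⟩; exact y.2
    · intro h; exact ⟨⟨x, h⟩, rfl⟩
  rw [hr, Set.ncard_coe_finset, hcp, Nat.card_eq_fintype_card]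
  exact h2

end jordan2

section syl13
variable {G Ω : Type} [Group G] [Finite G] [Fintype Ω] [DecidableEq Ω] [MulAction G Ω]
  {p : ℕ} [hp : Fact p.Prime]

theorem smem {g : G} {Y : Finset Ω} (h : g • Y = Y) {y : Ω} (hy : y ∈ Y) : g • y ∈ Y := by
  have := smul_mem_smul_finset (a := g) hy
  rwa [h] at this

def pY (Y : Finset Ω) (g : G) (h : g • Y = Y) : Equiv.Perm Y where
  toFun y := ⟨g • (y : Ω), smem h y.2⟩
  invFun y := ⟨g⁻¹ • (y : Ω), smem (inv_smul_eq_iff.mpr h.symm) y.2⟩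
  left_inv y := by simp
  right_inv y := by simp

theorem pY_apply {Y : Finset Ω} {g : G} (h : g • Y = Y) (y : Y) : ((pY Y g h y : Y) : Ω) = g • (y : Ω) := rfl

def MY (G : Type) {Ω : Type} [Group G] [Fintype Ω] [DecidableEq Ω] [MulAction G Ω] (Y : Finset Ω) :
    Subgroup (Equiv.Perm Y) where
  carrier := {σ | ∃ g : G, g • Y = Y ∧ ∀ y : Y, g • (y : Ω) = σ y}
  one_mem' := ⟨1, one_smul _ _, by simp⟩
  mul_mem' := by
    rintro a b ⟨g, hg, hg'⟩ ⟨k, hk, hk'⟩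
    exact ⟨g * k, by rw [mul_smul, hk, hg], fun y => by rw [mul_smul, hk', hg', Equiv.Perm.mul_apply]⟩
  inv_mem' := by
    rintro a ⟨g, hg, hg'⟩
    refine ⟨g⁻¹, inv_smul_eq_iff.mpr hg.symm, fun y => ?_⟩
    rw [inv_smul_eq_iff, hg']; simp

theorem mem_MY {Y : Finset Ω} {σ : Equiv.Perm Y} : σ ∈ MY G Y ↔ ∃ g : G, g • Y = Y ∧ ∀ y : Y, g • (y : Ω) = σ y :=
  Iff.rfl

theorem pY_mem {Y : Finset Ω} {g : G} (h : g • Y = Y) : pY Y g h ∈ MY G Y := ⟨g, h, fun _ => rfl⟩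

theorem pY_pow {Y : Finset Ω} {g : G} (h : g • Y = Y) (j : ℕ) (y : Y) :
    (((pY Y g h) ^ j) y : Ω) = g ^ j • (y : Ω) := by
  induction j generalizing y with
  | zero => simp
  | succ j ih => rw [pow_succ, pow_succ, Equiv.Perm.mul_apply, ih, mul_smul]; rfl

theorem alt_of_trans {Q : Sylow p G} {C Y : Finset Ω} (hC : IsC Q C) (hCY : C ⊆ Y)
    (hF : Y \ C ⊆ FixS Ω Q) (h2 : Y.card < 2 * p) (h3 : p = 3 ∨ p + 3 ≤ Y.card)
    (ht : ∀ x ∈ Y, ∀ y ∈ Y, ∃ g : G, g • Y = Y ∧ g • x = y) (σ : Equiv.Perm Y)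
    (hσ : Equiv.Perm.sign σ = 1) : ∃ g : G, g • Y = Y ∧ ∀ y : Y, g • (y : Ω) = σ y := by
  have hQY : Stb Q Y := by
    have := stb_union hC hF
    rwa [union_sdiff_of_subset hCY] at this
  obtain ⟨x, hx⟩ := hC.ne
  obtain ⟨q, hq, hqx⟩ : ∃ q ∈ Q, q • x ≠ x := by
    by_contra! h
    exact hC.notMem hx (mem_FixS.mpr h)
  have hqY := hQY q hq
  set w := pY Y q hqY with hw
  have hw1 : w ≠ 1 := by
    intro h
    have := congrArg (fun σ : Equiv.Perm Y => ((σ ⟨x, hCY hx⟩ : Y) : Ω)) h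
    exact hqx this
  obtain ⟨j, hj⟩ := syl_pow Q hq
  have hwj : w ^ p ^ j = 1 := by
    ext y
    rw [pY_pow, hj]; simp
  have hpd : p ∣ orderOf w := by
    obtain ⟨i, hi, hi'⟩ := (Nat.dvd_prime_pow hp.out).mp (orderOf_dvd_of_pow_eq_one hwj)
    rw [hi']
    refine dvd_pow_self p ?_
    rintro rfl
    rw [pow_zero, orderOf_eq_one_iff] at hi'
    exact hw1 hi'
  set z := w ^ (orderOf w / p) with hz
  have hzo : orderOf z = p := orderOf_pow_orderOf_div (orderOf_pos w).ne' hpd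
  have hzs : z.support.card ≤ p := by
    have : z.support.map (Function.Embedding.subtype _) ⊆ C := by
      intro y hy
      obtain ⟨y, hy', rfl⟩ := mem_map.mp hy
      rw [Equiv.Perm.mem_support] at hy'
      by_contra hyC
      apply hy'
      have h1 : (y : Ω) ∈ FixS Ω Q := hF (mem_sdiff.mpr ⟨y.2, hyC⟩)
      ext
      rw [hz, hw, pY_pow]
      exact mem_FixS.mp h1 _ (Q.pow_mem hq _)
    have := card_le_card this
    rwa [card_map, hC.1] at this
  have hzc : z.IsCycle := Equiv.Perm.isCycle_of_prime_order (by rw [hzo]; exact hp.out) (by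
    rw [hzo]; have := hp.out.pos; omega)
  have hzM : z ∈ MY G Y := (MY G Y).pow_mem (pY_mem _) _
  have : IsPretransitive (MY G Y) Y := ⟨fun x y => by
    obtain ⟨g, hg, hg'⟩ := ht x x.2 y y.2
    exact ⟨⟨pY Y g hg, pY_mem hg⟩, Subtype.ext hg'⟩⟩
  exact jordan_trans (p := p) (MY G Y) hzM hzc (by rw [← hzc.orderOf, hzo]) (by simpa using h2) (by simpa using h3)
    (Equiv.Perm.mem_alternatingGroup.mpr hσ)

theorem Ctx.case_two (c : Ctx p G Ω) (h3 : 3 ≤ p) (hn : Fintype.card Ω + 1 = 2 * p) :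
    ∃ V : FDRep ℂ G, Simple V ∧ p ∣ Module.finrank ℂ V ∧ ¬ (p ^ 2 ∣ Module.finrank ℂ V) := by
  obtain ⟨Q, hQ⟩ := c.hc univ
  obtain ⟨C, hC, hCp, hCs, hCo, hCF⟩ := c.decomp (by rw [card_univ]; omega) (by rw [card_univ]; omega) hQ
  have hA : ∀ σ : Equiv.Perm Ω, Equiv.Perm.sign σ = 1 → ∃ g : G, ∀ x, g • x = σ x := by
    intro σ hσ
    obtain ⟨g, -, hg⟩ := alt_of_trans (G := G) ⟨hCp, hCo⟩ hC hCF (by rw [card_univ]; omega) (by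
      rw [card_univ]
      have : p = 3 ∨ 4 ≤ p := by omega
      omega)
      (fun x _ y _ => by
        obtain ⟨g, hg⟩ := c.MT_pred {x} (fun _ => y) (by simp; omega) (by simp)
        exact ⟨g, by simp, hg x (by simp)⟩)
      (σ.subtypePerm (p := (· ∈ (univ : Finset Ω))) (by simp)) (by
        
        have h := Equiv.Perm.sign_subtypePerm σ (p := (· ∈ (univ : Finset Ω))) (by simp) (by simp)
        rw [hσ] at h
        convert h using 2
        congr 1
        exact Subsingleton.elim _ _)
    exact ⟨g, fun x => hg ⟨x, mem_univ x⟩⟩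
  obtain ⟨V, hV, h⟩ := altRep (G := G) (Ω := Ω) (k := p - 1) (by omega) (by omega) hA
  refine ⟨V, hV, ?_⟩
  obtain ⟨k1, k2⟩ := choose_part (p := p) (n := 2 * p - 1) (by omega)
    (by rw [show 2 * p - 1 + 1 = 2 * p by omega]; exact dvd_mul_left _ _)
    (by rw [show 2 * p - 1 - p + 1 = p by omega])
    (by rw [show 2 * p - 1 - p + 1 = p by omega]
        intro h; have := Nat.le_of_dvd (by omega) h; nlinarith)
  rw [show 2 * p - 1 - 1 = 2 * (p - 1) by omega] at k1 k2
  rcases h with h | h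
  · rw [h]; exact ⟨k1, k2⟩
  · rw [← h] at k1 k2
    refine ⟨(hp.out.dvd_mul.mp k1).resolve_left ?_, fun h => k2 (h.mul_left _)⟩
    intro h; have := Nat.le_of_dvd (by omega) h; omega

end syl13

section avg
variable {Ω : Type} [Fintype Ω] [DecidableEq Ω]

theorem cnt_pos {k : ℕ} (hk : k ≤ Fintype.card Ω) :
    0 < ∑ Z : Finset Ω, (if Z.card = k then (1:ℝ) else 0) := by
  obtain ⟨Z, -, hZ⟩ := exists_subset_card_eq (s := (univ : Finset Ω)) (n := k) (by simpa using hk)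
  refine sum_pos' (fun _ _ => by split_ifs <;> norm_num) ⟨Z, mem_univ _, by simp [hZ]⟩

theorem cnt1 {k : ℕ} (hk : k ≤ Fintype.card Ω) :
    ∑ Y : Finset Ω, (if Y.card = k + 1 then ((k:ℝ) + 1) else 0) =
      ∑ Z : Finset Ω, (if Z.card = k then ((Fintype.card Ω : ℝ) - k) else 0) := by
  have h := dc1 (Ω := Ω) (fun Z x => if Z.card = k then 1 else 0)
  rw [sum_congr rfl (g := fun Y : Finset Ω => (if Y.card = k + 1 then ((k:ℝ) + 1) else 0))] at h
  · rw [h]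
    refine sum_congr rfl fun Z _ => ?_
    rw [sum_const]
    split_ifs with h
    · rw [card_compl, h, nsmul_eq_mul, Nat.cast_sub hk]; ring
    · simp
  · intro Y _
    rw [sum_congr rfl (g := fun _ => if Y.card = k + 1 then (1:ℝ) else 0)]
    · rw [sum_const]
      split_ifs with h
      · rw [h]; simp
      · simp
    · intro x hx
      have := card_erase_add_one hx
      congr 1
      exact propext (by omega)

theorem avg1 {k : ℕ} (hk : k ≤ Fintype.card Ω) (F : Finset Ω → Ω → ℝ) (a b : ℝ)
    (h1 : ∀ Y : Finset Ω, Y.card = k + 1 → ∑ x ∈ Y, F (Y.erase x) x = a)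
    (h2 : ∀ Z : Finset Ω, Z.card = k → ∑ x ∈ Zᶜ, F Z x = b) :
    b * (k + 1) = a * ((Fintype.card Ω : ℝ) - k) := by
  have h := dc1 (Ω := Ω) (fun Z x => if Z.card = k then F Z x else 0)
  rw [sum_congr rfl (g := fun Y : Finset Ω => (if Y.card = k + 1 then a else 0)),
    sum_congr rfl (s₁ := univ) (f := fun Z : Finset Ω => ∑ x ∈ Zᶜ, _)
      (g := fun Z : Finset Ω => (if Z.card = k then b else 0))] at h
  · have h3 := cnt1 (Ω := Ω) hk
    have h4 := cnt_pos (Ω := Ω) hk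
    have e : ∀ (j : ℕ) (r : ℝ), ∑ Z : Finset Ω, (if Z.card = j then r else 0) =
        r * ∑ Z : Finset Ω, (if Z.card = j then (1:ℝ) else 0) := by
      intro j r; rw [mul_sum]; refine sum_congr rfl fun Z _ => by split_ifs <;> simp
    rw [e, e k] at h h3
    set A := ∑ Z : Finset Ω, (if Z.card = k then (1:ℝ) else 0)
    set B := ∑ Z : Finset Ω, (if Z.card = k + 1 then (1:ℝ) else 0)
    have : (b * (k + 1) - a * ((Fintype.card Ω : ℝ) - k)) * A = 0 := by
      linear_combination (-((k:ℝ)+1)) * h + a * h3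
    rcases mul_eq_zero.mp this with h | h
    · linarith
    · exact absurd h h4.ne'
  · intro Z _
    split_ifs with h
    · exact h2 Z h
    · simp
  · intro Y _
    split_ifs with h
    · rw [← h1 Y h]
      refine sum_congr rfl fun x hx => ?_
      rw [if_pos]; rw [card_erase_of_mem hx]; omega
    · refine sum_eq_zero fun x hx => ?_
      rw [if_neg]; have := card_erase_add_one hx; omega

theorem avg2 {k : ℕ} (hk : k + 1 ≤ Fintype.card Ω) (F : Finset Ω → Ω → Ω → ℝ) (a b : ℝ)
    (h1 : ∀ Y : Finset Ω, Y.card = k + 2 → a ≤ ∑ x ∈ Y, ∑ y ∈ Y.erase x, F ((Y.erase x).erase y) x y)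
    (h2 : ∀ Z : Finset Ω, Z.card = k → ∑ y ∈ Zᶜ, ∑ x ∈ (insert y Z)ᶜ, F Z x y ≤ b) :
    a * ((Fintype.card Ω : ℝ) - k) * ((Fintype.card Ω : ℝ) - k - 1) ≤ b * (k + 1) * (k + 2) := by
  have h := dc2 (Ω := Ω) (fun Z x y => if Z.card = k then F Z x y else 0)
  have hl : ∑ Y : Finset Ω, (if Y.card = k + 2 then a else 0) ≤ ∑ Y : Finset Ω, ∑ x ∈ Y, ∑ y ∈ Y.erase x,
      (fun Z x y => if Z.card = k then F Z x y else 0) ((Y.erase x).erase y) x y := by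
    refine sum_le_sum fun Y _ => ?_
    split_ifs with hY
    · refine (h1 Y hY).trans (le_of_eq ?_)
      refine sum_congr rfl fun x hx => sum_congr rfl fun y hy => ?_
      have := card_erase_add_one hx
      have := card_erase_add_one hy
      dsimp only
      rw [if_pos]; omega
    · refine (le_of_eq (sum_eq_zero fun x hx => sum_eq_zero fun y hy => ?_).symm)
      have := card_erase_add_one hx
      have := card_erase_add_one hy
      dsimp only
      rw [if_neg]; omega
  have hr : ∑ Z : Finset Ω, ∑ y ∈ Zᶜ, ∑ x ∈ (insert y Z)ᶜ,
      (fun Z x y => if Z.card = k then F Z x y else 0) Z x y ≤ ∑ Z : Finset Ω, (if Z.card = k then b else 0) := by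
    refine sum_le_sum fun Z _ => ?_
    split_ifs with hZ
    · simpa [hZ] using h2 Z hZ
    · simp [hZ]
  rw [h] at hl
  have hm := hl.trans hr
  have h3 := cnt1 (Ω := Ω) (k := k) (by omega)
  have h3' := cnt1 (Ω := Ω) (k := k + 1) hk
  have h4 := cnt_pos (Ω := Ω) (k := k) (by omega)
  have e : ∀ (j : ℕ) (r : ℝ), ∑ Z : Finset Ω, (if Z.card = j then r else 0) =
      r * ∑ Z : Finset Ω, (if Z.card = j then (1:ℝ) else 0) := by
    intro j r; rw [mul_sum]; refine sum_congr rfl fun Z _ => by split_ifs <;> simp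
  rw [e, e k] at hm h3
  rw [e, e (k+1)] at h3'
  set A := ∑ Z : Finset Ω, (if Z.card = k then (1:ℝ) else 0)
  set B := ∑ Z : Finset Ω, (if Z.card = k + 1 then (1:ℝ) else 0)
  set D := ∑ Z : Finset Ω, (if Z.card = k + 1 + 1 then (1:ℝ) else 0)
  change a * D ≤ b * A at hm
  push_cast at h3'
  have hk1 : (0:ℝ) ≤ k := Nat.cast_nonneg k
  have k1 : a * D * ((k+1)*(k+2)) ≤ b * A * ((k+1)*(k+2)) := mul_le_mul_of_nonneg_right hm (by positivity)
  have k2 : a * D * ((k+1)*(k+2)) = a * ((Fintype.card Ω : ℝ) - k) * ((Fintype.card Ω : ℝ) - k - 1) * A := by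
    linear_combination (a * (k+1)) * h3' + a * ((Fintype.card Ω : ℝ) - k - 1) * h3
  rw [k2] at k1
  by_contra hcon
  push Not at hcon
  nlinarith [mul_lt_mul_of_pos_right hcon h4]

end avg

section syl15
variable {G Ω : Type} [Group G] [Finite G] [Fintype Ω] [DecidableEq Ω] [MulAction G Ω]
  {p : ℕ} [hp : Fact p.Prime]

structure Big (p : ℕ) (G Ω : Type) [Group G] [Finite G] [Fintype Ω] [DecidableEq Ω] [MulAction G Ω]
    [hp : Fact p.Prime] : Prop where
  c : Ctx p G Ω
  h3 : 3 ≤ p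
  hn : 3 * p - 1 ≤ Fintype.card Ω
  hH : ∀ i < p, HH p G Ω i
  hom : ∀ S S' : Finset Ω, S.card = S'.card → p ≤ S.card → S.card < 2 * p → Eq' G S S'

open Classical in
noncomputable def TT (p : ℕ) (G : Type) {Ω : Type} [Group G] [Fintype Ω] [DecidableEq Ω] [MulAction G Ω]
    (Y : Finset Ω) : Finset Ω :=
  Y.filter (fun y => ∀ Q : Sylow p G, Stb Q Y → y ∈ FixS Ω Q)

theorem mem_TT {Y : Finset Ω} {y : Ω} : y ∈ TT p G Y ↔ y ∈ Y ∧ ∀ Q : Sylow p G, Stb Q Y → y ∈ FixS Ω Q := by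
  simp [TT]

theorem TT_smul_le (g : G) (Y : Finset Ω) : g • TT p G Y ⊆ TT p G (g • Y) := by
  intro y hy
  obtain ⟨x, hx, rfl⟩ := mem_smul_finset.mp hy
  rw [mem_TT] at hx ⊢
  refine ⟨smul_mem_smul_finset hx.1, fun Q' hQ' => ?_⟩
  obtain ⟨Q, hQ⟩ := conj_syl Q' g⁻¹
  have h1 := smul_stb hQ hQ'
  rw [inv_smul_smul] at h1
  have h2 := hx.2 Q h1
  rw [FixS_smul hQ, mem_smul_finset] at h2
  obtain ⟨z, hz, rfl⟩ := h2
  rwa [smul_inv_smul]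

theorem TT_smul (g : G) (Y : Finset Ω) : TT p G (g • Y) = g • TT p G Y := by
  refine Subset.antisymm ?_ (TT_smul_le g Y)
  have := TT_smul_le (p := p) g⁻¹ (g • Y)
  rw [inv_smul_smul] at this
  have h := smul_finset_subset_smul_finset (a := g) this
  rwa [smul_inv_smul] at h

theorem TT_trans (b : Ctx p G Ω) {Y : Finset Ω} (h1 : p ≤ Y.card) (h2 : Y.card < 2 * p) (hT : TT p G Y = ∅)
    (x : Ω) (hx : x ∈ Y) (y : Ω) (hy : y ∈ Y) : ∃ g : G, g • Y = Y ∧ g • x = y := by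
  have key : ∀ x ∈ Y, ∃ (Q : Sylow p G) (C : Finset Ω), Stb Q Y ∧ IsC Q C ∧ x ∈ C ∧ C ⊆ Y ∧ Y \ C ⊆ FixS Ω Q := by
    intro x hx
    have : x ∉ TT p G Y := by rw [hT]; simp
    rw [mem_TT] at this
    push Not at this
    obtain ⟨Q, hQ, hxQ⟩ := this hx
    obtain ⟨C, hC, hCp, hCs, hCo, hCF⟩ := b.decomp h2 h1 hQ
    refine ⟨Q, C, hQ, ⟨hCp, hCo⟩, ?_, hC, hCF⟩
    by_contra h
    exact hxQ (hCF (mem_sdiff.mpr ⟨hx, h⟩))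
  obtain ⟨Q, C, hQ, hC, hxC, hCY, hCF⟩ := key x hx
  obtain ⟨Q', C', hQ', hC', hyC, hCY', hCF'⟩ := key y hy
  obtain ⟨k, hk, hk'⟩ := conjS hQ hQ'
  have h3 := hC.smul hk'
  have h4 : k • C = C' := by
    refine hC'.uniq h3 hCF' ?_
    rw [union_sdiff_of_subset hCY']
    have := smul_finset_subset_smul_finset (a := k) hCY
    rwa [hk] at this
  have h5 : k • x ∈ C' := by rw [← h4]; exact smul_mem_smul_finset hxC
  have h6 : y ∈ Qorb Q' (k • x) := by rw [hC'.2 _ h5]; exact hyC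
  obtain ⟨q, hq, hqy⟩ := mem_Qorb.mp h6
  exact ⟨q * k, by rw [mul_smul, hk, hQ' q hq], by rw [mul_smul, hqy]⟩

theorem Big.full (b : Big p G Ω) {Y0 : Finset Ω} (hY0 : Y0.card = 2 * p - 2) (hne : TT p G Y0 ≠ ∅)
    {Q : Sylow p G} {C : Finset Ω} (hC : IsC Q C) (s : Ω) (hs : s ∈ FixS Ω Q) :
    TT p G (C ∪ (FixS Ω Q).erase s) = (FixS Ω Q).erase s := by
  classical
  have h3 := b.h3
  set Γ := FixS Ω Q with hΓ
  have hΓc : Γ.card = p - 1 := b.c.card_fix Q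
  have hYc : ∀ s ∈ Γ, (C ∪ Γ.erase s).card = 2 * p - 2 := by
    intro s hs
    rw [card_union_of_disjoint (hC.disj (erase_subset _ _)), hC.1, card_erase_of_mem hs, hΓc]
    omega
  let A : Ω → Ω → Prop := fun s t => t ∈ TT p G (C ∪ Γ.erase s)
  have hsub : ∀ s ∈ Γ, TT p G (C ∪ Γ.erase s) ⊆ Γ.erase s := by
    intro s hs t ht
    rw [mem_TT] at ht
    have h1 := ht.2 Q (stb_union hC (erase_subset _ _))
    rcases mem_union.mp ht.1 with h | h
    · exact absurd h1 (hC.notMem h)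
    · exact h
  have hcard : ∀ s ∈ Γ, (TT p G (C ∪ Γ.erase s)).card = (TT p G Y0).card := by
    intro s hs
    obtain ⟨g, hg⟩ := b.hom Y0 (C ∪ Γ.erase s) (by rw [hYc s hs, hY0]) (by omega) (by omega)
    rw [← hg, TT_smul, card_smul_finset]
  have hinv : ∀ s ∈ Γ, ∀ t ∈ Γ, s ≠ t → ∀ s' ∈ Γ, ∀ t' ∈ Γ, s' ≠ t' →
      ((A s t ↔ A s' t') ∧ (A t s ↔ A t' s')) ∨ ((A s t ↔ A t' s') ∧ (A t s ↔ A s' t')) := by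
    intro s hs t ht hst s' hs' t' ht' hst'
    obtain ⟨g, hgQ, hgC, hg⟩ := (b.hH 2 (by omega)).strong hC (S := {s, t}) (S' := {s', t'})
      (by intro z hz; simp at hz; rcases hz with rfl | rfl <;> assumption)
      (by intro z hz; simp at hz; rcases hz with rfl | rfl <;> assumption)
      (card_pair hst) (card_pair hst')
    have hgΓ : g • Γ = Γ := (FixS_smul hgQ).symm
    have hA : ∀ u v, A u v ↔ A (g • u) (g • v) := by
      intro u v
      have : g • (C ∪ Γ.erase u) = C ∪ Γ.erase (g • u) := by
        rw [smul_finset_union, hgC, smul_erase', hgΓ]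
      simp only [A]
      rw [← this, TT_smul, smul_mem_smul_finset_iff]
    have h1 : g • s ∈ ({s', t'} : Finset Ω) := by rw [← hg]; exact smul_mem_smul_finset (by simp)
    have h2 : g • t ∈ ({s', t'} : Finset Ω) := by rw [← hg]; exact smul_mem_smul_finset (by simp)
    have h12 : g • s ≠ g • t := fun h => hst (MulAction.injective g h)
    rw [mem_insert, mem_singleton] at h1 h2
    rw [hA s t, hA t s]
    rcases h1 with h1 | h1 <;> rcases h2 with h2 | h2 <;> rw [h1, h2]
    · exact absurd (h1.trans h2.symm) h12
    · left; exact ⟨Iff.rfl, Iff.rfl⟩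
    · right; exact ⟨Iff.rfl, Iff.rfl⟩
    · exact absurd (h1.trans h2.symm) h12
  have hτ : 0 < (TT p G Y0).card := card_pos.mpr (nonempty_iff_ne_empty.mpr hne)
  obtain ⟨t0, ht0⟩ : ∃ t0, A s t0 := by
    have := hcard s hs
    obtain ⟨t, ht⟩ := card_pos.mp (this ▸ hτ)
    exact ⟨t, ht⟩
  have ht0Γ := hsub s hs ht0
  rw [mem_erase] at ht0Γ
  by_cases hboth : A t0 s
  · refine Subset.antisymm (hsub s hs) ?_
    intro t ht
    rw [mem_erase] at ht
    rcases hinv s hs t0 ht0Γ.2 (Ne.symm ht0Γ.1) s hs t ht.2 (Ne.symm ht.1) with h | h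
    · exact h.1.mp ht0
    · exact h.2.mp hboth
  · exfalso
    have hone : ∀ s ∈ Γ, ∀ t ∈ Γ, (if A s t then 1 else 0) + (if A t s then 1 else 0) = if s = t then 0 else 1 := by
      intro u hu v hv
      by_cases huv : u = v
      · subst huv
        have : ¬ A u u := fun h => by simpa using hsub u hu h
        simp [this]
      · rcases hinv s hs t0 ht0Γ.2 (Ne.symm ht0Γ.1) u hu v hv huv with h | h
        · have h1 := h.1.mp ht0
          have h2 : ¬ A v u := fun h' => hboth (h.2.mpr h')
          simp [h1, h2, huv]
        · have h1 := h.1.mp ht0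
          have h2 : ¬ A u v := fun h' => hboth (h.2.mpr h')
          simp [h1, h2, huv]
    have hX : ∑ s ∈ Γ, ∑ t ∈ Γ, (if A s t then 1 else 0) = (p - 1) * (TT p G Y0).card := by
      rw [← hΓc, ← smul_eq_mul, ← sum_const]
      refine sum_congr rfl fun u hu => ?_
      rw [sum_boole, ← hcard u hu]
      simp only [Nat.cast_id]
      congr 1
      ext v
      rw [mem_filter]
      exact ⟨fun h => h.2, fun h => ⟨mem_of_mem_erase (hsub u hu h), h⟩⟩
    have hX' : ∑ s ∈ Γ, ∑ t ∈ Γ, (if A t s then 1 else 0) = (p - 1) * (TT p G Y0).card := by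
      rw [sum_comm, hX]
    have hsum : ∑ s ∈ Γ, ∑ t ∈ Γ, ((if A s t then 1 else 0) + (if A t s then 1 else 0)) = (p - 1) * (p - 2) := by
      rw [← hΓc, ← smul_eq_mul, ← sum_const]
      refine sum_congr rfl fun u hu => ?_
      rw [sum_congr rfl (hone u hu)]
      have : ∀ x ∈ Γ, (if u = x then 0 else 1) = if x ≠ u then 1 else 0 := by
        intro x _; by_cases h : u = x <;> simp [h, eq_comm]
      rw [sum_congr rfl this, sum_boole, filter_ne', card_erase_of_mem hu, hΓc]
      simp; omega
    simp only [sum_add_distrib] at hsum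
    rw [hX, hX', ← mul_add] at hsum
    have h5 : (TT p G Y0).card + (TT p G Y0).card = p - 2 := Nat.eq_of_mul_eq_mul_left (by omega) hsum
    rcases hp.out.eq_two_or_odd' with h | ⟨r, hr⟩ <;> omega

theorem Big.TT_empty (b : Big p G Ω) {Y0 : Finset Ω} (hY0 : Y0.card = 2 * p - 2) : TT p G Y0 = ∅ := by
  classical
  by_contra hne
  have h3 := b.h3
  have hn := b.hn
  have hfull := fun {Q : Sylow p G} {C : Finset Ω} (hC : IsC Q C) => b.full hY0 hne hC
  have hW : ∀ W : Finset Ω, W.card = 2 * p - 1 → ∃ (Q : Sylow p G) (C : Finset Ω), IsC Q C ∧ W = C ∪ FixS Ω Q := by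
    intro W hW
    obtain ⟨Q, hQ⟩ := b.c.hc W
    obtain ⟨C, hC, hCp, hCs, hCo, hCF⟩ := b.c.decomp (by omega) (by omega) hQ
    refine ⟨Q, C, ⟨hCp, hCo⟩, ?_⟩
    rw [← eq_of_subset_of_card_le hCF, union_sdiff_of_subset hC]
    rw [b.c.card_fix, card_sdiff_of_subset hC]; omega
  have herase : ∀ (Q : Sylow p G) (C : Finset Ω), IsC Q C → ∀ s ∈ FixS Ω Q, (C ∪ FixS Ω Q).erase s = C ∪ (FixS Ω Q).erase s := by
    intro Q C hC s hs
    rw [erase_union_distrib, erase_eq_of_notMem (fun h => hC.notMem h hs)]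
  have hTc : ∀ Y : Finset Ω, Y.card = 2 * p - 2 → (TT p G Y).card = p - 2 := by
    obtain ⟨W, -, hWc⟩ := exists_subset_card_eq (s := (univ : Finset Ω)) (n := 2 * p - 1)
      (by rw [card_univ]; omega)
    obtain ⟨Q, C, hC, hWe⟩ := hW W hWc
    have hΓc := b.c.card_fix Q
    obtain ⟨s, hs⟩ : (FixS Ω Q).Nonempty := card_pos.mp (by omega)
    have h1 := hfull hC s hs
    intro Y hY
    obtain ⟨g, hg⟩ := b.hom (C ∪ (FixS Ω Q).erase s) Y (by
      rw [← herase Q C hC s hs, ← hWe, card_erase_of_mem (by rw [hWe]; simp [hs])]; omega)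
      (by rw [← herase Q C hC s hs, ← hWe, card_erase_of_mem (by rw [hWe]; simp [hs])]; omega)
      (by rw [← herase Q C hC s hs, ← hWe, card_erase_of_mem (by rw [hWe]; simp [hs])]; omega)
    rw [← hg, TT_smul, card_smul_finset, h1, card_erase_of_mem hs, hΓc]
    omega
  let E : Finset Ω → Finset Ω := fun Z => (Zᶜ).filter (fun x => x ∈ TT p G (insert x Z))
  have hE : ∀ (g : G) Z, E (g • Z) = g • E Z := by
    intro g Z
    ext x
    obtain ⟨x, rfl⟩ : ∃ y, g • y = x := ⟨g⁻¹ • x, smul_inv_smul _ _⟩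
    rw [smul_mem_smul_finset_iff]
    simp only [E, mem_filter, mem_compl, smul_mem_smul_finset_iff]
    rw [← smul_finset_insert, TT_smul, smul_mem_smul_finset_iff]
  obtain ⟨Z0, -, hZ0⟩ := exists_subset_card_eq (s := (univ : Finset Ω)) (n := 2 * p - 3)
      (by rw [card_univ]; omega)
  have hEc : ∀ Z : Finset Ω, Z.card = 2 * p - 3 → (E Z).card = (E Z0).card := by
    intro Z hZ
    obtain ⟨g, hg⟩ := b.hom Z0 Z (by omega) (by omega) (by omega)
    rw [← hg, hE, card_smul_finset]
  set e := (E Z0).card with he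
  have a1 := avg1 (Ω := Ω) (k := 2 * p - 3) (by omega) (fun Z x => if x ∈ TT p G (insert x Z) then 1 else 0)
    ((p - 2 : ℕ) : ℝ) (e : ℝ) (by
      intro Y hY
      rw [sum_congr rfl (g := fun x => if x ∈ TT p G Y then (1:ℝ) else 0)
        (fun x hx => by rw [insert_erase hx]), sum_boole, ← hTc Y (by omega)]
      congr 2
      ext x
      rw [mem_filter]
      exact ⟨fun h => h.2, fun h => ⟨(mem_TT.mp h).1, h⟩⟩) (by
      intro Z hZ
      rw [sum_boole, ← hEc Z hZ])
  have a2 := avg2 (Ω := Ω) (k := 2 * p - 3) (by omega)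
    (fun Z x y => (if x ∈ TT p G (insert x Z) then 1 else 0) * (if y ∈ TT p G (insert y Z) then 1 else 0))
    (((p - 1 : ℕ) : ℝ) * ((p - 2 : ℕ) : ℝ)) ((e : ℝ) * (e - 1)) (by
      intro W hWc
      obtain ⟨Q, C, hC, hWe⟩ := hW W (by omega)
      have hΓc := b.c.card_fix Q
      have hΓW : FixS Ω Q ⊆ W := by rw [hWe]; exact subset_union_right
      have hnn : ∀ (P R : Prop) [Decidable P] [Decidable R], (0:ℝ) ≤ (if P then 1 else 0) * (if R then 1 else 0) := by
        intro P R _ _; split_ifs <;> norm_num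
      refine le_trans ?_ (sum_le_sum_of_subset_of_nonneg hΓW
        (fun x _ _ => sum_nonneg fun y _ => hnn _ _))
      have : ∀ x ∈ FixS Ω Q, ((p - 2 : ℕ) : ℝ) ≤ ∑ y ∈ W.erase x,
          (if x ∈ TT p G (insert x ((W.erase x).erase y)) then (1:ℝ) else 0) *
            (if y ∈ TT p G (insert y ((W.erase x).erase y)) then 1 else 0) := by
        intro x hx
        refine le_trans ?_ (sum_le_sum_of_subset_of_nonneg (erase_subset_erase x hΓW)
          (fun y _ _ => hnn _ _))
        rw [sum_congr rfl (g := fun _ => (1:ℝ))]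
        · rw [sum_const, card_erase_of_mem hx, hΓc, nsmul_eq_mul, mul_one]
          exact_mod_cast (by omega : p - 2 ≤ p - 1 - 1)
        · intro y hy
          rw [mem_erase] at hy
          rw [insert_erase (by rw [mem_erase]; exact ⟨hy.1, hΓW hy.2⟩), erase_right_comm,
            insert_erase (by rw [mem_erase]; exact ⟨Ne.symm hy.1, hΓW hx⟩), hWe,
            herase Q C hC x hx, herase Q C hC y hy.2, hfull hC x hx, hfull hC y hy.2]
          simp [hy.1, hy.2, hx, Ne.symm hy.1]
      refine le_trans ?_ (sum_le_sum this)
      rw [sum_const, hΓc, nsmul_eq_mul]) (by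
      intro Z hZ
      have h1 : ∀ y ∈ Zᶜ, ∑ x ∈ (insert y Z)ᶜ, ((if x ∈ TT p G (insert x Z) then (1:ℝ) else 0) *
          (if y ∈ TT p G (insert y Z) then 1 else 0)) = if y ∈ TT p G (insert y Z) then ((e:ℝ) - 1) else 0 := by
        intro y hy
        rw [← sum_mul]
        by_cases h : y ∈ TT p G (insert y Z)
        · rw [if_pos h, if_pos h, mul_one, sum_boole]
          have hyE : y ∈ E Z := by simp only [E, mem_filter]; exact ⟨hy, h⟩
          have : filter (fun x => x ∈ TT p G (insert x Z)) (insert y Z)ᶜ = (E Z).erase y := by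
            ext x; simp only [E, mem_filter, mem_compl, mem_insert, mem_erase]; tauto
          have h5 := card_erase_add_one hyE
          rw [hEc Z hZ] at h5
          rw [this, ← h5]; simp
        · rw [if_neg h, if_neg h, mul_zero]
      rw [sum_congr rfl h1, ← sum_filter, sum_const, nsmul_eq_mul]
      have : (filter (fun y => y ∈ TT p G (insert y Z)) Zᶜ).card = e := hEc Z hZ
      rw [this])
  have c1 : ((2 * p - 3 : ℕ) : ℝ) = 2 * p - 3 := by rw [Nat.cast_sub (by omega)]; push_cast; ring
  have c2 : ((p - 2 : ℕ) : ℝ) = p - 2 := by rw [Nat.cast_sub (by omega)]; push_cast; ring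
  have c3 : ((p - 1 : ℕ) : ℝ) = p - 1 := by rw [Nat.cast_sub (by omega)]; push_cast; ring
  rw [c1, c2] at a1
  rw [c1, c2, c3] at a2
  have hpr : (3:ℝ) ≤ p := by exact_mod_cast h3
  have hN : (0:ℝ) < (Fintype.card Ω : ℝ) - (2 * p - 3) := by
    have : ((2 * p : ℕ):ℝ) < ((Fintype.card Ω + 3 : ℕ) : ℝ) := by exact_mod_cast (by omega)
    push_cast at this; linarith
  set N := (Fintype.card Ω : ℝ) - (2 * p - 3)
  have a3 : ((p:ℝ) - 1) * (p - 2) * N * (N - 1) ≤ ((p - 2) * N) * (((e:ℝ) - 1) * (2 * p - 1)) := by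
    have : (e:ℝ) * (e - 1) * (2 * p - 3 + 1) * (2 * p - 3 + 2) = ((p - 2) * N) * (((e:ℝ) - 1) * (2 * p - 1)) := by
      linear_combination ((e:ℝ) - 1) * (2 * p - 1) * a1
    linarith
  have a4 : ((p:ℝ) - 1) * (N - 1) ≤ ((e:ℝ) - 1) * (2 * p - 1) := by
    have hpos : (0:ℝ) < (p - 2) * N := mul_pos (by linarith) hN
    refine le_of_mul_le_mul_left ?_ hpos
    linarith
  have a5 : ((p:ℝ) - 1) * (N - 1) * (2 * p - 2) ≤ ((e:ℝ) - 1) * (2 * p - 1) * (2 * p - 2) :=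
    mul_le_mul_of_nonneg_right a4 (by linarith)
  have a6 : ((e:ℝ) - 1) * (2 * p - 1) * (2 * p - 2) = (2 * p - 1) * ((p - 2) * N - (2 * p - 2)) := by
    linear_combination (2 * (p:ℝ) - 1) * a1
  rw [a6] at a5
  have : 0 < (p:ℝ) * N := by positivity
  nlinarith

theorem Big.trans_m (b : Big p G Ω) {Y : Finset Ω} (hY : Y.card = 2 * p - 2) (x : Ω) (hx : x ∈ Y) (y : Ω)
    (hy : y ∈ Y) : ∃ g : G, g • Y = Y ∧ g • x = y :=
  TT_trans b.c (by have := b.h3; omega) (by have := b.h3; omega) (b.TT_empty hY) x hx y hy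

theorem Big.alt_m (b : Big p G Ω) {Y : Finset Ω} (hY : Y.card = 2 * p - 2) (σ : Equiv.Perm Y)
    (hσ : Equiv.Perm.sign σ = 1) : ∃ g : G, g • Y = Y ∧ ∀ y : Y, g • (y : Ω) = σ y := by
  have h3 := b.h3
  obtain ⟨Q, hQ⟩ := b.c.hc Y
  obtain ⟨C, hC, hCp, hCs, hCo, hCF⟩ := b.c.decomp (by omega) (by omega) hQ
  refine alt_of_trans ⟨hCp, hCo⟩ hC hCF (by omega) ?_ (b.trans_m hY) σ hσ
  rcases hp.out.eq_two_or_odd' with h | ⟨r, hr⟩ <;> omega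

end syl15

section syl16
variable {G Ω : Type} [Group G] [Finite G] [Fintype Ω] [DecidableEq Ω] [MulAction G Ω]
  {p : ℕ} [hp : Fact p.Prime]

def Sm (G : Type) {Ω : Type} [Group G] [MulAction G Ω] (D : Finset Ω) (x y : Ω) : Prop :=
  ∃ g : G, (∀ z ∈ D, g • z = z) ∧ g • x = y

theorem Sm.refl (D : Finset Ω) (x : Ω) : Sm G D x x := ⟨1, by simp, by simp⟩

theorem Sm.symm {D : Finset Ω} {x y : Ω} (h : Sm G D x y) : Sm G D y x := by
  obtain ⟨g, hg, rfl⟩ := h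
  exact ⟨g⁻¹, fun z hz => by rw [inv_smul_eq_iff, hg z hz], by simp⟩

theorem Sm.trans {D : Finset Ω} {x y z : Ω} (h : Sm G D x y) (h' : Sm G D y z) : Sm G D x z := by
  obtain ⟨g, hg, rfl⟩ := h
  obtain ⟨k, hk, rfl⟩ := h'
  exact ⟨k * g, fun z hz => by rw [mul_smul, hg z hz, hk z hz], mul_smul _ _ _⟩

theorem Sm.smul {D : Finset Ω} {x y : Ω} (k : G) (h : Sm G D x y) : Sm G (k • D) (k • x) (k • y) := by
  obtain ⟨g, hg, rfl⟩ := h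
  refine ⟨k * g * k⁻¹, fun z hz => ?_, by simp [mul_smul]⟩
  obtain ⟨w, hw, rfl⟩ := mem_smul_finset.mp hz
  simp [mul_smul, hg w hw]

theorem Sm.smul_iff {D : Finset Ω} {x y : Ω} (k : G) : Sm G (k • D) (k • x) (k • y) ↔ Sm G D x y := by
  refine ⟨fun h => ?_, Sm.smul k⟩
  simpa using h.smul k⁻¹

theorem exP {g : G} {W : Finset Ω} (h : g • W = W) :
    ∃ π : Equiv.Perm Ω, (∀ x ∈ W, g • x = π x) ∧ ∀ x, x ∉ W → π x = x :=
  ⟨Equiv.Perm.ofSubtype (pY W g h),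
    fun x hx => by rw [Equiv.Perm.ofSubtype_apply_of_mem _ hx]; rfl,
    fun x hx => Equiv.Perm.ofSubtype_apply_of_not_mem _ hx⟩

theorem perm_mem {W : Finset Ω} {π : Equiv.Perm Ω} (h : ∀ x, x ∉ W → π x = x) (x : Ω) : π x ∈ W ↔ x ∈ W := by
  constructor
  · intro h1; by_contra h2; rw [h x h2] at h1; exact h2 h1
  · intro h1; by_contra h2; exact h2 (by rwa [π.injective (h _ h2)])

theorem Big.alt' (b : Big p G Ω) {Y : Finset Ω} (hY : Y.card = 2 * p - 2) (π : Equiv.Perm Ω)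
    (hs : Equiv.Perm.sign π = 1) (hf : ∀ x, x ∉ Y → π x = x) : ∃ g : G, ∀ x ∈ Y, g • x = π x := by
  obtain ⟨g, -, hg⟩ := b.alt_m hY (π.subtypePerm (perm_mem hf)) (by
    rw [← hs]
    convert Equiv.Perm.sign_subtypePerm π (perm_mem hf) ?_
    intro x hx; by_contra h; exact hx (hf x h))
  exact ⟨g, fun x hx => hg ⟨x, hx⟩⟩

theorem Big.transD (b : Big p G Ω) {D : Finset Ω} (hD : D.card = 2 * p - 3) {x y : Ω} (hx : x ∉ D) (hy : y ∉ D) :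
    ∃ g : G, g • D = D ∧ g • x = y := by
  have h3 := b.h3
  have c1 : (insert x D).card = 2 * p - 2 := by rw [card_insert_of_notMem hx]; omega
  have c2 : (insert y D).card = 2 * p - 2 := by rw [card_insert_of_notMem hy]; omega
  obtain ⟨g, hg⟩ := b.hom (insert x D) (insert y D) (by omega) (by omega) (by omega)
  obtain ⟨k, hk, hk'⟩ := b.trans_m c2 (g • x) (by rw [← hg]; exact smul_mem_smul_finset (by simp)) y (by simp)
  refine ⟨k * g, ?_, by rw [mul_smul, hk']⟩
  have h1 : (k * g) • (insert x D).erase x = (insert y D).erase y := by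
    rw [smul_erase', mul_smul, mul_smul, hg, hk, hk']
  rwa [erase_insert hx, erase_insert hy] at h1

theorem genSm {D : Finset Ω} {x y : Ω} (hx : x ∉ D) {g : G} (hg : g • D = D) (hxy : g • x = y) {π : Equiv.Perm Ω}
    (h1 : ∀ z ∈ D, g • z = π z) (h2 : ∀ z, z ∉ D → π z = z)
    (hk : ∃ k : G, ∀ z ∈ insert y D, k • z = π⁻¹ z) : Sm G D x y := by
  obtain ⟨k, hk⟩ := hk
  have hy : y ∉ D := by
    rw [← hxy, ← hg, smul_mem_smul_finset_iff]; exact hx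
  refine ⟨k * g, fun z hz => ?_, ?_⟩
  · rw [mul_smul, hk _ (mem_insert_of_mem (smem hg hz)), h1 z hz]; simp
  · rw [mul_smul, hxy, hk _ (by simp), Equiv.Perm.inv_eq_iff_eq, h2 y hy]

theorem Big.evenSm (b : Big p G Ω) {D : Finset Ω} (hD : D.card = 2 * p - 3) {x y : Ω} (hx : x ∉ D) {g : G}
    (hg : g • D = D) (hxy : g • x = y) {π : Equiv.Perm Ω}
    (h1 : ∀ z ∈ D, g • z = π z) (h2 : ∀ z, z ∉ D → π z = z) (hs : Equiv.Perm.sign π = 1) : Sm G D x y := by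
  have h3 := b.h3
  have hy : y ∉ D := by
    rw [← hxy, ← hg, smul_mem_smul_finset_iff]; exact hx
  refine genSm hx hg hxy h1 h2 (b.alt' ?_ _ (by rw [Equiv.Perm.sign_inv, hs]) ?_)
  · rw [card_insert_of_notMem hy]; omega
  · intro z hz
    rw [Equiv.Perm.inv_eq_iff_eq, h2 z (fun h => hz (mem_insert_of_mem h))]

theorem sgn_cases (π : Equiv.Perm Ω) : Equiv.Perm.sign π = 1 ∨ Equiv.Perm.sign π = -1 := Int.units_eq_one_or _

theorem Big.Sm_odd (b : Big p G Ω) {Y0 : Finset Ω} (hY0 : Y0.card = 2 * p - 2) {g0 : G} {π0 : Equiv.Perm Ω}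
    (h0 : ∀ z ∈ Y0, g0 • z = π0 z) (h0' : ∀ z, z ∉ Y0 → π0 z = z) (hs0 : Equiv.Perm.sign π0 ≠ 1)
    {D : Finset Ω} (hD : D.card = 2 * p - 3) {x y : Ω} (hx : x ∉ D) (hy : y ∉ D) : Sm G D x y := by
  have h3 := b.h3
  have c2 : (insert y D).card = 2 * p - 2 := by rw [card_insert_of_notMem hy]; omega
  obtain ⟨g, hg, hxy⟩ := b.transD hD hx hy
  obtain ⟨π, h1, h2⟩ := exP hg
  rcases sgn_cases π with hs | hs
  · exact b.evenSm hD hx hg hxy h1 h2 hs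
  obtain ⟨k, hk⟩ := b.hom Y0 (insert y D) (by omega) (by omega) (by omega)
  refine genSm hx hg hxy h1 h2 ?_
  set τ := MulAction.toPerm k * π0 * (MulAction.toPerm k)⁻¹ with hτ
  have t1 : ∀ z ∈ insert y D, (k * g0 * k⁻¹) • z = τ z := by
    intro z hz
    rw [← hk] at hz
    obtain ⟨w, hw, rfl⟩ := mem_smul_finset.mp hz
    have e : (MulAction.toPerm k : Equiv.Perm Ω)⁻¹ (k • w) = w := by
      rw [Equiv.Perm.inv_eq_iff_eq]; rfl
    simp only [hτ, Equiv.Perm.mul_apply, e]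
    simp [mul_smul, h0 w hw]
  have t2 : ∀ z, z ∉ insert y D → τ z = z := by
    intro z hz
    obtain ⟨w, rfl⟩ : ∃ w, k • w = z := ⟨k⁻¹ • z, by simp⟩
    rw [← hk, smul_mem_smul_finset_iff] at hz
    have e : (MulAction.toPerm k : Equiv.Perm Ω)⁻¹ (k • w) = w := by
      rw [Equiv.Perm.inv_eq_iff_eq]; rfl
    simp only [hτ, Equiv.Perm.mul_apply, e, h0' w hz]
    rfl
  have t3 : Equiv.Perm.sign τ = -1 := by
    rw [hτ, Equiv.Perm.sign_mul, Equiv.Perm.sign_mul, Equiv.Perm.sign_inv, mul_comm, ← mul_assoc, Int.units_mul_self, one_mul]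
    exact (sgn_cases π0).resolve_left hs0
  have h2' : ∀ z, z ∉ insert y D → π⁻¹ z = z := fun z hz => by
    rw [Equiv.Perm.inv_eq_iff_eq, h2 z (fun h => hz (mem_insert_of_mem h))]
  obtain ⟨l, hl⟩ := b.alt' c2 (π⁻¹ * τ⁻¹) (by
    rw [Equiv.Perm.sign_mul, Equiv.Perm.sign_inv, Equiv.Perm.sign_inv, hs, t3]; rfl) (by
    intro z hz
    have : τ⁻¹ z = z := by rw [Equiv.Perm.inv_eq_iff_eq, t2 z hz]
    rw [Equiv.Perm.mul_apply, this, h2' z hz])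
  refine ⟨l * (k * g0 * k⁻¹), fun z hz => ?_⟩
  rw [mul_smul, t1 z hz, hl _ ((perm_mem t2 z).mpr hz)]
  simp

theorem parity {m : ℕ} (NO : ∀ (Y : Finset Ω) (g : G) (π : Equiv.Perm Ω), Y.card = m → (∀ z ∈ Y, g • z = π z) →
    (∀ z, z ∉ Y → π z = z) → Equiv.Perm.sign π = 1) {W : Finset Ω} (hW : W.card = m + 1) {g : G} {s t : Ω}
    (hs : s ∈ W) (ht : t ∈ W) (hst : s ≠ t) (hgst : g • s = t) {π : Equiv.Perm Ω}
    (h1 : ∀ z ∈ W, g • z = π z) (h2 : ∀ z, z ∉ W → π z = z) (hsg : Equiv.Perm.sign π = 1) :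
    ¬ Sm G ((W.erase s).erase t) s t := by
  rintro ⟨h, hh, hht⟩
  have := NO (W.erase t) (g * h) (π * Equiv.swap s t) (by rw [card_erase_of_mem ht, hW]; rfl) (by
    intro z hz
    rw [mem_erase] at hz
    rw [mul_smul, Equiv.Perm.mul_apply]
    by_cases hzs : z = s
    · subst hzs; rw [hht, Equiv.swap_apply_left, h1 t ht]
    · rw [Equiv.swap_apply_of_ne_of_ne hzs hz.1, hh z (by simp [hzs, hz]), h1 z hz.2]) (by
    intro z hz
    rw [Equiv.Perm.mul_apply]
    by_cases hzt : z = t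
    · subst hzt; rw [Equiv.swap_apply_right, ← h1 s hs, hgst]
    · have hzW : z ∉ W := fun h => hz (by simp [hzt, h])
      rw [Equiv.swap_apply_of_ne_of_ne (fun h : z = s => hzW (h ▸ hs)) hzt, h2 z hzW])
  rw [Equiv.Perm.sign_mul, hsg, Equiv.Perm.sign_swap hst] at this
  exact absurd this (by decide)

theorem fix_even {m : ℕ} (NO : ∀ (Y : Finset Ω) (g : G) (π : Equiv.Perm Ω), Y.card = m → (∀ z ∈ Y, g • z = π z) →
    (∀ z, z ∉ Y → π z = z) → Equiv.Perm.sign π = 1) {W : Finset Ω} (hW : W.card = m + 1) {g : G} (hg : g • W = W)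
    {w s t : Ω} (hw : w ∈ W) (hgw : g • w = w) (hs : s ∈ W) (ht : t ∈ W) (hst : s ≠ t) (hgst : g • s = t) :
    ¬ Sm G ((W.erase s).erase t) s t := by
  obtain ⟨π, h1, h2⟩ := exP hg
  refine parity NO hW hs ht hst hgst h1 h2 (NO (W.erase w) g π (by rw [card_erase_of_mem hw, hW]; rfl)
    (fun z hz => h1 z (mem_of_mem_erase hz)) fun z hz => ?_)
  by_cases hzw : z = w
  · subst hzw; rw [← h1 z hw, hgw]
  · exact h2 z fun h => hz (by simp [hzw, h])

theorem Big.MT_big (b : Big p G Ω) : MT G Ω (2 * p - 2) := by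
  classical
  have h3 := b.h3
  have hn := b.hn
  refine MT_of_St (by omega) fun D x y hD hx hy => ?_
  change Sm G D x y
  by_cases NO : ∀ (Y : Finset Ω) (g : G) (π : Equiv.Perm Ω), Y.card = 2 * p - 2 → (∀ z ∈ Y, g • z = π z) →
    (∀ z, z ∉ Y → π z = z) → Equiv.Perm.sign π = 1
  swap
  · push Not at NO
    obtain ⟨Y0, g0, π0, c, h1, h2, h4⟩ := NO
    exact b.Sm_odd c h1 h2 h4 (by omega) hx hy
  by_contra hxy
  have hD' : D.card = 2 * p - 3 := by omega
  have hdiff : ∀ Z : Finset Ω, Z.card = 2 * p - 3 → ∀ u, u ∉ Z → ∃ v, v ∉ Z ∧ ¬ Sm G Z u v := by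
    intro Z hZ u hu
    obtain ⟨g, rfl⟩ := b.hom D Z (by omega) (by omega) (by omega)
    by_contra hcon
    push Not at hcon
    have h1 := hcon (g • x) (by rwa [smul_mem_smul_finset_iff])
    have h2 := hcon (g • y) (by rwa [smul_mem_smul_finset_iff])
    exact hxy ((Sm.smul_iff g).mp (h1.symm.trans h2))
  have two : ∀ Z : Finset Ω, Z.card = 2 * p - 3 → ∀ u v w, u ∉ Z → v ∉ Z → w ∉ Z → ¬ Sm G Z u v → ¬ Sm G Z u w →
      Sm G Z v w := by
    intro Z hZ u v w hu hv hw huv huw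
    obtain ⟨g, hg, hgv⟩ := b.transD hZ hu hv
    obtain ⟨k, hk, hkw⟩ := b.transD hZ hu hw
    obtain ⟨π, p1, p2⟩ := exP hg
    obtain ⟨ρ, r1, r2⟩ := exP hk
    have sπ := (sgn_cases π).resolve_left fun h => huv (b.evenSm hZ hu hg hgv p1 p2 h)
    have sρ := (sgn_cases ρ).resolve_left fun h => huw (b.evenSm hZ hu hk hkw r1 r2 h)
    have p2' : ∀ z, z ∉ Z → π⁻¹ z = z := fun z hz => by rw [Equiv.Perm.inv_eq_iff_eq, p2 z hz]
    refine b.evenSm hZ hv (g := k * g⁻¹) (π := ρ * π⁻¹) ?_ ?_ ?_ ?_ ?_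
    · rw [mul_smul, inv_smul_eq_iff.mpr hg.symm, hk]
    · rw [mul_smul, inv_smul_eq_iff.mpr hgv.symm, hkw]
    · intro z hz
      have hz' := (perm_mem p2' z).mpr hz
      have : g⁻¹ • z = π⁻¹ z := by rw [inv_smul_eq_iff, p1 _ hz']; simp
      rw [mul_smul, this, Equiv.Perm.mul_apply, r1 _ hz']
    · intro z hz; rw [Equiv.Perm.mul_apply, p2' z hz, r2 z hz]
    · rw [Equiv.Perm.sign_mul, Equiv.Perm.sign_inv, sπ, sρ]; rfl
  have notall : ∀ W : Finset Ω, W.card = 2 * p - 1 → ¬ ∀ s ∈ W, ∀ t ∈ W, s ≠ t → ¬ Sm G ((W.erase s).erase t) s t := by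
    intro W hW hall
    have hall' : ∀ (Z : Finset Ω), Z.card = 2 * p - 3 → ∀ u v, u ∉ Z → v ∉ Z → u ≠ v → ¬ Sm G Z u v := by
      intro Z hZ u v hu hv huv h
      obtain ⟨g, hg⟩ := b.hom (insert u (insert v Z)) W (by
        rw [card_insert_of_notMem (by simp [hu, huv]), card_insert_of_notMem hv]; omega)
        (by rw [card_insert_of_notMem (by simp [hu, huv]), card_insert_of_notMem hv]; omega)
        (by rw [card_insert_of_notMem (by simp [hu, huv]), card_insert_of_notMem hv]; omega)
      refine hall (g • u) (by rw [← hg, smul_mem_smul_finset_iff]; simp) (g • v)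
        (by rw [← hg, smul_mem_smul_finset_iff]; simp) (fun h => huv (MulAction.injective g h)) ?_
      rw [← hg, ← smul_erase', ← smul_erase', erase_insert (by simp [hu, huv]), erase_insert hv]
      exact h.smul g
    obtain ⟨T, hT, hT3⟩ := exists_subset_card_eq (s := Dᶜ) (n := 3) (by rw [card_compl]; omega)
    obtain ⟨u, v, w, huv, huw, hvw, rfl⟩ := card_eq_three.mp hT3
    have m : ∀ z ∈ ({u, v, w} : Finset Ω), z ∉ D := fun z hz => mem_compl.mp (hT hz)
    exact hall' D hD' v w (m v (by simp)) (m w (by simp)) hvw (two D hD' u v w (m u (by simp)) (m v (by simp))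
      (m w (by simp)) (hall' D hD' u v (m u (by simp)) (m v (by simp)) huv)
      (hall' D hD' u w (m u (by simp)) (m w (by simp)) huw))
  have a := avg2 (Ω := Ω) (k := 2 * p - 3) (by omega) (fun Z x y => if Sm G Z x y then 1 else -1)
    (2 * ((p - 1 : ℕ) : ℝ)) 0 ?_ ?_
  · have c1 : ((2 * p - 3 : ℕ) : ℝ) + 3 = 2 * p := by exact_mod_cast (by omega : 2 * p - 3 + 3 = 2 * p)
    have c2 : 0 < ((p - 1 : ℕ) : ℝ) := by exact_mod_cast (by omega : 0 < p - 1)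
    have c3 : 2 * (p : ℝ) ≤ Fintype.card Ω := by exact_mod_cast (by omega : 2 * p ≤ Fintype.card Ω)
    have : 0 < 2 * ((p - 1 : ℕ) : ℝ) * ((Fintype.card Ω : ℝ) - (2 * p - 3 : ℕ)) * ((Fintype.card Ω : ℝ) - (2 * p - 3 : ℕ) - 1) :=
      mul_pos (mul_pos (by linarith) (by linarith)) (by linarith)
    linarith
  · intro W hWc
    obtain ⟨Q, hQ⟩ := b.c.hc W
    obtain ⟨C, hCW, hCp, hCs, hCo, hCF⟩ := b.c.decomp (by omega) (by omega) hQ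
    have hC : IsC Q C := ⟨hCp, hCo⟩
    have hΓc := b.c.card_fix Q
    have hWe : W = C ∪ FixS Ω Q := by
      rw [← eq_of_subset_of_card_le hCF, union_sdiff_of_subset hCW]
      rw [b.c.card_fix, card_sdiff_of_subset hCW]; omega
    set Γ := FixS Ω Q with hΓ
    have hdis : Disjoint C Γ := hC.disj subset_rfl
    have hWc' : W.card = 2 * p - 2 + 1 := by omega
    have hCW' : ∀ z ∈ C, z ∈ W := fun z hz => hCW hz
    have hΓW : ∀ z ∈ Γ, z ∈ W := fun z hz => by rw [hWe]; simp [hz]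
    have dC : ∀ s ∈ C, ∀ t ∈ C, s ≠ t → ¬ Sm G ((W.erase s).erase t) s t := by
      intro s hs t ht hst
      obtain ⟨q, hq, hqt⟩ := mem_Qorb.mp (show t ∈ Qorb Q s by rw [hC.2 s hs]; exact ht)
      obtain ⟨w, hw⟩ : Γ.Nonempty := card_pos.mp (by omega)
      exact fix_even NO hWc' (hQ q hq) (hΓW w hw) (mem_FixS.mp hw q hq) (hCW' s hs) (hCW' t ht) hst hqt
    have mv : ∀ s ∈ Γ, ∀ t ∈ Γ, ∀ c ∈ C, ∀ c' ∈ C, ∃ g : G, g • W = W ∧ g • s = t ∧ g • c = c' := by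
      intro s hs t ht c hc c' hc'
      obtain ⟨g, hgQ, hgC, hg⟩ := (b.hH 1 (by omega)).strong hC (S := {s}) (S' := {t})
        (by simpa using hs) (by simpa using ht) (by simp) (by simp)
      have hgΓ : g • Γ = Γ := (FixS_smul hgQ).symm
      have hgW : g • W = W := by rw [hWe, smul_finset_union, hgC, hgΓ]
      have hgst : g • s = t := by simpa using hg
      obtain ⟨q, hq, hqt⟩ := mem_Qorb.mp (show c' ∈ Qorb Q (g • c) by rw [hC.2 _ (smem hgC hc)]; exact hc')
      exact ⟨q * g, by rw [mul_smul, hgW, hQ q hq], by rw [mul_smul, hgst, mem_FixS.mp ht q hq], by rw [mul_smul, hqt]⟩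
    obtain ⟨c, hc⟩ : C.Nonempty := card_pos.mp (by omega)
    have dΓ : ∀ s ∈ Γ, ∀ t ∈ Γ, s ≠ t → ¬ Sm G ((W.erase s).erase t) s t := by
      intro s hs t ht hst
      obtain ⟨g, hgW, hgst, hgc⟩ := mv s hs t ht c hc c hc
      exact fix_even NO hWc' hgW (hCW' c hc) hgc (hΓW s hs) (hΓW t ht) hst hgst
    have crossall : ∀ s ∈ Γ, ∀ c ∈ C, Sm G ((W.erase s).erase c) s c := by
      intro s hs c hc
      by_contra hn
      have hcr : ∀ t ∈ Γ, ∀ d ∈ C, ¬ Sm G ((W.erase t).erase d) t d := by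
        intro t ht d hd h
        obtain ⟨g, hgW, h1, h2⟩ := mv t ht s hs d hd c hc
        apply hn
        have := h.smul g
        rwa [smul_erase', smul_erase', hgW, h1, h2] at this
      refine notall W (by omega) fun s hs t ht hst => ?_
      rw [hWe, mem_union] at hs ht
      rcases hs with hs | hs <;> rcases ht with ht | ht
      · exact dC s hs t ht hst
      · intro h; rw [erase_right_comm] at h; exact hcr t ht s hs h.symm
      · exact hcr s hs t ht
      · exact dΓ s hs t ht hst
    have key : ∀ x, ∀ A B : Finset Ω, Disjoint A B → W.erase x = A ∪ B →
        (∀ y ∈ A, ¬ Sm G ((W.erase x).erase y) x y) → (∀ y ∈ B, Sm G ((W.erase x).erase y) x y) →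
        ∑ y ∈ W.erase x, (if Sm G ((W.erase x).erase y) x y then (1:ℝ) else -1) = B.card - A.card := by
      intro x A B hAB hx hA hB
      rw [sum_congr hx (fun _ _ => rfl), sum_union hAB, sum_congr rfl (g := fun _ => (-1:ℝ))
        (fun y hy => if_neg (hA y hy)), sum_congr rfl (s₁ := B) (g := fun _ => (1:ℝ)) (fun y hy => if_pos (hB y hy))]
      simp; ring
    have cp : ((p - 1 : ℕ) : ℝ) = p - 1 := by rw [Nat.cast_sub (by omega)]; simp
    rw [sum_congr hWe (fun _ _ => rfl), sum_union hdis,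
      sum_congr rfl (g := fun _ => (0:ℝ)) (fun x hx => ?_),
      sum_congr rfl (s₁ := Γ) (g := fun _ => (2:ℝ)) (fun x hx => ?_)]
    · simp only [sum_const, hΓc, nsmul_eq_mul]; linarith
    · have hxC : x ∉ C := fun h => hC.notMem h hx
      rw [key x (Γ.erase x) C (hdis.symm.mono_left (erase_subset _ _)) (by
        rw [hWe, erase_union_distrib, erase_eq_of_notMem hxC, union_comm])
        (fun y hy => by
          rw [mem_erase] at hy
          exact dΓ x hx y hy.2 (Ne.symm hy.1)) (fun y hy => crossall x hx y hy), card_erase_of_mem hx, hΓc, hC.1,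
        Nat.cast_sub (by omega), cp]
      push_cast; ring
    · have hxΓ : x ∉ Γ := hC.notMem hx
      rw [key x (C.erase x) Γ (hdis.mono_left (erase_subset _ _)) (by
        rw [hWe, erase_union_distrib, erase_eq_of_notMem hxΓ])
        (fun y hy => by
          rw [mem_erase] at hy
          exact dC x hx y hy.2 (Ne.symm hy.1)) (fun y hy => by
            rw [erase_right_comm]; exact (crossall y hy x hx).symm), card_erase_of_mem hx, hΓc, hC.1]
      simp
  · intro Z hZ
    refine sum_nonpos fun y hy => ?_
    rw [mem_compl] at hy
    rw [sum_ite, sum_const, sum_const, nsmul_eq_mul, nsmul_eq_mul, mul_one, mul_neg_one]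
    obtain ⟨v, hv, hvS⟩ := hdiff Z hZ y hy
    obtain ⟨g, hg, rfl⟩ := b.transD hZ hy hv
    have : (filter (fun x => Sm G Z x y) (insert y Z)ᶜ).card ≤
        (filter (fun x => ¬ Sm G Z x y) (insert y Z)ᶜ).card := by
      refine card_le_card_of_injOn (fun x => g • x) ?_ (MulAction.injective g).injOn
      intro x hx
      simp only [coe_filter, mem_compl, mem_insert, not_or, Set.mem_setOf_eq] at hx ⊢
      have h1 := hx.2.smul g
      rw [hg] at h1
      have h2 : ¬ Sm G Z (g • x) y := fun h => hvS (h.symm.trans h1)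
      refine ⟨⟨fun h => h2 (by rw [h]; exact Sm.refl _ _), fun h => hx.1.2 ?_⟩, h2⟩
      rwa [← hg, smul_mem_smul_finset_iff] at h
    have : ((filter (fun x => Sm G Z x y) (insert y Z)ᶜ).card : ℝ) ≤
        ((filter (fun x => ¬ Sm G Z x y) (insert y Z)ᶜ).card : ℝ) := by exact_mod_cast this
    linarith

theorem Big.fin (b : Big p G Ω) : ∃ V : FDRep ℂ G, Simple V ∧
      p ∣ Module.finrank ℂ V ∧ ¬ (p ^ 2 ∣ Module.finrank ℂ V) := by
  have h3 := b.h3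
  have hn := b.hn
  have hT := b.MT_big
  obtain ⟨V, hV, hd⟩ := theoremA (G := G) (Ω := Ω) (k := p - 1) (hT.mono (by omega)) (by omega)
  obtain ⟨a, ha, hna⟩ := b.c.mod
  obtain ⟨h1, h2⟩ := b.c.ppart (hT.mono (by omega))
  refine ⟨V, hV, ?_⟩
  rw [hd]
  exact choose_part b.c.hn ⟨a, by rw [hna, mul_comm]⟩ h1 h2

end syl16

section syl17
variable {G X : Type} [Group G] [Finite G] [Fintype X] [DecidableEq X] [MulAction G X]

theorem rank3 (T : Matrix X X ℂ) (hinv : ∀ (g : G) x y, T (g • x) (g • y) = T x y)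
    (hrow : ∀ x, ∑ y, T x y = 0) (hcol : ∀ y, ∑ x, T x y = 0) (hd : ∀ x, T x x = 0) {a0 b0 d0 : ℂ}
    (ha0 : a0 ≠ 0)
    (hTT : ∀ x y, (T * T) x y = a0 * (if x = y then 1 else 0) + b0)
    (hM : ∀ M : Matrix X X ℂ, (∀ (g : G) x y, M (g • x) (g • y) = M x y) →
      ∃ a b d : ℂ, ∀ x y, M x y = a * (if x = y then 1 else 0) + b + d * T x y)
    (hX : 2 ≤ Fintype.card X) :
    ∃ V : FDRep ℂ G, Simple V ∧ 2 * Module.finrank ℂ V + 1 = Fintype.card X := by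
  have : Nonempty X := Fintype.card_pos_iff.mp (by omega)
  have hn : (Fintype.card X : ℂ) ≠ 0 := by exact_mod_cast (by omega : Fintype.card X ≠ 0)
  have colz : ∀ (M : Matrix X X ℂ) y, ∑ x, (sz X * M) x y = 0 := by
    intro M y
    simp only [Matrix.mul_apply]
    rw [sum_comm]
    exact sum_eq_zero fun z _ => by rw [← sum_mul, sz_col, zero_mul]
  have hPT : sz X * T = T := by
    ext x y
    simp [Matrix.mul_apply, sz, sub_mul, sum_sub_distrib, ← mul_sum, hcol]
  have hTP : T * sz X = T := by
    ext x y
    simp [Matrix.mul_apply, sz, mul_sub, sum_sub_distrib, ← sum_mul, hrow]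
  have htr : (sz X).trace = (Fintype.card X : ℂ) - 1 := by
    simp [Matrix.trace, sz, hn]
  have form : ∀ (M : Matrix X X ℂ) (a b d : ℂ), (∀ x y, M x y = a * (if x = y then 1 else 0) + b + d * T x y) →
      (∀ y, ∑ x, M x y = 0) → M = a • sz X + d • T := by
    intro M a b d h h0
    obtain ⟨y⟩ := ‹Nonempty X›
    have h1 := h0 y
    simp only [h, sum_add_distrib, ← mul_sum, hcol] at h1
    simp at h1
    have hb : b = - (a * (Fintype.card X : ℂ)⁻¹) := by field_simp; linear_combination h1
    ext x y
    rw [h, hb]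
    by_cases hxy : x = y <;> simp [sz, hxy] <;> ring
  obtain ⟨V, hV, hV2⟩ := repG2 (G := G) (sz X) T (fun g t t' => by simp [sz]) sz_mul hinv hPT hTP a0 ha0 (by
    have := form (T * T) a0 b0 0 (by simpa using hTT) (by
      intro y; rw [← hPT, Matrix.mul_assoc]; exact colz _ y)
    rw [this]; simp) (by simp [Matrix.trace, hd]) (by
      rw [htr, sub_ne_zero]; exact_mod_cast (by omega : Fintype.card X ≠ 1)) (by
    intro M h1 h2
    obtain ⟨a, b, d, h⟩ := hM M h1
    refine ⟨a, d, form M a b d h ?_⟩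
    intro y; rw [← h2, Matrix.mul_assoc]; exact colz _ y)
  refine ⟨V, hV, ?_⟩
  rw [htr] at hV2
  have : (2 * Module.finrank ℂ V : ℂ) + 1 = Fintype.card X := by rw [hV2]; ring
  exact_mod_cast this

theorem tourn {A : X → X → Prop} (tr : ∀ x y : X, ∃ g : G, g • x = y) {x0 y0 : X} (hxy : x0 ≠ y0)
    (hA : ∀ x y, A x y ↔ ∃ g : G, g • x0 = x ∧ g • y0 = y)
    (hanti : ∀ x y, A x y → ¬ A y x) (htot : ∀ x y, x ≠ y → A x y ∨ A y x) :
    ∃ V : FDRep ℂ G, Simple V ∧ 2 * Module.finrank ℂ V + 1 = Fintype.card X := by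
  classical
  have Ainv : ∀ (g : G) x y, A (g • x) (g • y) ↔ A x y := by
    have : ∀ (g : G) x y, A x y → A (g • x) (g • y) := by
      intro g x y h
      rw [hA] at h ⊢
      obtain ⟨k, rfl, rfl⟩ := h
      exact ⟨g * k, mul_smul _ _ _, mul_smul _ _ _⟩
    intro g x y
    refine ⟨fun h => ?_, this g x y⟩
    simpa using this g⁻¹ _ _ h
  have irr : ∀ x, ¬ A x x := fun x h => hanti x x h h
  have hX : 2 ≤ Fintype.card X := by
    have := card_le_univ ({x0, y0} : Finset X)
    rwa [card_pair hxy] at this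
  let T : Matrix X X ℂ := fun x y => if A x y then 1 else if A y x then -1 else 0
  have Tn : ∀ x y, T y x = - T x y := by
    intro x y
    simp only [T]
    by_cases h1 : A x y
    · simp [h1, hanti x y h1]
    · by_cases h2 : A y x <;> simp [h1, h2]
  have Tinv : ∀ (g : G) x y, T (g • x) (g • y) = T x y := by
    intro g x y; simp only [T, Ainv]
  have hrow : ∀ x, ∑ y, T x y = 0 := by
    have hc : ∀ x, ∑ y, T x y = ∑ y, T x0 y := by
      intro x
      obtain ⟨g, rfl⟩ := tr x0 x
      rw [← Equiv.sum_comp (MulAction.toPerm g)]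
      exact sum_congr rfl fun y _ => Tinv g x0 y
    have h1 : ∑ x, ∑ y, T x y = - ∑ x, ∑ y, T x y := by
      conv_lhs => rw [sum_comm]
      rw [← sum_neg_distrib]
      refine sum_congr rfl fun x _ => ?_
      rw [← sum_neg_distrib]
      exact sum_congr rfl fun y _ => Tn _ _
    have h2 : ∑ x, ∑ y, T x y = 0 := by linear_combination (1/2 : ℂ) * h1
    rw [sum_congr rfl fun x _ => hc x, sum_const, nsmul_eq_mul, mul_eq_zero] at h2
    intro x
    rw [hc x]
    refine h2.resolve_left ?_
    rw [card_univ]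
    exact_mod_cast (by omega : Fintype.card X ≠ 0)
  have hcol : ∀ y, ∑ x, T x y = 0 := by
    intro y
    rw [sum_congr rfl fun x _ => Tn y x, sum_neg_distrib, hrow, neg_zero]
  have hM : ∀ M : Matrix X X ℂ, (∀ (g : G) x y, M (g • x) (g • y) = M x y) →
      ∃ a b d : ℂ, ∀ x y, M x y = a * (if x = y then 1 else 0) + b + d * T x y := by
    intro M h
    have hMA : ∀ x y, A x y → M x y = M x0 y0 ∧ M y x = M y0 x0 := by
      intro x y hxy
      obtain ⟨g, rfl, rfl⟩ := (hA x y).mp hxy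
      exact ⟨h _ _ _, h _ _ _⟩
    refine ⟨M x0 x0 - (M x0 y0 + M y0 x0) / 2, (M x0 y0 + M y0 x0) / 2, (M x0 y0 - M y0 x0) / 2, fun x y => ?_⟩
    by_cases hxy : x = y
    · subst hxy
      obtain ⟨g, rfl⟩ := tr x0 x
      simp [T, irr, h]
    · rcases htot x y hxy with h1 | h1
      · rw [(hMA x y h1).1]; simp [T, h1, hxy]; ring
      · rw [(hMA y x h1).2]; simp [T, h1, hxy, hanti y x h1]; ring
  obtain ⟨a, b, d, hab⟩ := hM (T * T) (by
    intro g x y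
    simp only [Matrix.mul_apply]
    rw [← Equiv.sum_comp (MulAction.toPerm g)]
    exact sum_congr rfl fun z _ => by
      rw [MulAction.toPerm_apply, Tinv, Tinv])
  have hA0 : A x0 y0 := (hA _ _).mpr ⟨1, by simp, by simp⟩
  have sym : (T * T) x0 y0 = (T * T) y0 x0 := by
    simp only [Matrix.mul_apply]
    exact sum_congr rfl fun z _ => by rw [Tn z x0, Tn y0 z]; ring
  have hd : d = 0 := by
    rw [hab, hab, Tn x0 y0] at sym
    simp [hxy, Ne.symm hxy, T, hA0] at sym
    linear_combination (1/2 : ℂ) * sym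
  subst hd
  refine rank3 (G := G) T Tinv hrow hcol (fun x => by simp [T, irr]) (a0 := a) (b0 := b) (d0 := 0) ?_ (by simpa using hab) hM hX
  intro ha
  have e1 := hab x0 x0
  have e2 : ∑ x, (T * T) x x0 = 0 := by
    simp only [Matrix.mul_apply]
    rw [sum_comm]
    exact sum_eq_zero fun z _ => by rw [← sum_mul, hcol, zero_mul]
  simp only [hab, ha] at e2
  simp at e2
  have hb : b = 0 := by
    rcases e2 with h | h
    · have : Nonempty X := ⟨x0⟩
      exact absurd h (by exact_mod_cast Fintype.card_ne_zero)
    · exact h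
  rw [ha, hb] at e1
  simp only [Matrix.mul_apply] at e1
  have e3 : ∑ z, T x0 z * T z x0 = - ((∑ z, (if z = x0 then 0 else 1) : ℕ) : ℂ) := by
    push_cast
    rw [← sum_neg_distrib]
    refine sum_congr rfl fun z _ => ?_
    by_cases hz : z = x0
    · subst hz; simp [T, irr]
    · rcases htot x0 z (Ne.symm hz) with h | h
      · simp [T, h, hanti _ _ h, hz]
      · simp [T, h, hanti _ _ h, hz]
  rw [e3] at e1
  have e4 : (∑ z, (if z = x0 then 0 else 1) : ℕ) = 0 := by
    have : ((∑ z, (if z = x0 then 0 else 1) : ℕ) : ℂ) = 0 := by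
      rw [← neg_eq_zero, e1]; simp
    exact_mod_cast this
  rw [sum_eq_zero_iff] at e4
  have := e4 y0 (by simp)
  simp [Ne.symm hxy] at this

theorem seven [Fact (Nat.Prime 3)] (tr : ∀ x y : X, ∃ g : G, g • x = y) (h7 : Fintype.card X = 7) (Q : Sylow 3 G) (x0 : X)
    (hx0 : ∀ x, (∀ q ∈ Q, q • x = x) ↔ x = x0) :
    ∃ V : FDRep ℂ G, Simple V ∧ 3 ∣ Module.finrank ℂ V ∧ ¬ (3 ^ 2 ∣ Module.finrank ℂ V) := by
  classical
  have o3 : ∀ y, y ≠ x0 → (Qorb Q y).card = 3 ∧ x0 ∉ Qorb Q y := by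
    intro y hy
    obtain ⟨j, hj⟩ := Qorb_card_pow Q y
    have h0 : ∃ q ∈ Q, q • y ≠ y := by
      by_contra h; push Not at h; exact hy ((hx0 y).mp h)
    obtain ⟨q, hq, hqy⟩ := h0
    have h3 := Qorb_card_ge hq hqy
    have h8 : (Qorb Q y).card ≤ 7 := by rw [← h7]; exact card_le_univ _
    constructor
    · rcases j with _ | _ | j
      · simp at hj; omega
      · simpa using hj
      · have : 3 ^ 2 ≤ 3 ^ (j + 1 + 1) := Nat.pow_le_pow_right (by norm_num) (by omega)
        omega
    · intro h
      obtain ⟨q, hq, hqy⟩ := mem_Qorb.mp h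
      apply hy
      have := (hx0 x0).mpr rfl q⁻¹ (inv_mem hq)
      rw [← this, ← hqy, inv_smul_smul]
  obtain ⟨y0, hy0⟩ : ∃ y0, y0 ≠ x0 := by
    have : Nontrivial X := Fintype.one_lt_card_iff_nontrivial.mp (by omega)
    exact exists_ne x0
  obtain ⟨y1, hy1⟩ : ∃ y1, y1 ∉ insert x0 (Qorb Q y0) := by
    by_contra h
    push Not at h
    have : univ ⊆ insert x0 (Qorb Q y0) := fun z _ => h z
    have h2 := card_le_card this
    rw [card_univ, h7] at h2
    have := card_insert_le x0 (Qorb Q y0)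
    have := (o3 y0 hy0).1
    omega
  rw [mem_insert, not_or] at hy1
  have dis : Disjoint (Qorb Q y0) (Qorb Q y1) := by
    rw [disjoint_left]
    intro z h1 h2
    apply hy1.2
    rw [← Qorb_eq h1, Qorb_eq h2]
    exact mem_Qorb.mpr ⟨1, one_mem _, one_smul _ _⟩
  have cov : insert x0 (Qorb Q y0 ∪ Qorb Q y1) = univ := by
    refine eq_univ_of_card _ ?_
    rw [card_insert_of_notMem, card_union_of_disjoint dis, (o3 y0 hy0).1, (o3 y1 hy1.1).1, h7]
    rw [mem_union, not_or]
    exact ⟨(o3 y0 hy0).2, (o3 y1 hy1.1).2⟩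
  have hfix := (hx0 x0).mpr rfl
  let A : X → X → Prop := fun x y => ∃ g : G, g • x0 = x ∧ g • y0 = y
  let B : X → X → Prop := fun x y => ∃ g : G, g • x0 = x ∧ g • y1 = y
  have Asm : ∀ (g : G) x y, A x y → A (g • x) (g • y) := by
    rintro g x y ⟨k, rfl, rfl⟩
    exact ⟨g * k, mul_smul _ _ _, mul_smul _ _ _⟩
  have AB : ∀ x y, x ≠ y → A x y ∨ B x y := by
    intro x y hxy
    obtain ⟨g, hg⟩ := tr x0 x
    have : g⁻¹ • y ∈ insert x0 (Qorb Q y0 ∪ Qorb Q y1) := by rw [cov]; simp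
    rw [mem_insert, mem_union] at this
    rcases this with h | h | h
    · exact absurd (by rw [← hg, ← h, smul_inv_smul]) hxy
    · obtain ⟨q, hq, h'⟩ := mem_Qorb.mp h
      left; exact ⟨g * q, by rw [mul_smul, hfix q hq, hg], by rw [mul_smul, h', smul_inv_smul]⟩
    · obtain ⟨q, hq, h'⟩ := mem_Qorb.mp h
      right; exact ⟨g * q, by rw [mul_smul, hfix q hq, hg], by rw [mul_smul, h', smul_inv_smul]⟩
  by_cases h1 : A x0 y1
  · have hall : ∀ x y, x ≠ y → A x y := by
      intro x y hxy
      rcases AB x y hxy with h | ⟨g, rfl, rfl⟩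
      · exact h
      · exact Asm g _ _ h1
    have hT : MT G X (2 * 1) := MT_of_St (by omega) (by
      intro D x y hD hx hy
      obtain ⟨d, rfl⟩ := card_eq_one.mp (show D.card = 1 by omega)
      rw [mem_singleton] at hx hy
      obtain ⟨g, h1, h2⟩ := hall d x (Ne.symm hx)
      obtain ⟨k, h3, h4⟩ := hall d y (Ne.symm hy)
      refine ⟨k * g⁻¹, ?_, ?_⟩
      · intro z hz
        rw [mem_singleton] at hz
        rw [hz, mul_smul, inv_smul_eq_iff.mpr h1.symm, h3]
      · rw [mul_smul, inv_smul_eq_iff.mpr h2.symm, h4])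
    obtain ⟨V, hV, hd⟩ := theoremA (G := G) (Ω := X) (k := 1) hT (by omega)
    rw [h7] at hd
    refine ⟨V, hV, ?_⟩
    rw [hd]; decide
  · have A0 : A x0 y0 := ⟨1, by simp, by simp⟩
    have hA0 : ∀ y, A x0 y → y ∈ Qorb Q y0 := by
      intro y hy
      have : y ∈ insert x0 (Qorb Q y0 ∪ Qorb Q y1) := by rw [cov]; simp
      rw [mem_insert, mem_union] at this
      rcases this with h | h | h
      · obtain ⟨g, h2, h3⟩ := hy
        exact absurd (MulAction.injective g (h3.trans (h.trans h2.symm))) hy0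
      · exact h
      · obtain ⟨q, hq, h'⟩ := mem_Qorb.mp h
        have := Asm q⁻¹ _ _ hy
        rw [hfix _ (inv_mem hq), ← h', inv_smul_smul] at this
        exact absurd this h1
    have hns : ¬ A y0 x0 := by
      intro hs
      have symA : ∀ x y, A x y → A y x := by
        rintro x y ⟨g, rfl, rfl⟩; exact Asm g _ _ hs
      let Gr : SimpleGraph X := { Adj := A, symm := ⟨fun x y h => symA x y h⟩, loopless := ⟨by
        rintro x ⟨g, h2, h3⟩
        exact hy0 (MulAction.injective g (h3.trans h2.symm))⟩ }
      have hdeg : ∀ x, Gr.degree x = 3 := by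
        intro x
        obtain ⟨g, rfl⟩ := tr x0 x
        rw [← (o3 y0 hy0).1, ← SimpleGraph.card_neighborFinset_eq_degree, ← card_smul_finset g (Qorb Q y0)]
        congr 1
        ext z
        rw [SimpleGraph.mem_neighborFinset, mem_smul_finset]
        constructor
        · intro h
          have := Asm g⁻¹ _ _ h
          rw [inv_smul_smul] at this
          exact ⟨_, hA0 _ this, smul_inv_smul _ _⟩
        · rintro ⟨w, hw, rfl⟩
          obtain ⟨q, hq, rfl⟩ := mem_Qorb.mp hw
          refine Asm g _ _ ?_
          have := Asm q _ _ A0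
          rwa [hfix q hq] at this
      have := Gr.sum_degrees_eq_twice_card_edges
      rw [sum_congr rfl fun x _ => hdeg x, sum_const, card_univ, h7] at this
      simp at this
      omega
    obtain ⟨g, hg1, hg2⟩ := (AB y0 x0 hy0).resolve_left hns
    obtain ⟨V, hV, hd⟩ := tourn (G := G) (A := A) tr (Ne.symm hy0) (fun x y => Iff.rfl) (by
      rintro x y ⟨k, rfl, rfl⟩ h
      have := Asm k⁻¹ _ _ h
      rw [inv_smul_smul, inv_smul_smul] at this
      exact hns this) (by
      intro x y hxy
      rcases AB x y hxy with h | ⟨k, rfl, rfl⟩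
      · exact Or.inl h
      · right
        refine ⟨k * g⁻¹, ?_, ?_⟩
        · rw [mul_smul, inv_smul_eq_iff.mpr hg2.symm]
        · rw [mul_smul, inv_smul_eq_iff.mpr hg1.symm])
    rw [h7] at hd
    have : Module.finrank ℂ V = 3 := by omega
    exact ⟨V, hV, by rw [this]; decide⟩

end syl17

section syl18
variable {G Ω : Type} [Group G] [Finite G] [Fintype Ω] [DecidableEq Ω] [MulAction G Ω] [hp : Fact (Nat.Prime 3)]

theorem Ctx.eight_blocks (c : Ctx 3 G Ω) (h8 : Fintype.card Ω = 8) (hH : ¬ HH 3 G Ω 1) :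
    ∃ (Q : Sylow 3 G) (C : Finset Ω) (b : Ω), IsC Q C ∧ b ∈ FixS Ω Q ∧
      (∀ X X' : Finset Ω, X.card = 3 → X'.card = 3 → Eq' G X X') ∧
      (∀ x ∉ C, Eq' G (insert b C) (insert x C) → x = b) ∧ Eq' G (insert b C) (insert b C)ᶜ := by
  unfold HH at hH
  push Not at hH
  obtain ⟨Q, C, S, S', hC, hS, hS', h1, h1', hne⟩ := hH
  obtain ⟨s, rfl⟩ := card_eq_one.mp h1
  obtain ⟨s', rfl⟩ := card_eq_one.mp h1'
  have hs := singleton_subset_iff.mp hS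
  have hs' := singleton_subset_iff.mp hS'
  simp only [union_comm C, ← insert_eq] at hne
  have hss : s ≠ s' := by rintro rfl; exact hne 1 (one_smul _ _)
  have hF : FixS Ω Q = {s, s'} := by
    symm
    apply eq_of_subset_of_card_le
    · intro x; simp; rintro (rfl | rfl) <;> assumption
    · rw [c.card_fix, card_pair hss]
  have hu : Stb Q (univ \ C) := Stb.sdiff (fun g _ => smul_finset_univ) hC.stb
  have hcu : (univ \ C).card = 5 := by
    rw [card_sdiff_of_subset (subset_univ _), card_univ, h8, hC.1]
  obtain ⟨D, hD, hD1, -, hD2, hD3⟩ := c.decomp (by omega) (by omega) hu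
  have hDC : IsC Q D := ⟨hD1, hD2⟩
  have two : ∀ E : Finset Ω, IsC Q E → E = C ∨ E = D := by
    intro E hE
    rcases hC.eq_or_disj hE with h | h
    · exact Or.inl h
    rcases hDC.eq_or_disj hE with h' | h'
    · exact Or.inr h'
    exfalso
    obtain ⟨x, hx⟩ := hE.ne
    refine hE.notMem hx (hD3 ?_)
    simp [disjoint_left.mp h hx, disjoint_left.mp h' hx]
  have nC : ∀ x ∈ FixS Ω Q, x ∉ C := fun x hx h => hC.notMem h hx
  have nD : ∀ x ∈ FixS Ω Q, x ∉ D := fun x hx h => hDC.notMem h hx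
  have all : ∀ x ∉ C, x ∈ D ∨ x = s ∨ x = s' := by
    intro x hx
    by_contra h
    push Not at h
    have := hD3 (show x ∈ (univ \ C) \ D by simp [hx, h.1])
    rw [hF] at this; simp [h.2] at this
  have DnC : ∀ x ∈ D, x ∉ C := fun x hx => (mem_sdiff.mp (hD hx)).2
  obtain ⟨h, hh⟩ := c.MT_pred {s, s'} (Equiv.swap s s') (by rw [card_pair hss]) (Equiv.injective _).injOn
  have e1 : h • s = s' := by simpa using hh s (by simp)
  have e2 : h • s' = s := by simpa using hh s' (by simp)
  obtain ⟨Q', hQ'⟩ := conj_syl Q h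
  have hF' : FixS Ω Q' = {s, s'} := by
    rw [FixS_smul hQ', hF, smul_finset_insert, smul_finset_singleton, e1, e2, pair_comm]
  obtain ⟨k, hk, hk'⟩ := syl_conj (pstab G {s, s'}) Q' Q
    (fun x hx y hy => mem_FixS.mp (hF' ▸ hy) x hx) (fun x hx y hy => mem_FixS.mp (hF ▸ hy) x hx)
  have hg := conj_trans hQ' hk'
  set g := k * h with hgd
  have f1 : g • s = s' := by rw [hgd, mul_smul, e1]; exact hk _ (by simp)
  have f2 : g • s' = s := by rw [hgd, mul_smul, e2]; exact hk _ (by simp)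
  have gC : g • C = D := by
    rcases two _ (hC.smul hg) with h | h
    · exact absurd (by rw [smul_finset_insert, h, f1]) (hne g)
    · exact h
  have cc : ∀ x y, x ≠ y → x ∈ FixS Ω Q → y ∈ FixS Ω Q → insert x D = (insert y C)ᶜ := by
    intro x y hxy hx hy
    apply eq_of_subset_of_card_le
    · intro z
      simp only [mem_insert, mem_compl, not_or]
      rintro (rfl | h)
      · exact ⟨hxy, nC _ hx⟩
      · exact ⟨fun e => nD _ hy (e ▸ h), DnC _ h⟩
    · rw [card_compl, card_insert_of_notMem (nC _ hy), card_insert_of_notMem (nD _ hx), h8, hC.1, hD1]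
  have hom : ∀ X : Finset Ω, X.card = 3 → Eq' G X C := by
    intro X hX
    obtain ⟨Q1, hQ1⟩ := c.hc X
    obtain ⟨E, hE, hE1, -, hE2, -⟩ := c.decomp (by omega) (by omega) hQ1
    obtain rfl := eq_of_subset_of_card_le hE (by omega)
    obtain ⟨l, -, hl⟩ := syl_conj ⊤ Q1 Q (fun _ _ => trivial) (fun _ _ => trivial)
    rcases two _ (IsC.smul hl ⟨hE1, hE2⟩) with h | h
    · exact ⟨l, h⟩
    · exact Eq'.trans ⟨l, h⟩ (Eq'.symm ⟨g, gC⟩)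
  have hom2 : ∀ X X' : Finset Ω, X.card = 3 → X'.card = 3 → Eq' G X X' :=
    fun X X' h h' => (hom X h).trans (hom X' h').symm
  have DD : ∀ x ∈ D, ∀ y ∈ D, Eq' G (insert x C) (insert y C) := by
    intro x hx y hy
    rw [← hDC.2 x hx] at hy
    obtain ⟨q, hq, rfl⟩ := mem_Qorb.mp hy
    exact ⟨q, by rw [smul_finset_insert, hC.stb q hq]⟩
  by_cases hx : ∃ x ∈ D, Eq' G (insert s C) (insert x C)
  · obtain ⟨x, hx, hx'⟩ := hx
    refine ⟨Q, C, s', hC, hs', hom2, ?_, g, by rw [smul_finset_insert, f2, gC, cc _ _ hss hs hs']⟩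
    intro y hy he
    rcases all y hy with h | rfl | rfl
    · obtain ⟨l, hl⟩ := (hx'.trans (DD x hx y h)).trans he.symm
      exact absurd hl (hne l)
    · obtain ⟨l, hl⟩ := he.symm
      exact absurd hl (hne l)
    · rfl
  · push Not at hx
    refine ⟨Q, C, s, hC, hs, hom2, ?_, g, by rw [smul_finset_insert, f1, gC, cc _ _ hss.symm hs' hs]⟩
    intro y hy he
    rcases all y hy with h | rfl | rfl
    · exact absurd he (hx y h)
    · rfl
    · obtain ⟨l, hl⟩ := he
      exact absurd hl (hne l)

theorem smul_compl' (g : G) (B : Finset Ω) : g • Bᶜ = (g • B)ᶜ := by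
  rw [compl_eq_univ_sdiff, smul_finset_sdiff, smul_finset_univ, compl_eq_univ_sdiff]

theorem Ctx.case_eight (c : Ctx 3 G Ω) (h8 : Fintype.card Ω = 8) (hH : ¬ HH 3 G Ω 1) :
    ∃ V : FDRep ℂ G, Simple V ∧ 3 ∣ Module.finrank ℂ V ∧ ¬ 3 ^ 2 ∣ Module.finrank ℂ V := by
  classical
  obtain ⟨Q, C, b, hC, hb, hom, hu, hcp⟩ := c.eight_blocks h8 hH
  have hbC : b ∉ C := fun h => hC.notMem h hb
  set B0 := insert b C with hB0
  have hB4 : ∀ B, Eq' G B0 B → B.card = 4 := by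
    rintro B ⟨g, rfl⟩
    rw [card_smul_finset, hB0, card_insert_of_notMem hbC, hC.1]
  have hBc : ∀ B, Eq' G B0 B → Eq' G B0 Bᶜ := by
    rintro B ⟨g, rfl⟩
    exact hcp.trans ⟨g, smul_compl' g B0⟩
  have u0 : ∀ B, Eq' G B0 B → C ⊆ B → B = B0 := by
    intro B hB h
    obtain ⟨x, hx, h'⟩ := exists_singleton h (by rw [hB4 B hB, hC.1])
    have e : B = insert x C := by rw [h', insert_erase hx]
    rw [e] at hB ⊢
    rw [hu x (by rw [h']; simp) hB]
  have u1 : ∀ T : Finset Ω, T.card = 3 → ∃ B, Eq' G B0 B ∧ T ⊆ B ∧ ∀ B', Eq' G B0 B' → T ⊆ B' → B' = B := by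
    intro T hT
    obtain ⟨g, rfl⟩ := hom C T hC.1 hT
    refine ⟨g • B0, ⟨g, rfl⟩, smul_finset_subset_smul_finset (subset_insert _ _), ?_⟩
    intro B' hB' hs
    rw [← u0 (g⁻¹ • B') (hB'.trans ⟨_, rfl⟩) (by
      rw [← smul_finset_subset_smul_finset_iff (a := g), smul_inv_smul]; exact hs), smul_inv_smul]
  set Bl := univ.filter (fun B => Eq' G B0 B) with hBl
  have cBl : Bl.card = 14 := by
    have := card_mul_eq_card_mul (s := powersetCard 3 (univ : Finset Ω)) (t := Bl)
      (fun T B => T ⊆ B) (m := 1) (n := 4) (by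
        intro T hT
        obtain ⟨B, h1, h2, h3⟩ := u1 T (mem_powersetCard.mp hT).2
        rw [card_eq_one]
        refine ⟨B, ?_⟩
        ext B'
        simp only [bipartiteAbove, hBl, mem_filter, mem_univ, true_and, mem_singleton]
        exact ⟨fun h => h3 B' h.1 h.2, by rintro rfl; exact ⟨h1, h2⟩⟩) (by
        intro B hB
        have : (powersetCard 3 (univ : Finset Ω)).bipartiteBelow (fun T B => T ⊆ B) B = powersetCard 3 B := by
          ext T; simp [bipartiteBelow, mem_powersetCard, and_comm]
        rw [this, card_powersetCard, hB4 B (by simpa [hBl] using hB)]; rfl)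
    rw [card_powersetCard, card_univ, h8] at this
    have h56 : Nat.choose 8 3 = 56 := rfl
    omega
  have pne : ∀ B : Finset Ω, B ≠ Bᶜ := by
    intro B h
    obtain ⟨x, hx⟩ := hC.ne
    have := congrArg (x ∈ ·) h
    simp at this
  have smp : ∀ (g : G) (B : Finset Ω), g • ({B, Bᶜ} : Finset (Finset Ω)) = {g • B, (g • B)ᶜ} := by
    intro g B
    rw [smul_finset_insert, smul_finset_singleton, smul_compl']
  let X := MulAction.orbit G ({B0, B0ᶜ} : Finset (Finset Ω))
  have hX : ∀ x : X, ∃ B, Eq' G B0 B ∧ x.1 = {B, Bᶜ} := by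
    rintro ⟨x, g, rfl⟩
    exact ⟨g • B0, ⟨g, rfl⟩, smp g B0⟩
  have hX' : ∀ B, Eq' G B0 B → ({B, Bᶜ} : Finset (Finset Ω)) ∈ X := by
    rintro B ⟨g, rfl⟩
    exact ⟨g, smp g B0⟩
  have hXm : ∀ (x : X) B, Eq' G B0 B → B ∈ x.1 → x.1 = {B, Bᶜ} := by
    intro x B hB h
    obtain ⟨B1, h1, h2⟩ := hX x
    rw [h2] at h ⊢
    rcases mem_insert.mp h with rfl | h
    · rfl
    · rw [mem_singleton.mp h, compl_compl, pair_comm]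
  have : Fintype X := Fintype.ofFinite _
  have h7 : Fintype.card X = 7 := by
    have := card_mul_eq_card_mul (s := Bl) (t := (univ : Finset X))
      (fun B x => B ∈ x.1) (m := 1) (n := 2) (by
        intro B hB
        have hB : Eq' G B0 B := by simpa [hBl] using hB
        rw [card_eq_one]
        refine ⟨⟨_, hX' B hB⟩, ?_⟩
        ext x
        simp only [bipartiteAbove, mem_filter, mem_univ, true_and, mem_singleton, Subtype.ext_iff]
        exact ⟨fun h => hXm x B hB h, fun h => by rw [h]; simp⟩) (by
        intro x _
        obtain ⟨B, hB, hx⟩ := hX x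
        have : Bl.bipartiteBelow (fun (B : Finset Ω) (x : X) => B ∈ x.1) x = {B, Bᶜ} := by
          ext B'
          simp only [bipartiteBelow, hBl, mem_filter, mem_univ, true_and, hx]
          refine ⟨fun h => h.2, fun h => ⟨?_, h⟩⟩
          rcases mem_insert.mp h with rfl | h
          · exact hB
          · rw [mem_singleton.mp h]; exact hBc B hB
        rw [this, card_pair (pne B)])
    rw [cBl, card_univ] at this
    omega
  have sB0 : Stb Q B0 := by
    intro q hq
    rw [hB0, smul_finset_insert, hC.stb q hq, mem_FixS.mp hb q hq]
  refine seven (X := X) (MulAction.exists_smul_eq G) h7 Q ⟨_, hX' B0 (Eq'.refl _)⟩ ?_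
  intro x
  constructor
  · intro hx
    obtain ⟨B, hB, hxB⟩ := hX x
    have sB : Stb Q B := by
      intro q hq
      by_contra hne
      have := Qorb_card_ge hq hne
      have h2 : Qorb Q B ⊆ x.1 := by
        intro B' hB'
        obtain ⟨r, hr, rfl⟩ := mem_Qorb.mp hB'
        have h3 : r • x.1 = x.1 := congrArg Subtype.val (hx r hr)
        rw [← h3]
        exact smul_mem_smul_finset (by rw [hxB]; simp)
      have h3 := card_le_card h2
      rw [hxB, card_pair (pne B)] at h3
      omega
    obtain ⟨E, hE, hE1, -, hE2, hE3⟩ := c.decomp (by rw [hB4 B hB]; norm_num) (by rw [hB4 B hB]; norm_num) sB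
    apply Subtype.ext
    refine hXm x B0 (Eq'.refl _) ?_
    rw [hxB]
    rcases hC.eq_or_disj ⟨hE1, hE2⟩ with rfl | h
    · rw [u0 B hB hE]; simp
    · have : C ⊆ Bᶜ := by
        intro y hy
        rw [mem_compl]
        intro hyB
        exact hC.notMem hy (hE3 (mem_sdiff.mpr ⟨hyB, fun h' => disjoint_left.mp h h' hy⟩))
      rw [u0 _ (hBc B hB) this]; simp
  · rintro rfl q hq
    apply Subtype.ext
    change q • ({B0, B0ᶜ} : Finset (Finset Ω)) = _
    rw [smp, sB0 q hq]

end syl18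

section syl19
variable {G Ω : Type} [Group G] [Finite G] [Fintype Ω] [DecidableEq Ω] [MulAction G Ω]

theorem pent {K : Type} [DecidableEq K] {col : Ω → Ω → K} (sy : ∀ x y, col x y = col y x)
    (inv : ∀ (g : G) x y, col (g • x) (g • y) = col x y) (tr : ∀ x y : Ω, ∃ g : G, g • x = y) {i j : K} (hij : i ≠ j)
    (ij : ∀ u v, u ≠ v → col u v = i ∨ col u v = j)
    (mono : ∀ k x y z, x ≠ y → x ≠ z → y ≠ z → col x y = k → col x z = k → col y z = k → False)
    (two : ∀ k, k = i ∨ k = j → ∃ w a b, a ≠ b ∧ a ≠ w ∧ b ≠ w ∧ col w a = k ∧ col w b = k)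
    (ord : ∀ u v u' v', u ≠ v → u' ≠ v' → col u v = col u' v' → ∃ g : G, g • u = u' ∧ g • v = v') :
    ∃ V : FDRep ℂ G, Simple V ∧ Module.finrank ℂ V = 2 := by
  classical
  let N : K → Ω → Finset Ω := fun k x => univ.filter (fun y => y ≠ x ∧ col x y = k)
  have mN : ∀ k x y, y ∈ N k x ↔ y ≠ x ∧ col x y = k := by intro k x y; simp [N]
  have cN : ∀ k l, (k = i ∧ l = j) ∨ (k = j ∧ l = i) → ∀ x, (N k x).card = 2 := by
    intro k l hkl x
    have kl : ∀ u v, u ≠ v → col u v ≠ k → col u v = l := by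
      intro u v h h'
      rcases hkl with ⟨rfl, rfl⟩ | ⟨rfl, rfl⟩ <;> rcases ij u v h with e | e <;> simp_all
    refine le_antisymm ?_ ?_
    · by_contra h
      obtain ⟨a, ha, b, hb, d, hd, h1, h2, h3⟩ := two_lt_card.mp (not_le.mp h)
      rw [mN] at ha hb hd
      have q : ∀ a b, (a ≠ x ∧ col x a = k) → (b ≠ x ∧ col x b = k) → a ≠ b → col a b = l := fun a b ha hb h1 =>
        kl a b h1 fun h => mono k x a b ha.1.symm hb.1.symm h1 ha.2 hb.2 h
      exact mono l a b d h1 h2 h3 (q _ _ ha hb h1) (q _ _ ha hd h2) (q _ _ hb hd h3)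
    · obtain ⟨w, a, b, h1, h2, h3, h4, h5⟩ := two k (by tauto)
      obtain ⟨g, rfl⟩ := tr w x
      apply one_lt_card.mpr
      refine ⟨g • a, ?_, g • b, ?_, by simpa using h1⟩ <;> rw [mN, inv] <;> simp [*]
  have ci := cN i j (by simp)
  have cj := cN j i (by simp)
  let T : Matrix Ω Ω ℂ := fun x y => (if y ∈ N i x then 1 else 0) - (if y ∈ N j x then 1 else 0)
  have Ti : ∀ x y, y ≠ x → col x y = i → T x y = 1 := by
    intro x y h h'
    simp [T, mN, h, h', hij]
  have Tj : ∀ x y, y ≠ x → col x y = j → T x y = -1 := by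
    intro x y h h'
    simp [T, mN, h, h', hij.symm]
  have T0 : ∀ x, T x x = 0 := by intro x; simp [T, mN]
  have Ts : ∀ x y, T x y = T y x := by
    intro x y
    simp only [T, mN, sy x y, ne_comm]
  have c5 : Fintype.card Ω = 5 := by
    obtain ⟨w, -⟩ := two i (by simp)
    have : (univ : Finset Ω) = insert w (N i w ∪ N j w) := by
      ext y
      simp only [mem_univ, mem_insert, mem_union, mN, true_iff]
      by_cases h : y = w
      · exact Or.inl h
      · rcases ij w y (Ne.symm h) with e | e <;> simp [h, e]
    rw [← card_univ, this, card_insert_of_notMem (by simp [mN]), card_union_of_disjoint, ci, cj]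
    rw [disjoint_left]
    intro y h1 h2
    rw [mN] at h1 h2
    exact hij (h1.2.symm.trans h2.2)
  have row : ∀ x, ∑ y, T x y = 0 := by
    intro x
    simp only [T, sum_sub_distrib, sum_boole, filter_mem_eq_inter, univ_inter, ci, cj, sub_self]
  have col0 : ∀ y, ∑ x, T x y = 0 := by
    intro y; simp only [Ts _ y]; exact row y
  have pm : ∀ x y, y ≠ x → T x y = 1 ∨ T x y = -1 := by
    intro x y h
    rcases ij x y h.symm with e | e
    · exact Or.inl (Ti x y h e)
    · exact Or.inr (Tj x y h e)
  have pmc : ∀ x y, y ≠ x → (T x y = 1 → col x y = i) ∧ (T x y = -1 → col x y = j) := by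
    intro x y h
    rcases ij x y h.symm with e | e
    · refine ⟨fun _ => e, fun h' => ?_⟩
      rw [Ti x y h e] at h'; norm_num at h'
    · refine ⟨fun h' => ?_, fun _ => e⟩
      rw [Tj x y h e] at h'; norm_num at h'
  have sq : ∀ (ε : ℂ) x y, x ≠ y → ε * ε = 1 → T x y = ε → (∀ z, z ≠ x → z ≠ y → T x z = ε → T z y = ε → False) →
      (T * T) x y = -1 := by
    intro ε x y hxy he hT hz
    have h1 : ∑ z, (1 + ε * T x z) * (1 + ε * T z y) = 4 := by
      rw [← sum_subset (subset_univ ({x, y} : Finset Ω)), sum_pair hxy, T0, T0, hT, he]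
      · norm_num
      · intro z _ h
        simp only [mem_insert, mem_singleton, not_or] at h
        have he' : ε = 1 ∨ ε = -1 := mul_self_eq_one_iff.mp he
        have := hz z h.1 h.2
        rcases he' with rfl | rfl <;> rcases pm x z h.1 with e | e <;> rcases pm z y (Ne.symm h.2) with e' | e' <;>
          simp [e, e'] at this ⊢
    have h2 : ∑ z, (1 + ε * T x z) * (1 + ε * T z y) = 5 + (T * T) x y := by
      have : ∀ z, (1 + ε * T x z) * (1 + ε * T z y) = 1 + ε * T x z + ε * T z y + T x z * T z y := by
        intro z; linear_combination (T x z * T z y) * he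
      simp only [this, sum_add_distrib, ← mul_sum, row, col0, Matrix.mul_apply]
      simp [c5]
    rw [h2] at h1
    linear_combination h1
  obtain ⟨V, hV, h⟩ := rank3 (G := G) T (a0 := 5) (b0 := -1) (d0 := 0) (by
      intro g x y
      simp [T, mN, inv]) row col0 T0 (by norm_num) (by
      intro x y
      by_cases hxy : x = y
      · subst hxy
        have : ∀ z, T x z * T z x = 1 - (if x = z then 1 else 0) := by
          intro z
          by_cases h : x = z
          · subst h; simp [T0]
          · rw [Ts z x]
            rcases pm x z (Ne.symm h) with e | e <;> simp [e, h]
        simp only [Matrix.mul_apply, this, sum_sub_distrib]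
        simp [c5]; norm_num
      · rw [if_neg hxy, mul_zero, zero_add]
        rcases pm x y (Ne.symm hxy) with e | e
        · refine sq 1 x y hxy (by norm_num) e fun z h1 h2 h3 h4 => ?_
          exact mono i x y z hxy h1.symm h2.symm ((pmc x y (Ne.symm hxy)).1 e) ((pmc x z h1).1 h3)
            (by rw [sy]; exact (pmc z y h2.symm).1 h4)
        · refine sq (-1) x y hxy (by norm_num) e fun z h1 h2 h3 h4 => ?_
          exact mono j x y z hxy h1.symm h2.symm ((pmc x y (Ne.symm hxy)).2 e) ((pmc x z h1).2 h3)
            (by rw [sy]; exact (pmc z y h2.symm).2 h4)) (by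
      intro M hM
      obtain ⟨w, a, -, -, ha, -, ha', -⟩ := two i (by simp)
      obtain ⟨w', b, -, -, hb, -, hb', -⟩ := two j (by simp)
      refine ⟨M w w - (M w a + M w' b) / 2, (M w a + M w' b) / 2, (M w a - M w' b) / 2, fun x y => ?_⟩
      by_cases hxy : x = y
      · subst hxy
        obtain ⟨g, rfl⟩ := tr w x
        rw [T0, hM]; simp
      rw [if_neg hxy]
      rcases ij x y hxy with e | e
      · obtain ⟨g, rfl, rfl⟩ := ord w a x y ha.symm hxy (ha'.trans e.symm)
        rw [hM, Ti _ _ (Ne.symm hxy) e]; ring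
      · obtain ⟨g, rfl, rfl⟩ := ord w' b x y hb.symm hxy (hb'.trans e.symm)
        rw [hM, Tj _ _ (Ne.symm hxy) e]; ring) (by omega)
  exact ⟨V, hV, by omega⟩

theorem Ctx.case_p2 [hp : Fact (Nat.Prime 2)] (c : Ctx 2 G Ω) :
    ∃ V : FDRep ℂ G, Simple V ∧ 2 ∣ Module.finrank ℂ V ∧ ¬ 2 ^ 2 ∣ Module.finrank ℂ V := by
  classical
  obtain ⟨a, ha, hcard⟩ := c.mod
  let col : Ω → Ω → Set (Finset Ω) := fun x y => MulAction.orbit G ({x, y} : Finset Ω)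
  have sy : ∀ x y, col x y = col y x := fun x y => by simp only [col, pair_comm]
  have inv : ∀ (g : G) x y, col (g • x) (g • y) = col x y := by
    intro g x y
    have : ({g • x, g • y} : Finset Ω) = g • {x, y} := by
      rw [smul_finset_insert, smul_finset_singleton]
    simp only [col]; rw [this, MulAction.orbit_smul]
  have tr : ∀ x y : Ω, ∃ g : G, g • x = y := by
    intro x y
    obtain ⟨g, hg⟩ := c.MT_pred {x} (fun _ => y) (by simp) (by simp)
    exact ⟨g, hg x (by simp)⟩
  have sw : ∀ {Q : Sylow 2 G} {u v : Ω}, u ≠ v → Stb Q {u, v} → ∃ q ∈ Q, q • u = v ∧ q • v = u := by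
    intro Q u v huv hQ
    obtain ⟨C, hC, h1, -, h2, -⟩ := c.decomp (by rw [card_pair huv]; norm_num) (by rw [card_pair huv]) hQ
    obtain rfl := eq_of_subset_of_card_le hC (by rw [h1, card_pair huv])
    obtain ⟨q, hq, e⟩ := mem_Qorb.mp (show v ∈ Qorb Q u by rw [h2 u (by simp)]; simp)
    refine ⟨q, hq, e, ?_⟩
    have := hQ.smul_mem hq (show v ∈ ({u, v} : Finset Ω) by simp)
    simp only [mem_insert, mem_singleton] at this
    refine this.resolve_right fun h => huv ?_
    rw [← e] at h; rw [← e]; exact (smul_left_cancel q h).symm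
  have fix1 : ∀ (Q : Sylow 2 G) w w', w ∈ FixS Ω Q → w' ∈ FixS Ω Q → w = w' := fun Q w w' h h' =>
    card_le_one.mp (c.card_fix Q).le w h w' h'
  have ord : ∀ u v u' v', u ≠ v → u' ≠ v' → col u v = col u' v' → ∃ g : G, g • u = u' ∧ g • v = v' := by
    intro u v u' v' h h' e
    obtain ⟨g, hg⟩ : ({u', v'} : Finset Ω) ∈ col u v := e ▸ MulAction.mem_orbit_self _
    simp only [smul_finset_insert, smul_finset_singleton] at hg
    have h1 : g • u ∈ ({u', v'} : Finset Ω) := by rw [← hg]; simp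
    have h2 : g • v ∈ ({u', v'} : Finset Ω) := by rw [← hg]; simp
    have h3 : g • u ≠ g • v := by simpa using h
    simp only [mem_insert, mem_singleton] at h1 h2
    rcases h1 with e1 | e1 <;> rcases h2 with e2 | e2
    · exact absurd (e1.trans e2.symm) h3
    · exact ⟨g, e1, e2⟩
    · obtain ⟨Q, hQ⟩ := c.hc {u', v'}
      obtain ⟨q, -, e3, e4⟩ := sw h' hQ
      exact ⟨q * g, by rw [mul_smul, e1, e4], by rw [mul_smul, e2, e3]⟩
    · exact absurd (e1.trans e2.symm) h3
  let P : Set (Finset Ω) → Set (Finset Ω) → Prop := fun i j => ∃ (Q : Sylow 2 G) (u v w : Ω),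
    u ≠ v ∧ Stb Q {u, v} ∧ w ∈ FixS Ω Q ∧ col u v = i ∧ col w u = j
  have Pf : ∀ {i j j'}, P i j → P i j' → j = j' := by
    rintro i j j' ⟨Q, u, v, w, h1, h2, h3, rfl, rfl⟩ ⟨Q', u', v', w', h1', h2', h3', h4', rfl⟩
    obtain ⟨g, hg⟩ : ({u', v'} : Finset Ω) ∈ col u v := h4' ▸ MulAction.mem_orbit_self _
    obtain ⟨k, hk, hk'⟩ := conjT hg h2 h2'
    have : w' = k • w := fix1 Q' _ _ h3' (by rw [FixS_smul hk']; exact smul_mem_smul_finset h3)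
    rw [← inv k w u, ← this]
    have hku : k • u ∈ ({u', v'} : Finset Ω) := by rw [← hk]; exact smul_mem_smul_finset (by simp)
    simp only [mem_insert, mem_singleton] at hku
    rcases hku with e | e
    · rw [e]
    · obtain ⟨q, hq, e3, e4⟩ := sw h1' h2'
      rw [e, ← inv q w' v', e4, mem_FixS.mp h3' q hq]
  have tri0 : ∀ (Q : Sylow 2 G) x y z, x ≠ y → x ≠ z → y ≠ z → Stb Q {x, y, z} → x ∈ FixS Ω Q →
      P (col y z) (col x y) ∧ col x y = col x z := by
    intro Q x y z h1 h2 h3 hQ hx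
    have hs : Stb Q {y, z} := by
      intro q hq
      have : ({y, z} : Finset Ω) = ({x, y, z} : Finset Ω).erase x := by
        rw [erase_insert (by simp [h1, h2])]
      rw [this, smul_erase', hQ q hq, mem_FixS.mp hx q hq]
    refine ⟨⟨Q, y, z, x, h3, hs, hx, rfl, rfl⟩, ?_⟩
    obtain ⟨q, hq, e3, e4⟩ := sw h3 hs
    rw [← inv q x y, e3, mem_FixS.mp hx q hq]
  have tri : ∀ x y z, x ≠ y → x ≠ z → y ≠ z → (P (col y z) (col x y) ∧ col x y = col x z) ∨
      (P (col x z) (col y x) ∧ col y x = col y z) ∨ (P (col x y) (col z x) ∧ col z x = col z y) := by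
    intro x y z h1 h2 h3
    obtain ⟨Q, hQ⟩ := c.hc {x, y, z}
    have h33 : ({x, y, z} : Finset Ω).card = 3 := by rw [card_eq_three]; exact ⟨x, y, z, h1, h2, h3, rfl⟩
    obtain ⟨C, hC, hC2, -, -, hF⟩ := c.decomp (by omega) (by omega) hQ
    have : 0 < (({x, y, z} : Finset Ω) \ C).card := by rw [card_sdiff_of_subset hC]; omega
    obtain ⟨w, hw⟩ := card_pos.mp this
    have hwF := hF hw
    have hw := (mem_sdiff.mp hw).1
    simp only [mem_insert, mem_singleton] at hw
    rcases hw with rfl | rfl | rfl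
    · exact Or.inl (tri0 Q _ _ _ h1 h2 h3 hQ hwF)
    · exact Or.inr (Or.inl (tri0 Q _ _ _ h1.symm h3 h2 (by rwa [insert_comm]) hwF))
    · exact Or.inr (Or.inr (tri0 Q _ _ _ h2.symm h3.symm h1 (by convert hQ using 1; ext; simp; tauto) hwF))
  have at_w : ∀ w u v, u ≠ v → ∃ y, y ≠ w ∧ col w y = col u v := by
    intro w u v h
    obtain ⟨g, rfl⟩ := tr u w
    exact ⟨g • v, by simpa using h.symm, inv g u v⟩
  have two : ∀ u v, u ≠ v → ∃ w a b, a ≠ b ∧ a ≠ w ∧ b ≠ w ∧ col w a = col u v ∧ col w b = col u v := by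
    intro u v h
    obtain ⟨Q, -⟩ := c.hc ∅
    obtain ⟨w, hw⟩ := card_pos.mp (show 0 < (FixS Ω Q).card by rw [c.card_fix]; norm_num)
    obtain ⟨y, hy, e⟩ := at_w w u v h
    have hyF : y ∉ FixS Ω Q := fun h => hy (fix1 Q _ _ h hw)
    rw [mem_FixS] at hyF
    push Not at hyF
    obtain ⟨q, hq, hqy⟩ := hyF
    have hw' := mem_FixS.mp hw q hq
    refine ⟨w, q • y, y, hqy, ?_, hy, ?_, e⟩
    · intro h; rw [← hw'] at h; exact hy (smul_left_cancel q h)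
    · conv_lhs => rw [← hw']
      rw [inv, e]
  have surj : ∀ u v, u ≠ v → ∃ u' v', u' ≠ v' ∧ P (col u' v') (col u v) := by
    intro u v h
    obtain ⟨w, a, b, h1, h2, h3, h4, h5⟩ := two u v h
    rcases tri w a b h2.symm h3.symm h1 with h | h | h
    · exact ⟨a, b, h1, by rw [← h4]; exact h.1⟩
    · exact ⟨w, b, h3.symm, by rw [← h4, sy w a]; exact h.1⟩
    · exact ⟨w, a, h2.symm, by rw [← h5, sy w b]; exact h.1⟩
  have dich : ∀ w x y, x ≠ w → y ≠ w → col w x ≠ col w y → (P (col w y) (col w x) ∧ col x y = col w x) ∨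
      (P (col w x) (col w y) ∧ col x y = col w y) := by
    intro w x y hx hy h
    have hxy : x ≠ y := by rintro rfl; exact h rfl
    rcases tri w x y hx.symm hy.symm hxy with h' | h' | h'
    · exact absurd h'.2 h
    · rw [sy x w] at h'; exact Or.inl ⟨h'.1, h'.2.symm⟩
    · rw [sy y w, sy y x] at h'; exact Or.inr ⟨h'.1, h'.2.symm⟩
  let N : Set (Finset Ω) → Ω → Finset Ω := fun k x => univ.filter (fun y => y ≠ x ∧ col x y = k)
  have mN : ∀ k x y, y ∈ N k x ↔ y ≠ x ∧ col x y = k := by intro k x y; simp [N]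
  have reg : ∀ k x y, (N k x).card = (N k y).card := by
    intro k x y
    obtain ⟨g, rfl⟩ := tr x y
    rw [← card_smul_finset g]
    congr 1
    ext z
    rw [mem_smulF, mN, mN, ← inv g x, smul_inv_smul, Ne, inv_smul_eq_iff]
  have less : ∀ w x y, x ≠ w → y ≠ w → col w x ≠ col w y → ¬ P (col w y) (col w x) →
      (N (col w x) w).card < (N (col w y) w).card := by
    intro w x y hx hy h hP
    rw [reg (col w y) w y, ← Nat.succ_le_iff, Nat.succ_eq_add_one, ← card_insert_of_notMem (a := w) (by simp [mN])]
    apply card_le_card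
    intro z hz
    rcases mem_insert.mp hz with rfl | hz
    · exact (mN _ _ _).mpr ⟨hy.symm, sy _ _⟩
    · obtain ⟨h1, h2⟩ := (mN _ _ _).mp hz
      rcases dich w z y h1 hy (by rw [h2]; exact h) with h' | h'
      · rw [h2] at h'; exact absurd h'.1 hP
      · refine (mN _ _ _).mpr ⟨?_, by rw [sy]; exact h'.2⟩
        rintro rfl; exact h h2.symm
  by_cases one : ∀ w x y, x ≠ w → y ≠ w → col w x = col w y
  · have hMT : MT G Ω 2 := by
      refine MT_of_St (by omega) fun D x y hD hx hy => ?_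
      obtain ⟨z, rfl⟩ := card_eq_one.mp (show D.card = 1 by omega)
      simp only [mem_singleton] at hx hy
      obtain ⟨g, h1, h2⟩ := ord z x z y (Ne.symm hx) (Ne.symm hy) (one z x y hx hy)
      exact ⟨g, by simpa using h1, h2⟩
    obtain ⟨V, hV, hd⟩ := theoremA (k := 1) hMT (by omega)
    obtain ⟨h1, h2⟩ := c.ppart hMT
    have := choose_part c.hn ⟨a, by omega⟩ h1 h2
    exact ⟨V, hV, by rw [hd]; exact this⟩
  push Not at one
  obtain ⟨w, x, y, hx, hy, hne⟩ := one
  obtain ⟨y0, hy0, hmax⟩ := exists_max_image (univ.erase w) (fun y => (N (col w y) w).card) ⟨x, by simp [hx]⟩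
  have hy0 : y0 ≠ w := by simpa using hy0
  obtain ⟨y1, hy1, hne1⟩ : ∃ y1, y1 ≠ w ∧ col w y1 ≠ col w y0 := by
    by_cases h : col w x = col w y0
    · exact ⟨y, hy, fun h' => hne (h.trans h'.symm)⟩
    · exact ⟨x, hx, h⟩
  have toi : ∀ y, y ≠ w → col w y ≠ col w y0 → P (col w y) (col w y0) := by
    intro y hy h
    by_contra hP
    have := less w y0 y hy0 hy h.symm hP
    have := hmax y (by simp [hy])
    omega
  have ij' : ∀ y, y ≠ w → col w y = col w y0 ∨ col w y = col w y1 := by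
    intro y hy
    by_contra h
    push Not at h
    rcases dich w y y1 hy hy1 h.2 with h' | h'
    · exact h.1 (Pf h'.1 (toi y1 hy1 hne1))
    · exact hne1 (Pf h'.1 (toi y hy h.1))
  have ij : ∀ u v, u ≠ v → col u v = col w y0 ∨ col u v = col w y1 := by
    intro u v h
    obtain ⟨y, hy, e⟩ := at_w w u v h
    rw [← e]; exact ij' y hy
  have Pji := toi y1 hy1 hne1
  have Pij : P (col w y0) (col w y1) := by
    obtain ⟨u, v, h, hP⟩ := surj w y1 hy1.symm
    rcases ij u v h with e | e <;> rw [e] at hP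
    · exact hP
    · exact absurd (Pf hP Pji) hne1
  obtain ⟨V, hV, hd⟩ := pent (G := G) (col := col) sy inv tr hne1.symm ij (by
    intro k x y z h1 h2 h3 e1 e2 e3
    have hP : P k k := by
      rcases tri x y z h1 h2 h3 with h | h | h
      · rw [e3, e1] at h; exact h.1
      · rw [sy y x, e2, e1] at h; exact h.1
      · rw [sy z x, e2, e1] at h; exact h.1
    rcases ij x y h1 with e | e <;> rw [e1] at e <;> subst e
    · exact hne1 (Pf Pij hP)
    · exact hne1 (Pf hP Pji)) (by
    rintro k (rfl | rfl)
    · exact two w y0 hy0.symm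
    · exact two w y1 hy1.symm) ord
  exact ⟨V, hV, by rw [hd], by rw [hd]; norm_num⟩

end syl19

section syl20
variable {G Ω : Type} [Group G] [Finite G] [Fintype Ω] [DecidableEq Ω] [MulAction G Ω] {p : ℕ} [hp : Fact p.Prime]

theorem Ctx.big (c : Ctx p G Ω) (h3 : 3 ≤ p) (hn : 3 * p - 1 ≤ Fintype.card Ω) (hH : ∀ i < p, HH p G Ω i) :
    Big p G Ω := by
  have h1 := c.homog_p h3 (by omega) (hH 1 (by omega))
  refine ⟨c, h3, hn, hH, fun S S' h h' h2 => ?_⟩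
  obtain ⟨i, hi⟩ := Nat.exists_eq_add_of_le h'
  exact c.homog h1 (i := i) (by omega) (hH i (by omega)) S S' hi (by omega)

theorem finalG [IsPreprimitive G Ω] (hc : ∀ s : Finset Ω, ∃ Q : Sylow p G, Stb Q s)
    (hF : ¬ Fx p G (univ : Finset Ω)) :
    ∃ V : FDRep ℂ G, Simple V ∧ p ∣ Module.finrank ℂ V ∧ ¬ (p ^ 2 ∣ Module.finrank ℂ V) := by
  have c : Ctx p G Ω := ⟨hc, allZ hc hF, by
    by_contra h
    exact hF (Fx_of_lt hc (by rw [card_univ]; omega))⟩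
  obtain ⟨a, ha, hn⟩ := c.mod
  rcases hp.out.eq_two_or_odd with rfl | ho
  · exact c.case_p2
  have h2 := hp.out.two_le
  have h3 : 3 ≤ p := by omega
  rcases (by omega : a = 2 ∨ a = 3 ∨ 4 ≤ a) with rfl | rfl | h4
  · exact c.case_two h3 hn
  · rcases (by omega : p = 3 ∨ 5 ≤ p) with rfl | h5
    · by_cases hH : HH 3 G Ω 1
      · refine (c.big le_rfl (by omega) fun i hi => ?_).fin
        interval_cases i
        · intro Q C S S' _ _ _ h h'
          rw [card_eq_zero.mp h, card_eq_zero.mp h']; exact ⟨1, one_smul _ _⟩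
        · exact hH
        · intro Q C S S' _ hS hS' h h'
          have := c.card_fix Q
          rw [eq_of_subset_of_card_le hS (by omega), eq_of_subset_of_card_le hS' (by omega)]
          exact ⟨1, one_smul _ _⟩
      · exact c.case_eight (by omega) hH
    · exact (c.big h3 (by omega) fun i hi => c.HH_three hn h5 i).fin
  · have : 4 * p ≤ a * p := Nat.mul_le_mul_right _ h4
    exact (c.big h3 (by omega) fun i hi => c.HH_of_big (by omega) hi).fin

theorem hc_of (hconc : ∀ s : Set Ω, (Nat.card (MulAction.orbit G s)).Coprime p) (s : Finset Ω) :
    ∃ Q : Sylow p G, Stb Q s := by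
  obtain ⟨Q⟩ : Nonempty (Sylow p G) := inferInstance
  have h1 := (hp.out.coprime_iff_not_dvd).mp (hconc (s : Set Ω)).symm
  obtain ⟨⟨t, g, rfl⟩, ht⟩ := Q.isPGroup'.nonempty_fixed_point_of_prime_not_dvd_card (MulAction.orbit G (s : Set Ω)) h1
  have hQ : Stb Q (g • s) := by
    intro q hq
    have := congrArg Subtype.val (ht ⟨q, hq⟩)
    apply coe_injective
    rw [coe_smul_finset, coe_smul_finset]
    exact this
  obtain ⟨Q', hQ'⟩ := conj_syl Q g⁻¹
  exact ⟨Q', by simpa using smul_stb hQ' hQ⟩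

end syl20
end

/-- Lemma 4.4 of the paper. Let `H ≤ S_n` be primitive with `p` dividing `|H|`,
with abelian Sylow `p`-subgroups and `H = O^{p'}(H)`. If `H` is `p`-concealed
(every orbit of `H` on the power set of `{1, …, n}` has size coprime to `p`), then
`H` has an irreducible complex character whose degree has `p`-part exactly `p`. -/
theorem p_concealed_char (p n : ℕ) (hp : p.Prime)
    (H : Subgroup (Equiv.Perm (Fin n)))
    (hprim : IsPrimitiveAction H (Fin n))
    (hdvd : p ∣ Nat.card H)
    (hsylab : ∀ Q : Sylow p H, ∀ a b : (Q : Subgroup ↥H), a * b = b * a)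
    (hOp' : ∀ N : Subgroup ↥H, N.Normal → N.index.Coprime p → N = ⊤)
    (hconcealed : ∀ s : Set (Fin n), (Nat.card (MulAction.orbit H s)).Coprime p) :
    ∃ V : FDRep ℂ ↥H, Simple V ∧
      p ∣ Module.finrank ℂ V ∧ ¬ (p ^ 2 ∣ Module.finrank ℂ V) := by
  haveI : Fact p.Prime := ⟨hp⟩
  haveI : IsPretransitive H (Fin n) := hprim.1
  haveI : IsPreprimitive H (Fin n) := { isTrivialBlock_of_isBlock := fun {B} h => hprim.2 B h }
  refine finalG (Ω := Fin n) (hc_of hconcealed) ?_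
  rintro ⟨Q, hQ⟩
  have h1 : ∀ g ∈ Q, g = 1 := by
    intro g hg
    apply Subtype.ext
    ext x
    have := hQ g hg x (Finset.mem_univ _)
    exact congrArg Fin.val this
  have h2 : (Q : Subgroup ↥H) = ⊥ := (Subgroup.eq_bot_iff_forall _).mpr h1
  exact Q.ne_bot_of_dvd_card hdvd h2
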